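/- For every permutation w ∈ S∞ and every flag φ, the set RFC(w,φ), with the Morse–Schilling crystal operators of RF_n(w) restricted to it (for n sufficiently large that RFC(w,φ) ⊆ RF_n(w)), is a disjoint union of Demazure crystals. -/

import Mathlib

noncomputable section
attribute [local instance] Classical.propDecidable

/-! ### Words, permutations, reduced words -/

/-- The adjacent transposition `s_i` exchanging `i` and `i+1`. -/
def sPerm (i : ℕ) : Equiv.Perm ℕ := Equiv.swap i (i + 1)

/-- The permutation `s_{i_1} ⋯ s_{i_n}` represented by the word `i_1 ⋯ i_n`. -/
def wordPerm (ρ : List ℕ) : Equiv.Perm ℕ := (ρ.map sPerm).prod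

/-- A word whose letters are positive integers. -/
def PosWord (ρ : List ℕ) : Prop := ∀ x ∈ ρ, 1 ≤ x

/-- A reduced word: a word of positive integers of minimal length among all words of
positive integers representing the same permutation. -/
def IsReducedWord (ρ : List ℕ) : Prop :=
  PosWord ρ ∧ ∀ σ : List ℕ, PosWord σ → wordPerm σ = wordPerm ρ → ρ.length ≤ σ.length

/-- `ρ` is a reduced word for the permutation `w`. -/
def IsReducedWordFor (w : Equiv.Perm ℕ) (ρ : List ℕ) : Prop :=
  IsReducedWord ρ ∧ wordPerm ρ = w

/-- A member of `S∞`: a permutation of the positive integers (it fixes `0`)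
fixing all but finitely many points. -/
def FinitaryPerm (w : Equiv.Perm ℕ) : Prop := w 0 = 0 ∧ {i : ℕ | w i ≠ i}.Finite

/-- A flag: a weakly increasing function `φ : ℤ_{>0} → ℤ_{>0}` with `φ(n) ≥ n`. -/
def IsFlag (φ : ℕ → ℕ) : Prop :=
  (∀ m n : ℕ, 1 ≤ m → m ≤ n → φ m ≤ φ n) ∧ ∀ n : ℕ, 1 ≤ n → n ≤ φ n

/-- A weak composition, as a function on the positive integers (value `0` at `0`)
with finitely many nonzero entries. -/
def WeakComp (α : ℕ → ℕ) : Prop := α 0 = 0 ∧ {i : ℕ | α i ≠ 0}.Finite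

/-- `φ - e_i`, i.e. `l ↦ φ(l) - δ_{il}`. -/
def subE (φ : ℕ → ℕ) (i : ℕ) : ℕ → ℕ := fun l => if l = i then φ l - 1 else φ l

/-- The right action of `s_i` on weak compositions, swapping entries `i` and `i+1`. -/
def swapC (α : ℕ → ℕ) (i : ℕ) : ℕ → ℕ := fun j => α (sPerm i j)

/-- `α` has length `k`: `k` is minimal with `α i = 0` for all `i > k`. -/
def HasLen (α : ℕ → ℕ) (k : ℕ) : Prop :=
  (∀ i, k < i → α i = 0) ∧ ∀ m, (∀ i, m < i → α i = 0) → k ≤ m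

/-! ### Coxeter–Knuth equivalence -/

/-- One Coxeter–Knuth move. -/
def CKStep (u v : List ℕ) : Prop :=
  (∃ (a b : List ℕ) (x y z : ℕ), y < x ∧ x < z ∧
      u = a ++ [x, y, z] ++ b ∧ v = a ++ [x, z, y] ++ b) ∨
  (∃ (a b : List ℕ) (x y z : ℕ), y < z ∧ z < x ∧
      u = a ++ [x, y, z] ++ b ∧ v = a ++ [y, x, z] ++ b) ∨
  (∃ (a b : List ℕ) (i : ℕ),
      u = a ++ [i, i + 1, i] ++ b ∧ v = a ++ [i + 1, i, i + 1] ++ b)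

/-- Coxeter–Knuth equivalence: the transitive (symmetric, reflexive) closure of `CKStep`. -/
def CKEquiv : List ℕ → List ℕ → Prop := Relation.EqvGen CKStep

/-! ### Run factorizations and weak descent tableaux -/

/-- The run factorization of a word into maximal strictly increasing blocks
(listed from left to right). -/
def runFact : List ℕ → List (List ℕ)
  | [] => []
  | a :: rest =>
    match runFact rest with
    | [] => [[a]]
    | r :: rs => if a < r.headI then (a :: r) :: rs else [a] :: r :: rs

/-- Auxiliary: rows of the remaining blocks, given the row of the previous block. -/
def wdtRowsAux : ℤ → List (List ℕ) → List ℤ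
  | _, [] => []
  | prev, b :: bs =>
      min (prev - 1) (b.headI : ℤ) :: wdtRowsAux (min (prev - 1) (b.headI : ℤ)) bs

/-- The row indices assigned to the blocks of a run factorization (blocks listed
left to right): the leftmost block goes to the row indexed by its first letter, and each
subsequent block goes to the row indexed by its first letter if this is below the previous
block's row, and otherwise directly below the previous block's row. -/
def wdtRows : List (List ℕ) → List ℤ
  | [] => []
  | b :: bs => (b.headI : ℤ) :: wdtRowsAux (b.headI : ℤ) bs

/-- A tableau: rows indexed by `ℤ` (bottom to top), columns indexed by `ℕ` starting at `1`;
the value `0` means that there is no box, a nonzero value is the (positive) entry. -/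
abbrev Tableau := ℤ → ℕ → ℕ

/-- The weak descent tableau of a word. -/
def weakDesTab (ρ : List ℕ) : Tableau := fun r c =>
  if c = 0 then 0
  else
    match ((wdtRows (runFact ρ)).zip (runFact ρ)).find? (fun p => decide (p.1 = r)) with
    | some p => p.2.getD (c - 1) 0
    | none => 0

/-- A word is non-virtual if its weak descent tableau only occupies rows of positive index. -/
def NonVirtual (ρ : List ℕ) : Prop := ∀ r ∈ wdtRows (runFact ρ), 1 ≤ r

/-- The shape of a tableau: the number of boxes in each (positively indexed) row. -/
def shapeOf (T : Tableau) : ℕ → ℕ := fun i => Set.ncard {c : ℕ | T (i : ℤ) c ≠ 0}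

/-- The weak descent composition of a word: the shape of its weak descent tableau. -/
def desComp (ρ : List ℕ) : ℕ → ℕ := shapeOf (weakDesTab ρ)

/-- Partial-sum (dominance) order on weak compositions. -/
def compLE (μ ν : ℕ → ℕ) : Prop :=
  ∀ k : ℕ, ∑ i ∈ Finset.Icc 1 k, μ i ≤ ∑ i ∈ Finset.Icc 1 k, ν i

/-- A Yamanouchi reduced word: a non-virtual reduced word that is minimal in its
Coxeter–Knuth class among non-virtual words, for the order
`ρ ≤ τ ↔ ρ ~ τ ∧ des ρ ≤ des τ`. -/
def Yamanouchi (ρ : List ℕ) : Prop :=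
  IsReducedWord ρ ∧ NonVirtual ρ ∧
    ∀ σ : List ℕ, NonVirtual σ → CKEquiv ρ σ → compLE (desComp ρ) (desComp σ)

/-- The (unique) Yamanouchi reduced word Coxeter–Knuth equivalent to `ρ`. -/
def hatRho (ρ : List ℕ) : List ℕ :=
  if h : ∃ σ, Yamanouchi σ ∧ CKEquiv ρ σ then h.choose else []

/-- The weak Edelman–Greene insertion tableau of a word: the weak descent tableau of the
unique Yamanouchi reduced word Coxeter–Knuth equivalent to it. -/
def hatP (ρ : List ℕ) : Tableau := weakDesTab (hatRho ρ)

/-! ### Factorizations -/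

/-- The factorization `f : ℕ → List ℕ` stores the block `ρ^{(i)}` at index `i ≥ 1`
(blocks indexed from the right); the largest index of a nonempty block. -/
def topIdx (f : ℕ → List ℕ) : ℕ := sSup {i : ℕ | f i ≠ []}

/-- The concatenation `ρ^{(top)} ⋯ ρ^{(i+1)} ρ^{(i)}` of the blocks of `f` with index `≥ i`. -/
def factWordGe (f : ℕ → List ℕ) (i : ℕ) : List ℕ :=
  ((((List.range (topIdx f + 1)).reverse).filter (fun j => decide (i ≤ j))).map f).foldr
    (· ++ ·) []

/-- The underlying word of a factorization. -/
def factWord (f : ℕ → List ℕ) : List ℕ := factWordGe f 0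

/-- The weak Edelman–Greene recording tableau of a factorization: it has the same shape as
the weak EG insertion tableau of the underlying word, and has entry `i` in all boxes of
`P̂(ρ^{(k)}|⋯|ρ^{(i)})` that are not in `P̂(ρ^{(k)}|⋯|ρ^{(i+1)})`. -/
def hatQfact (f : ℕ → List ℕ) : Tableau := fun r c =>
  sSup {i : ℕ | 1 ≤ i ∧ hatP (factWordGe f i) r c ≠ 0 ∧ hatP (factWordGe f (i + 1)) r c = 0}

/-- Every block is strictly increasing. -/
def IncreasingFact (f : ℕ → List ℕ) : Prop := ∀ i, List.Chain' (· < ·) (f i)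

/-- The factorization is `φ`-flagged: every nonempty block `ρ^{(i)}` has first letter
`ρ^{(i)}_1` with `φ(ρ^{(i)}_1) ≥ i`. -/
def FlaggedFact (φ : ℕ → ℕ) (f : ℕ → List ℕ) : Prop :=
  ∀ i, f i ≠ [] → i ≤ φ ((f i).headI)

/-- `RFC(w, φ)`: all `φ`-flagged increasing factorizations of reduced words for `w`. -/
def RFCset (w : Equiv.Perm ℕ) (φ : ℕ → ℕ) : Set (ℕ → List ℕ) :=
  {f | f 0 = [] ∧ {i : ℕ | f i ≠ []}.Finite ∧ IncreasingFact f ∧ FlaggedFact φ f ∧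
       IsReducedWordFor w (factWord f)}

/-- `RF_n(w)`: increasing factorizations of reduced words for `w` with exactly `n` blocks
(indexed `1, …, n`, possibly empty). -/
def RFn (n : ℕ) (w : Equiv.Perm ℕ) : Set (ℕ → List ℕ) :=
  {f | f 0 = [] ∧ (∀ j, n < j → f j = []) ∧ IncreasingFact f ∧
       IsReducedWordFor w (factWord f)}

/-- `RFC_n(w, φ)`: the `φ`-flagged elements of `RF_n(w)`. -/
def RFCn (n : ℕ) (w : Equiv.Perm ℕ) (φ : ℕ → ℕ) : Set (ℕ → List ℕ) :=
  {f | f ∈ RFn n w ∧ FlaggedFact φ f}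

/-! ### Morse–Schilling crystal operators -/

/-- Pairing procedure: first argument is the block `r^{(i)}` in *decreasing* order, second is
the not-yet-paired part of the block `r^{(i+1)}` (in increasing order). Each letter `b` of
`r^{(i)}`, from largest to smallest, is paired with the smallest still unpaired letter of
`r^{(i+1)}` strictly larger than `b`. Returns the unpaired letters of `r^{(i+1)}`. -/
def unpairedUpper : List ℕ → List ℕ → List ℕ
  | [], A => A
  | b :: bs, A =>
    match A.find? (fun a => decide (b < a)) with
    | some a => unpairedUpper bs (A.erase a)
    | none => unpairedUpper bs A

/-- As in `unpairedUpper`, but returns the unpaired letters of `r^{(i)}`. -/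
def unpairedLower : List ℕ → List ℕ → List ℕ
  | [], _ => []
  | b :: bs, A =>
    match A.find? (fun a => decide (b < a)) with
    | some a => unpairedLower bs (A.erase a)
    | none => b :: unpairedLower bs A

/-- Insert a letter into a weakly increasing list, keeping it increasing. -/
def insAsc (x : ℕ) : List ℕ → List ℕ
  | [] => [x]
  | y :: ys => if x ≤ y then x :: y :: ys else y :: insAsc x ys

/-- The Morse–Schilling raising operator `e_i`: if every letter of block `i+1` is paired,
the result is `none` (i.e. `0`); otherwise the largest unpaired letter `a` of block `i+1` is
removed and `a + s` is added to block `i`, where `s = min {j ≥ 0 | a+j+1 ∉ r^{(i+1)}}`. -/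
def msE (i : ℕ) (f : ℕ → List ℕ) : Option (ℕ → List ℕ) :=
  let B := f i
  let A := f (i + 1)
  let L := unpairedUpper B.reverse A
  if L = [] then none
  else
    let a := L.foldr max 0
    let s := sInf {j : ℕ | (a + j + 1) ∉ A}
    some (Function.update (Function.update f (i + 1) (A.erase a)) i (insAsc (a + s) B))

/-- The Morse–Schilling lowering operator `f_i`: if every letter of block `i` is paired,
the result is `none`; otherwise the smallest unpaired letter `b` of block `i` is removed and
`b - t` is added to block `i+1`, where `t = min {j ≥ 0 | b-j-1 ∉ r^{(i)}}`. -/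
def msF (i : ℕ) (f : ℕ → List ℕ) : Option (ℕ → List ℕ) :=
  let B := f i
  let A := f (i + 1)
  let R := unpairedLower B.reverse A
  if R = [] then none
  else
    let b := R.foldr min R.headI
    let t := sInf {j : ℕ | (b - j - 1) ∉ B}
    some (Function.update (Function.update f i (B.erase b)) (i + 1) (insAsc (b - t) A))

/-- Iteration `e_j^k` of the raising operator. -/
def msEIter (j : ℕ) : ℕ → (ℕ → List ℕ) → Option (ℕ → List ℕ)
  | 0, f => some f
  | k + 1, f => (msE j f).bind (msEIter j k)

/-- The Demazure operator `𝔇_j` on subsets of the crystal `RF_n(w)`: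
`𝔇_j X = {b ∈ RF_n(w) | e_j^k(b) ∈ X for some k ≥ 0}`. -/
def demOp (n : ℕ) (w : Equiv.Perm ℕ) (j : ℕ) (X : Set (ℕ → List ℕ)) : Set (ℕ → List ℕ) :=
  {b | b ∈ RFn n w ∧ ∃ (k : ℕ) (c : ℕ → List ℕ), msEIter j k b = some c ∧ c ∈ X}

/-- `𝔇_{i_1} 𝔇_{i_2} ⋯ 𝔇_{i_k} X` for a word `i_1 i_2 ⋯ i_k` (the head is applied last). -/
def demWord (n : ℕ) (w : Equiv.Perm ℕ) : List ℕ → Set (ℕ → List ℕ) → Set (ℕ → List ℕ)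
  | [], X => X
  | j :: rest, X => demOp n w j (demWord n w rest X)

/-- `𝔇_{b↓a} = 𝔇_{b-1} 𝔇_{b-2} ⋯ 𝔇_a` (the identity when `b ≤ a`). -/
def demDown (n : ℕ) (w : Equiv.Perm ℕ) (b a : ℕ) (X : Set (ℕ → List ℕ)) :
    Set (ℕ → List ℕ) :=
  demWord n w ((List.range' a (b - a)).reverse) X

/-! ### Key tableaux -/

/-- A key tableau: a filling of a left-justified diagram in the positively indexed rows,
with positive entries, weakly decreasing rows, distinct column entries, and the key
condition (c) of Assaf–Schilling. -/
def IsKeyTableau (T : Tableau) : Prop :=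
  (∀ (r : ℤ) (c : ℕ), r ≤ 0 → T r c = 0) ∧
  (∀ r : ℤ, T r 0 = 0) ∧
  {p : ℤ × ℕ | T p.1 p.2 ≠ 0}.Finite ∧
  (∀ (r : ℤ) (c : ℕ), 1 ≤ c → T r (c + 1) ≠ 0 → T r c ≠ 0) ∧
  (∀ (r : ℤ) (c : ℕ), 1 ≤ c → T r (c + 1) ≠ 0 → T r (c + 1) ≤ T r c) ∧
  (∀ (r r' : ℤ) (c : ℕ), r ≠ r' → T r c ≠ 0 → T r' c ≠ 0 → T r c ≠ T r' c) ∧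
  (∀ (r r' : ℤ) (c : ℕ), r < r' → T r c ≠ 0 → T r' c ≠ 0 → T r' c < T r c →
      T r (c + 1) ≠ 0 ∧ T r' c < T r (c + 1))

/-- The tableau is `φ`-flagged: every entry in row `i` is at most `φ(i)`. -/
def FlaggedTab (φ : ℕ → ℕ) (T : Tableau) : Prop := ∀ (i c : ℕ), T (i : ℤ) c ≤ φ i

/-- `SSKT(α, φ)`: the `φ`-flagged key tableaux of shape `α`. -/
def SSKT (α φ : ℕ → ℕ) : Set Tableau :=
  {T | IsKeyTableau T ∧ shapeOf T = α ∧ FlaggedTab φ T}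

/-- The weight of a tableau: `wt(T)_v` is the number of entries equal to `v`. -/
def wtTab (T : Tableau) : ℕ → ℕ := fun v =>
  if v = 0 then 0 else Set.ncard {p : ℤ × ℕ | T p.1 p.2 = v}

/-- The weight of a word: the multiplicity of each positive letter. -/
def wtWord (u : List ℕ) : ℕ → ℕ := fun v => if v = 0 then 0 else u.count v

/-- The statistic `m_i(col(T), j)` where position `j` of the reverse column reading word
(entries read down columns, from right to left) is the box in row `r`, column `c`:
the number of entries `i+1` weakly after this box minus the number of entries `i`. -/
def mi (T : Tableau) (i : ℕ) (r : ℤ) (c : ℕ) : ℤ :=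
  (Set.ncard {p : ℤ × ℕ | T p.1 p.2 = i + 1 ∧ (p.2 < c ∨ (p.2 = c ∧ p.1 ≤ r))} : ℤ) -
  (Set.ncard {p : ℤ × ℕ | T p.1 p.2 = i ∧ (p.2 < c ∨ (p.2 = c ∧ p.1 ≤ r))} : ℤ)

/-- The box `(r, c)` maximizes `m_i` among all boxes of `T`. -/
def isMaxBox (T : Tableau) (i : ℕ) (r : ℤ) (c : ℕ) : Prop :=
  T r c ≠ 0 ∧ ∀ (r' : ℤ) (c' : ℕ), T r' c' ≠ 0 → mi T i r' c' ≤ mi T i r c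

/-- The Assaf–Schilling raising operator `e_i` on key tableaux.  If `m_i(col(T)) ≤ 0` the
result is `none` (i.e. `0`); otherwise, with `q` the largest position of the reverse column
reading word achieving the maximum (i.e. the maximizing box with the smallest column index,
and the smallest row index in that column), all entries `i+1` in the row of `q` weakly to its
right are changed to `i`, and all entries `i` in the same columns as these entries are
changed to `i+1`. -/
def keyE (i : ℕ) (T : Tableau) : Option Tableau :=
  if h : ∃ (r : ℤ) (c : ℕ), isMaxBox T i r c ∧ 1 ≤ mi T i r c then
    let cq := sInf {c : ℕ | ∃ r : ℤ, isMaxBox T i r c}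
    let rq : ℤ := ((sInf {m : ℕ | isMaxBox T i ((m : ℕ) : ℤ) cq} : ℕ) : ℤ)
    some (fun r c =>
      if cq ≤ c ∧ T rq c = i + 1 then
        (if T r c = i + 1 then i else if T r c = i then i + 1 else T r c)
      else T r c)
  else none

/-- The Assaf–Schilling lowering operator `f_i`: the (unique) inverse of `e_i`. -/
def keyF (i : ℕ) (T : Tableau) : Option Tableau :=
  if h : ∃ T', keyE i T' = some T then some h.choose else none

/-- Restriction of a partially defined crystal operator to a subset: the operator returns
`none` (i.e. `0`) whenever it would leave the subset. -/
def restrictOp {β : Type} (S : Set β) (op : β → Option β) (x : β) : Option β :=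
  (op x).bind fun y => if y ∈ S then some y else none

/-! ### Polynomials: divided differences and key polynomials -/

/-- The divided difference operator `∂_i f = (f - s_i · f) / (x_i - x_{i+1})`. -/
def divDiff (i : ℕ) (fp : MvPolynomial ℕ ℤ) : MvPolynomial ℕ ℤ :=
  if h : ∃ g : MvPolynomial ℕ ℤ,
      g * (MvPolynomial.X i - MvPolynomial.X (i + 1)) =
        fp - MvPolynomial.rename (fun j => sPerm i j) fp
  then h.choose else 0

/-- The isobaric divided difference operator `π_i f = ∂_i (x_i f)`. -/
def piOp (i : ℕ) (fp : MvPolynomial ℕ ℤ) : MvPolynomial ℕ ℤ :=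
  divDiff i (MvPolynomial.X i * fp)

/-- `π_{i_1} π_{i_2} ⋯ π_{i_k} f` for a word `i_1 i_2 ⋯ i_k` (the head is applied last). -/
def piWord : List ℕ → MvPolynomial ℕ ℤ → MvPolynomial ℕ ℤ
  | [], fp => fp
  | i :: rest, fp => piOp i (piWord rest fp)

/-- `π_{b↓a} = π_{b-1} π_{b-2} ⋯ π_a` (the identity when `b ≤ a`). -/
def piDown (b a : ℕ) (fp : MvPolynomial ℕ ℤ) : MvPolynomial ℕ ℤ :=
  piWord ((List.range' a (b - a)).reverse) fp

/-- The conjugate of a weak composition: `conjC α t = #{j ≥ 1 | α_j ≥ t}` for `t ≥ 1`. -/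
def conjC (α : ℕ → ℕ) (t : ℕ) : ℕ :=
  Set.ncard {j : ℕ | 1 ≤ j ∧ 1 ≤ t ∧ t ≤ α j}

/-- The partition rearrangement of a weak composition (the conjugate of its conjugate). -/
def sortC (α : ℕ → ℕ) : ℕ → ℕ := conjC (conjC α)

/-- The length of a permutation: the common length of its reduced words. -/
def permLength (w : Equiv.Perm ℕ) : ℕ :=
  sInf {n : ℕ | ∃ ρ : List ℕ, PosWord ρ ∧ wordPerm ρ = w ∧ ρ.length = n}

/-- The monomial `x^β = x_1^{β_1} x_2^{β_2} ⋯`. -/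
def xExp (β : ℕ → ℕ) : MvPolynomial ℕ ℤ :=
  ∏ i ∈ Finset.range (sSup {n : ℕ | β n ≠ 0} + 1), MvPolynomial.X i ^ β i

/-- The key polynomial `κ_α = π_w x^λ` where `λ` is the partition rearrangement of `α` and
`w` is the minimal-length permutation of `S∞` with `α · w = λ`. -/
def keyPoly (α : ℕ → ℕ) : MvPolynomial ℕ ℤ :=
  if h : ∃ (ρ : List ℕ) (w : Equiv.Perm ℕ), IsReducedWordFor w ρ ∧
      (∀ i, α (w i) = sortC α i) ∧
      (∀ v : Equiv.Perm ℕ, (∃ τ, IsReducedWordFor v τ) → (∀ i, α (v i) = sortC α i) →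
        permLength w ≤ permLength v)
  then piWord h.choose (xExp (sortC α)) else 0

/-- The `φ`-flagged key polynomial `κ_{(α,φ)} = Σ_{T ∈ SSKT(α,φ)} x^{wt(T)}`. -/
def flaggedKeyPoly (α φ : ℕ → ℕ) : MvPolynomial ℕ ℤ :=
  ∑ᶠ T ∈ SSKT α φ, xExp (wtTab T)

/-! ### Column insertion, keys, standardization -/

/-- The number of boxes in column `c` of a tableau. -/
def colHeightN (T : Tableau) (c : ℕ) : ℕ := Set.ncard {r : ℤ | T r c ≠ 0}

/-- One pass of column insertion: insert the value `x` starting at column `c`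
(`fuel` bounds the number of columns visited). -/
def colInsertAux : ℕ → Tableau → ℕ → ℕ → Tableau
  | 0, T, _, _ => T
  | fuel + 1, T, c, x =>
    if ∀ r : ℤ, T r c ≠ 0 → T r c < x then
      -- x is greater than every entry of column c: place it at the end of the column
      fun r c' => if c' = c ∧ r = (colHeightN T c + 1 : ℤ) then x else T r c'
    else if ∃ r : ℤ, T r c = x then
      -- column c contains x: move on to the next column with the same value
      colInsertAux fuel T (c + 1) x
    else
      -- bump the smallest entry of column c that is larger than x
      let y := sInf {v : ℕ | x < v ∧ ∃ r : ℤ, T r c = v}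
      colInsertAux fuel (fun r c' => if c' = c ∧ T r c' = y then x else T r c') (c + 1) y

/-- Column insertion of `x` into the semistandard Young tableau `T`. -/
def colInsert (T : Tableau) (x : ℕ) : Tableau :=
  colInsertAux (sSup {c : ℕ | ∃ r : ℤ, T r c ≠ 0} + 2) T 1 x

/-- The insertion tableau `P` of `(v → ∅)`: successively column insert
`v_n, v_{n-1}, …, v_1` into the empty tableau. -/
def insertP (v : List ℕ) : Tableau :=
  v.reverse.foldl colInsert (fun _ _ => 0)

/-- The recording tableau `Q` of `(v → ∅)`: the standard Young tableau whose restriction to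
`{1, …, j}` has the same shape as the insertion tableau of the last `j` letters of `v`. -/
def insertQ (v : List ℕ) : Tableau := fun r c =>
  sInf {j : ℕ | insertP (v.drop (v.length - j)) r c ≠ 0}

/-- The key `key(α)`: the unique semistandard Young tableau of weight `α` such that the set
of entries of column `i+1` is a subset of the entries of column `i`; its column `c` consists
of the elements of `{x ≥ 1 | α_x ≥ c}` in increasing order from bottom to top. -/
def keyTab (α : ℕ → ℕ) : Tableau := fun r c =>
  if c = 0 then 0
  else sInf {x : ℕ | 1 ≤ x ∧ c ≤ α x ∧
    ((Set.ncard {y : ℕ | 1 ≤ y ∧ c ≤ α y ∧ y ≤ x} : ℕ) : ℤ) = r}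

/-- The standardization of a semistandard Young tableau: the `1`'s are replaced from left to
right by `1, …, β_1`, the `2`'s by `β_1 + 1, …, β_1 + β_2`, and so on. -/
def stdTab (T : Tableau) : Tableau := fun r c =>
  if T r c = 0 then 0
  else Set.ncard {p : ℤ × ℕ |
    T p.1 p.2 ≠ 0 ∧ (T p.1 p.2 < T r c ∨ (T p.1 p.2 = T r c ∧ p.2 ≤ c))}

/-! ### Maximal factorizations (Reiner–Shimozono) -/

/-- Every block is weakly increasing. -/
def WeaklyIncrFact (g : ℕ → List ℕ) : Prop := ∀ i, List.Chain' (· ≤ ·) (g i)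

/-- Maximality: the nonempty blocks have maximal length, i.e. there is a strict descent
between any two consecutive nonempty blocks (no letter can be moved from the end of a block
to the front of the next one to the right). -/
def MaxFact (g : ℕ → List ℕ) : Prop :=
  ∀ i j : ℕ, 1 ≤ i → i < j → g i ≠ [] → g j ≠ [] → (∀ m, i < m → m < j → g m = []) →
    (g i).headI < (g j).getLastD 0

/-- Reiner–Shimozono's set `𝒲(α, φ)` of `φ`-flagged maximal factorizations
`u^• = u^n ⋯ u^2 u^1` with `ℓ(u^i) = α_i` and `(u → ∅) = (P, std(key(α)))`. -/
def Wset (α φ : ℕ → ℕ) : Set (ℕ → List ℕ) :=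
  {g | g 0 = [] ∧ (∀ i, (g i).length = α i) ∧ (∀ i, ∀ x ∈ g i, 1 ≤ x) ∧
       WeaklyIncrFact g ∧ MaxFact g ∧ (∀ i, ∀ x ∈ g i, x ≤ φ i) ∧
       insertQ (factWord g) = stdTab (keyTab α)}

/-! ### Shifts and highest weight key tableaux -/

/-- `shift_N`: add `N` to every letter of every block. -/
def shiftFact (N : ℕ) (f : ℕ → List ℕ) : ℕ → List ℕ := fun i => (f i).map (· + N)

/-- The tableau of shape `α` whose column `i` is filled by `1, 2, …, λ^T_i` in increasing
order from bottom to top (where `λ^T` is the conjugate of the partition rearrangement `λ`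
of `α`): the box of column `c` in row `m` (where `α_m ≥ c`) contains the number of indices
`m' ≤ m` with `α_{m'} ≥ c`. -/
def highKeyTab (α : ℕ → ℕ) : Tableau := fun r c =>
  if c = 0 then 0
  else if ∃ m : ℕ, (m : ℤ) = r ∧ 1 ≤ m ∧ c ≤ α m then
    Set.ncard {m : ℕ | 1 ≤ m ∧ c ≤ α m ∧ (m : ℤ) ≤ r}
  else 0


/-- A `gl_n`-crystal isomorphism between two sets of key tableaux, both equipped with the
Assaf–Schilling operators (restricted to the sets): a weight-preserving bijection commuting
with all raising and lowering operators `e_i, f_i` for `1 ≤ i < n`. -/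
def SSKTIso (n : ℕ) (S₁ S₂ : Set Tableau) : Prop :=
  ∃ g : Tableau → Tableau, Set.BijOn g S₁ S₂ ∧
    (∀ T ∈ S₁, wtTab T = wtTab (g T)) ∧
    ∀ T ∈ S₁, ∀ i : ℕ, 1 ≤ i → i < n →
      Option.map g (restrictOp S₁ (keyE i) T) = restrictOp S₂ (keyE i) (g T) ∧
      Option.map g (restrictOp S₁ (keyF i) T) = restrictOp S₂ (keyF i) (g T)

/-! ### Two adjacent blocks -/

/-- The bracketing height of the pair (upper block `A`, lower block `B`). -/
def ht (A B : Finset ℤ) (x : ℤ) : ℤ :=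
  (∑ a ∈ A, if a ≤ x then 1 else 0) - ∑ b ∈ B, if b < x then 1 else 0

theorem sum_ite_le_succ (A : Finset ℤ) (x : ℤ) :
    (∑ a ∈ A, if a ≤ x + 1 then (1 : ℤ) else 0) =
      (∑ a ∈ A, if a ≤ x then 1 else 0) + if x + 1 ∈ A then 1 else 0 := by
  have h : (if x + 1 ∈ A then (1 : ℤ) else 0) = ∑ a ∈ A, if x + 1 = a then 1 else 0 := by
    rw [Finset.sum_ite_eq]
  rw [h, ← Finset.sum_add_distrib]
  refine Finset.sum_congr rfl fun a _ => ?_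
  split_ifs <;> omega

theorem ht_succ (A B : Finset ℤ) (x : ℤ) :
    ht A B (x + 1) = ht A B x + (if x + 1 ∈ A then 1 else 0) - if x ∈ B then 1 else 0 := by
  have h1 := sum_ite_le_succ A x
  have h2 := sum_ite_le_succ B (x - 1)
  simp only [sub_add_cancel] at h2
  have h3 : ∀ y : ℤ, (∑ b ∈ B, if b < y then (1 : ℤ) else 0) =
      ∑ b ∈ B, if b ≤ y - 1 then 1 else 0 := fun y =>
    Finset.sum_congr rfl fun b _ => by split_ifs <;> omega
  unfold ht
  rw [h3, h3, h1, add_sub_cancel_right, h2]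
  ring

theorem ht_erase_upper {A B : Finset ℤ} {a : ℤ} (h : a ∈ A) (x : ℤ) :
    ht (A.erase a) B x = ht A B x - if a ≤ x then 1 else 0 := by
  unfold ht
  rw [← Finset.add_sum_erase A _ h]; ring

theorem ht_insert_upper {A B : Finset ℤ} {a : ℤ} (h : a ∉ A) (x : ℤ) :
    ht (insert a A) B x = ht A B x + if a ≤ x then 1 else 0 := by
  unfold ht
  rw [Finset.sum_insert h]; ring

theorem ht_erase_lower {A B : Finset ℤ} {b : ℤ} (h : b ∈ B) (x : ℤ) :
    ht A (B.erase b) x = ht A B x + if b < x then 1 else 0 := by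
  unfold ht
  rw [← Finset.add_sum_erase B _ h]; ring

theorem ht_insert_lower {A B : Finset ℤ} {b : ℤ} (h : b ∉ B) (x : ℤ) :
    ht A (insert b B) x = ht A B x - if b < x then 1 else 0 := by
  unfold ht
  rw [Finset.sum_insert h]; ring

theorem ht_le_card (A B : Finset ℤ) (x : ℤ) : ht A B x ≤ A.card := by
  unfold ht
  have h1 : (∑ a ∈ A, if a ≤ x then (1 : ℤ) else 0) ≤ ∑ a ∈ A, 1 :=
    Finset.sum_le_sum fun a _ => by split_ifs <;> omega
  have h2 : (0 : ℤ) ≤ ∑ b ∈ B, if b < x then (1 : ℤ) else 0 :=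
    Finset.sum_nonneg fun a _ => by split_ifs <;> omega
  simp at h1 h2 ⊢
  omega

theorem exists_bounds (A B : Finset ℤ) :
    ∃ lo hi : ℤ, (∀ a ∈ A, lo < a ∧ a < hi) ∧ ∀ b ∈ B, lo < b ∧ b < hi := by
  obtain ⟨M, hM⟩ := (A ∪ B).bddAbove
  obtain ⟨m, hm⟩ := (A ∪ B).bddBelow
  refine ⟨m - 1, M + 1, fun a ha => ?_, fun a ha => ?_⟩ <;>
  · have h1 := hM (show a ∈ ((A ∪ B : Finset ℤ) : Set ℤ) by simp [ha])
    have h2 := hm (show a ∈ ((A ∪ B : Finset ℤ) : Set ℤ) by simp [ha])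
    omega

theorem exists_ht_eq_zero (A B : Finset ℤ) : ∃ lo : ℤ, ∀ x ≤ lo, ht A B x = 0 := by
  obtain ⟨lo, hi, h1, h2⟩ := exists_bounds A B
  refine ⟨lo, fun x hx => ?_⟩
  unfold ht
  rw [Finset.sum_eq_zero, Finset.sum_eq_zero, sub_zero]
  · intro b hb; rw [if_neg]; have := h2 b hb; omega
  · intro b hb; rw [if_neg]; have := h1 b hb; omega

theorem exists_ht_eq_card (A B : Finset ℤ) :
    ∃ hi : ℤ, ∀ x ≥ hi, ht A B x = A.card - B.card := by
  obtain ⟨lo, hi, h1, h2⟩ := exists_bounds A B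
  refine ⟨hi, fun x hx => ?_⟩
  unfold ht
  rw [Finset.sum_congr rfl (g := fun _ => (1 : ℤ)) fun b hb => if_pos (by have := h1 b hb; omega),
    Finset.sum_congr (s₁ := B) rfl (g := fun _ => (1 : ℤ))
      fun b hb => if_pos (by have := h2 b hb; omega)]
  simp

theorem exists_ht_bound (A B : Finset ℤ) : ∃ n : ℕ, ∀ x, ht A B x ≤ n :=
  ⟨A.card, ht_le_card A B⟩

/-- The number of unpaired letters of the upper block. -/
def hEps (A B : Finset ℤ) : ℕ := Nat.find (exists_ht_bound A B)

/-- The number of unpaired letters of the lower block. -/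
def hPhi (A B : Finset ℤ) : ℕ := hEps A B + B.card - A.card

theorem ht_le_hEps (A B : Finset ℤ) (x : ℤ) : ht A B x ≤ hEps A B :=
  Nat.find_spec (exists_ht_bound A B) x

theorem card_le_hEps (A B : Finset ℤ) : A.card ≤ hEps A B + B.card := by
  obtain ⟨hi, h⟩ := exists_ht_eq_card A B
  have := ht_le_hEps A B hi
  rw [h hi le_rfl] at this
  omega

theorem hPhi_add (A B : Finset ℤ) : hPhi A B + A.card = hEps A B + B.card := by
  have := card_le_hEps A B
  unfold hPhi; omega

theorem exists_ht_eq_hEps (A B : Finset ℤ) : ∃ x, ht A B x = hEps A B := by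
  by_contra! h
  have h1 : ∀ x, ht A B x < hEps A B := fun x => lt_of_le_of_ne (ht_le_hEps A B x) (h x)
  obtain ⟨lo, hlo⟩ := exists_ht_eq_zero A B
  have h0 := h1 lo
  rw [hlo lo le_rfl] at h0
  have := Nat.find_min (exists_ht_bound A B) (m := hEps A B - 1) (by
    change _ < hEps A B; omega)
  apply this
  intro x; have := h1 x; omega

theorem hEps_eq_of {A B : Finset ℤ} {n : ℤ} (h : ∀ x, ht A B x ≤ n) (h' : ∃ x, ht A B x = n) :
    (hEps A B : ℤ) = n := by
  obtain ⟨x, hx⟩ := h'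
  obtain ⟨y, hy⟩ := exists_ht_eq_hEps A B
  have := ht_le_hEps A B x
  have := h y
  omega

/-- `(a, r)` is the pair (letter leaving `A`, letter entering `B`) of the raising operator. -/
structure IsStep (A B : Finset ℤ) (a r : ℤ) : Prop where
  le : a ≤ r
  memA : ∀ x, a ≤ x → x ≤ r → x ∈ A
  memB : ∀ x, a ≤ x → x < r → x ∈ B
  not_memB : r ∉ B
  succ_not_memA : r + 1 ∉ A
  pos : 0 < ht A B a
  lt : ∀ x < a, ht A B x < ht A B a
  max : ∀ x, ht A B x ≤ ht A B a

/-- The condition excluding configurations that make a word non-reduced. -/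
def Red (A B : Finset ℤ) : Prop :=
  ∀ a r : ℤ, a ≤ r → (∀ x, a ≤ x → x ≤ r → x ∈ A ∧ x ∈ B) → r + 1 ∉ A → a - 1 ∉ B → False

theorem exists_first {A B : Finset ℤ} {M lo : ℤ} (hlo : ∀ x ≤ lo, ht A B x < M)
    (h : ∃ x, M ≤ ht A B x) :
    ∃ a, lo < a ∧ ht A B a = M ∧ a ∈ A ∧ a - 1 ∉ B ∧ ∀ x < a, ht A B x < M := by
  obtain ⟨a, ha, hmin⟩ := Int.exists_least_of_bdd (P := fun x => M ≤ ht A B x)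
    ⟨lo, fun z hz => by by_contra hc; exact absurd (hlo z (by omega)) (by omega)⟩ h
  have hlt : ∀ x < a, ht A B x < M := fun x hx => by
    by_contra hc; have := hmin x (by omega); omega
  have h1 := hlt (a - 1) (by omega)
  have h2 := ht_succ A B (a - 1)
  rw [sub_add_cancel] at h2
  have hlo' : lo < a := by
    by_contra hc; have := hlo a (by omega); omega
  split_ifs at h2 with h3 h4 h4
  · omega
  · exact ⟨a, hlo', by omega, h3, h4, hlt⟩
  · omega
  · omega

/-- The run of common letters starting at `a`. -/
theorem exists_run_end {A : Finset ℤ} (B : Finset ℤ) {a : ℤ} (ha : a ∈ A) :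
    ∃ r, a ≤ r ∧ (∀ x, a ≤ x → x ≤ r → x ∈ A) ∧ (∀ x, a ≤ x → x < r → x ∈ B) ∧
      (r + 1 ∉ A ∨ r ∉ B) := by
  obtain ⟨lo, hi, h1, h2⟩ := exists_bounds A B
  obtain ⟨r, hr, hmin⟩ := Int.exists_least_of_bdd
    (P := fun x => a ≤ x ∧ (x + 1 ∉ A ∨ x ∉ B)) ⟨a, fun z hz => hz.1⟩
    ⟨max a hi, le_max_left _ _, Or.inr fun hc => by have := h2 _ hc; omega⟩
  have hx : ∀ x, a ≤ x → x < r → x + 1 ∈ A ∧ x ∈ B := by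
    intro x hx1 hx2
    by_contra hc
    have := hmin x ⟨hx1, by tauto⟩
    omega
  refine ⟨r, hr.1, fun x hx1 hx2 => ?_, fun x hx1 hx2 => (hx x hx1 hx2).2, hr.2⟩
  rcases eq_or_lt_of_le hx1 with h | h
  · exact h ▸ ha
  · have := (hx (x - 1) (by omega) (by omega)).1
    rwa [sub_add_cancel] at this

theorem ht_run {A B : Finset ℤ} {a r : ℤ} (hA : ∀ x, a ≤ x → x ≤ r → x ∈ A)
    (hB : ∀ x, a ≤ x → x < r → x ∈ B) (x : ℤ) (h1 : a ≤ x) (h2 : x ≤ r) :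
    ht A B x = ht A B a := by
  induction x, h1 using Int.leInduction with
  | base => rfl
  | succ n hn ih =>
    rw [ht_succ, ih (by omega), if_pos (hA _ (by omega) h2), if_pos (hB _ hn (by omega))]
    ring

theorem exists_isStep {A B : Finset ℤ} (hR : Red A B) {a : ℤ} (ha : a ∈ A) (ha' : a - 1 ∉ B)
    (hpos : 0 < ht A B a) (hlt : ∀ x < a, ht A B x < ht A B a)
    (hmax : ∀ x, ht A B x ≤ ht A B a) : ∃ r, IsStep A B a r := by
  obtain ⟨r, har, hrA, hrB, hr⟩ := exists_run_end B ha
  have hM := ht_run hrA hrB r har le_rfl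
  have hs := ht_succ A B r
  have hm := hmax (r + 1)
  have hr1 : r + 1 ∉ A := by
    intro h
    rw [if_pos h, if_neg (by tauto)] at hs
    omega
  have hr2 : r ∉ B := by
    intro h
    refine hR a r har (fun x h1 h2 => ⟨hrA x h1 h2, ?_⟩) hr1 ha'
    rcases eq_or_lt_of_le h2 with rfl | h3
    · exact h
    · exact hrB x h1 h3
  exact ⟨r, har, hrA, hrB, hr2, hr1, hpos, hlt, hmax⟩

theorem exists_isStep_of_hEps {A B : Finset ℤ} (hR : Red A B) (h : 0 < hEps A B) :
    ∃ a r, IsStep A B a r := by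
  obtain ⟨lo, hlo⟩ := exists_ht_eq_zero A B
  obtain ⟨x, hx⟩ := exists_ht_eq_hEps A B
  obtain ⟨a, -, h1, h2, h3, h4⟩ := exists_first (A := A) (B := B) (M := hEps A B) (lo := lo)
    (fun x hx => by rw [hlo x hx]; omega) ⟨x, hx.ge⟩
  obtain ⟨r, hr⟩ := exists_isStep hR h2 h3 (by omega) (by rwa [h1])
    (by rw [h1]; exact ht_le_hEps A B)
  exact ⟨a, r, hr⟩

namespace IsStep
variable {A B : Finset ℤ} {a r : ℤ}

theorem mem_left (h : IsStep A B a r) : a ∈ A := h.memA a le_rfl h.le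

theorem ht_eq (h : IsStep A B a r) : ht A B a = hEps A B :=
  (hEps_eq_of h.max ⟨a, rfl⟩).symm

theorem ht_run_eq (h : IsStep A B a r) (x : ℤ) (h1 : a ≤ x) (h2 : x ≤ r + 1) :
    ht A B x = ht A B a := by
  rcases eq_or_lt_of_le h2 with rfl | h3
  · rw [ht_succ, if_neg h.succ_not_memA, if_neg h.not_memB,
      ht_run h.memA h.memB r h.le le_rfl]; ring
  · exact ht_run h.memA h.memB x h1 (by omega)

theorem pred_not_memB (h : IsStep A B a r) : a - 1 ∉ B := by
  intro hc
  have h1 := h.lt (a - 1) (by omega)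
  have h2 := ht_succ A B (a - 1)
  rw [sub_add_cancel, if_pos hc] at h2
  split_ifs at h2 <;> omega

theorem unique (h : IsStep A B a r) {a' r' : ℤ} (h' : IsStep A B a' r') : a = a' ∧ r = r' := by
  have ha : a = a' := by
    rcases lt_trichotomy a a' with hc | hc | hc
    · have := h'.lt a hc; have := h.max a'; omega
    · exact hc
    · have := h.lt a' hc; have := h'.max a; omega
  subst ha
  refine ⟨rfl, ?_⟩
  rcases lt_trichotomy r r' with hc | hc | hc
  · exact absurd (h'.memB r h.le hc) h.not_memB
  · exact hc
  · exact absurd (h.memB r' h'.le hc) h'.not_memB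

/-- Heights after the step. -/
theorem ht_after (h : IsStep A B a r) (x : ℤ) :
    ht (A.erase a) (insert r B) x =
      ht A B x - (if a ≤ x then 1 else 0) - if r < x then 1 else 0 := by
  rw [ht_insert_lower h.not_memB, ht_erase_upper h.mem_left]

theorem hEps_after (h : IsStep A B a r) : hEps (A.erase a) (insert r B) + 1 = hEps A B := by
  have h1 : (hEps (A.erase a) (insert r B) : ℤ) = hEps A B - 1 := by
    apply hEps_eq_of
    · intro x
      rw [h.ht_after]
      have h1 := h.max x
      have h2 := h.ht_eq
      rcases lt_or_ge x a with h3 | h3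
      · have := h.lt x h3
        rw [if_neg (by omega), if_neg (by have := h.le; omega)]; omega
      · rw [if_pos h3]; split_ifs <;> omega
    · refine ⟨a, ?_⟩
      rw [h.ht_after, if_pos le_rfl, if_neg (by have := h.le; omega), h.ht_eq]; ring
  omega

theorem card_upper (h : IsStep A B a r) : (A.erase a).card + 1 = A.card :=
  Finset.card_erase_add_one h.mem_left

theorem card_lower (h : IsStep A B a r) : (insert r B).card = B.card + 1 :=
  Finset.card_insert_of_notMem h.not_memB

theorem hPhi_after (h : IsStep A B a r) : hPhi (A.erase a) (insert r B) = hPhi A B + 1 := by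
  have h1 := hPhi_add A B
  have h2 := hPhi_add (A.erase a) (insert r B)
  have := h.hEps_after; have := h.card_upper; have := h.card_lower
  omega

end IsStep

/-- Reflection of a finite set of integers. -/
def negF (A : Finset ℤ) : Finset ℤ := A.image fun x => -x

@[simp] theorem mem_negF {A : Finset ℤ} {x : ℤ} : x ∈ negF A ↔ -x ∈ A := by
  unfold negF
  simp only [Finset.mem_image]
  constructor
  · rintro ⟨y, hy, rfl⟩; simpa
  · intro h; exact ⟨-x, h, by simp⟩

@[simp] theorem negF_negF (A : Finset ℤ) : negF (negF A) = A := by ext; simp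

theorem negF_insert (A : Finset ℤ) (a : ℤ) : negF (insert a A) = insert (-a) (negF A) := by
  ext x; simp [neg_eq_iff_eq_neg]

theorem negF_erase (A : Finset ℤ) (a : ℤ) : negF (A.erase a) = (negF A).erase (-a) := by
  ext x; simp [neg_eq_iff_eq_neg]

theorem ht_neg (A B : Finset ℤ) (x : ℤ) :
    ht (negF B) (negF A) (-x) = ht A B x + B.card - A.card := by
  have hn : ∀ (S : Finset ℤ) (g : ℤ → ℤ), ∑ a ∈ negF S, g a = ∑ a ∈ S, g (-a) := fun S g =>
    Finset.sum_image fun a _ b _ h => neg_injective h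
  have h1 : (A.card : ℤ) = ∑ a ∈ A, 1 := by simp
  have h2 : (B.card : ℤ) = ∑ a ∈ B, 1 := by simp
  unfold ht
  rw [hn, hn, h1, h2]
  have e1 : ∑ a ∈ B, (if -a ≤ -x then (1 : ℤ) else 0) =
      ∑ a ∈ B, 1 - ∑ a ∈ B, if a < x then 1 else 0 := by
    rw [← Finset.sum_sub_distrib]
    exact Finset.sum_congr rfl fun a _ => by split_ifs <;> omega
  have e2 : ∑ a ∈ A, (if -a < -x then (1 : ℤ) else 0) =
      ∑ a ∈ A, 1 - ∑ a ∈ A, if a ≤ x then 1 else 0 := by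
    rw [← Finset.sum_sub_distrib]
    exact Finset.sum_congr rfl fun a _ => by split_ifs <;> omega
  rw [e1, e2]; ring

theorem hEps_neg (A B : Finset ℤ) : hEps (negF B) (negF A) = hPhi A B := by
  have h0 := hPhi_add A B
  have : (hEps (negF B) (negF A) : ℤ) = hEps A B + B.card - A.card := by
    apply hEps_eq_of
    · intro x
      have := ht_neg A B (-x)
      rw [neg_neg] at this
      have := ht_le_hEps A B (-x)
      omega
    · obtain ⟨x, hx⟩ := exists_ht_eq_hEps A B
      exact ⟨-x, by rw [ht_neg, hx]⟩
  omega

theorem Red.neg {A B : Finset ℤ} (h : Red A B) : Red (negF B) (negF A) := by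
  intro a r har hm h1 h2
  refine h (-r) (-a) (by omega) (fun x hx1 hx2 => ?_) ?_ ?_
  · have := hm (-x) (by omega) (by omega)
    simp at this; tauto
  · rw [mem_negF] at h2; convert h2 using 2; ring
  · rw [mem_negF] at h1; convert h1 using 2; ring

theorem IsStep.neg {A B : Finset ℤ} {a r : ℤ} (h : IsStep A B a r) :
    IsStep (negF (insert r B)) (negF (A.erase a)) (-r) (-a) := by
  have hh : ∀ x, ht (negF (insert r B)) (negF (A.erase a)) x =
      ht A B (-x) - (if a ≤ -x then 1 else 0) - (if r < -x then 1 else 0) + B.card - A.card + 2 := by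
    intro x
    have h1 := ht_neg (A.erase a) (insert r B) (-x)
    rw [neg_neg] at h1
    rw [h1, h.ht_after]
    have := h.card_upper; have := h.card_lower; omega
  have hle := h.le
  have hbase := hh (-r)
  rw [neg_neg, if_pos hle, if_neg (by omega), h.ht_run_eq r hle (by omega)] at hbase
  refine ⟨by omega, fun x h1 h2 => ?_, fun x h1 h2 => ?_, ?_, ?_, ?_, fun x hx => ?_, fun x => ?_⟩
  · simp only [mem_negF, Finset.mem_insert]
    rcases eq_or_lt_of_le h1 with h3 | h3
    · left; omega
    · exact Or.inr (h.memB _ (by omega) (by omega))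
  · simp only [mem_negF, Finset.mem_erase]
    exact ⟨by omega, h.memA _ (by omega) (by omega)⟩
  · simp
  · simp only [mem_negF, Finset.mem_insert, not_or]
    refine ⟨by omega, ?_⟩
    convert h.pred_not_memB using 2; ring
  · rw [hbase]
    obtain ⟨hi, hhi⟩ := exists_ht_eq_card A B
    have := h.max hi
    rw [hhi hi le_rfl] at this
    omega
  · rw [hh, hbase]
    have := h.max (-x)
    rw [if_pos (by omega), if_pos (by omega)]; omega
  · rw [hh, hbase]
    have h2 := h.max (-x)
    rcases lt_or_ge (-x) a with h3 | h3
    · have := h.lt (-x) h3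
      rw [if_neg (by omega), if_neg (by omega)]; omega
    · rw [if_pos h3]; split_ifs <;> omega

theorem IsStep.negF_upper {A B : Finset ℤ} {a r : ℤ} (h : IsStep A B a r) :
    (negF (insert r B)).erase (-r) = negF B := by
  rw [← negF_erase, Finset.erase_insert h.not_memB]

theorem IsStep.negF_lower {A B : Finset ℤ} {a r : ℤ} (h : IsStep A B a r) :
    insert (-a) (negF (A.erase a)) = negF A := by
  rw [← negF_insert, Finset.insert_erase h.mem_left]

/-! ### Three adjacent blocks -/

/-- Raising step between the first two blocks of a triple. -/
def StepL (x y : Finset ℤ × Finset ℤ × Finset ℤ) : Prop :=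
  ∃ a r, IsStep x.1 x.2.1 a r ∧ y = (x.1.erase a, insert r x.2.1, x.2.2)

/-- Raising step between the last two blocks of a triple. -/
def StepR (x y : Finset ℤ × Finset ℤ × Finset ℤ) : Prop :=
  ∃ b q, IsStep x.2.1 x.2.2 b q ∧ y = (x.1, x.2.1.erase b, insert q x.2.2)

/-- Number of unpaired upper letters in the first two blocks. -/
def epsL (x : Finset ℤ × Finset ℤ × Finset ℤ) : ℕ := hEps x.1 x.2.1

/-- Number of unpaired upper letters in the last two blocks. -/
def epsR (x : Finset ℤ × Finset ℤ × Finset ℤ) : ℕ := hEps x.2.1 x.2.2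

/-- A set of triples stable under raising and lowering and without non-reduced patterns. -/
structure Closed3 (G : Set (Finset ℤ × Finset ℤ × Finset ℤ)) : Prop where
  redL : ∀ x ∈ G, Red x.1 x.2.1
  redR : ∀ x ∈ G, Red x.2.1 x.2.2
  stepL : ∀ x ∈ G, ∀ y, StepL x y → y ∈ G
  stepR : ∀ x ∈ G, ∀ y, StepR x y → y ∈ G
  backL : ∀ y ∈ G, ∀ x, StepL x y → x ∈ G
  backR : ∀ y ∈ G, ∀ x, StepR x y → x ∈ G

theorem step_commute_of_epsR_eq {x y z : Finset ℤ × Finset ℤ × Finset ℤ}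
    (h1 : StepL x y) (h2 : StepR x z) (he : epsR y = epsR x) :
    epsL z = epsL x + 1 ∧ ∃ t, StepR y t ∧ StepL z t := by
  obtain ⟨A, B, C⟩ := x
  obtain ⟨a, r, hL, rfl⟩ := h1
  obtain ⟨b, q, hR, rfl⟩ := h2
  simp only [epsL, epsR, StepL, StepR] at *
  have hH : ∀ x, ht (insert r B) C x = ht B C x + if r ≤ x then 1 else 0 :=
    ht_insert_upper hL.not_memB
  have hG : ∀ x, ht A (B.erase b) x = ht A B x + if b < x then 1 else 0 :=
    ht_erase_lower hR.mem_left
  have hK := hR.ht_eq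
  have hM := hL.ht_eq
  have hlt : ∀ x, r ≤ x → ht B C x < ht B C b := by
    intro x hx
    have h1 := ht_le_hEps (insert r B) C x
    rw [hH, if_pos hx] at h1; omega
  have hq : q + 1 < r := by
    by_contra hc
    have := hlt (q + 1) (by omega)
    have := hR.ht_run_eq (q + 1) (by have := hR.le; omega) le_rfl
    omega
  have hqa : q + 1 < a := by
    by_contra hc
    exact hR.succ_not_memA (hL.memB _ (by omega) hq)
  have hbq := hR.le
  have hb : IsStep (insert r B) C b q := by
    refine ⟨hR.le, fun x h1 h2 => Finset.mem_insert_of_mem (hR.memA x h1 h2), hR.memB, hR.not_memB,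
      ?_, ?_, fun x hx => ?_, fun x => ?_⟩
    · simp only [Finset.mem_insert, not_or]; exact ⟨by omega, hR.succ_not_memA⟩
    · rw [hH]; have := hR.pos; split_ifs <;> omega
    · rw [hH, hH, if_neg (by omega), if_neg (by omega)]; have := hR.lt x hx; omega
    · rw [hH, hH]; have := hR.max x; have := hlt x; split_ifs <;> omega
  have ha : IsStep A (B.erase b) a r := by
    refine ⟨hL.le, hL.memA, fun x h1 h2 => ?_, ?_, hL.succ_not_memA, ?_, fun x hx => ?_,
      fun x => ?_⟩
    · rw [Finset.mem_erase]; exact ⟨by omega, hL.memB x h1 h2⟩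
    · exact fun h => hL.not_memB (Finset.mem_of_mem_erase h)
    · rw [hG]; have := hL.pos; split_ifs <;> omega
    · rw [hG, hG]; have := hL.lt x hx; split_ifs <;> omega
    · rw [hG, hG]; have := hL.max x; split_ifs <;> omega
  refine ⟨?_, _, ⟨b, q, hb, rfl⟩, a, r, ha, ?_⟩
  · have := ha.ht_eq
    rw [hG, if_pos (by omega)] at this; omega
  · have hne : r ≠ b := fun h => hL.not_memB (h ▸ hR.mem_left)
    simp [Finset.erase_insert_of_ne hne]

theorem step_commute_of_epsL_eq {x y z : Finset ℤ × Finset ℤ × Finset ℤ}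
    (h1 : StepL x y) (h2 : StepR x z) (he : epsL z = epsL x) :
    epsR y = epsR x + 1 ∧ ∃ t, StepR y t ∧ StepL z t := by
  obtain ⟨A, B, C⟩ := x
  obtain ⟨a, r, hL, rfl⟩ := h1
  obtain ⟨b, q, hR, rfl⟩ := h2
  simp only [epsL, epsR, StepL, StepR] at *
  have hH : ∀ x, ht (insert r B) C x = ht B C x + if r ≤ x then 1 else 0 :=
    ht_insert_upper hL.not_memB
  have hG : ∀ x, ht A (B.erase b) x = ht A B x + if b < x then 1 else 0 :=
    ht_erase_lower hR.mem_left
  have hK := hR.ht_eq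
  have hM := hL.ht_eq
  have hlt : ∀ x, b < x → ht A B x < ht A B a := by
    intro x hx
    have h1 := ht_le_hEps A (B.erase b) x
    rw [hG, if_pos hx] at h1; omega
  have hrb : r + 1 ≤ b := by
    by_contra hc
    have := hlt (r + 1) (by omega)
    have := hL.ht_run_eq (r + 1) (by have := hL.le; omega) le_rfl
    omega
  have hbq := hR.le
  have har := hL.le
  have hb : IsStep (insert r B) C b q := by
    refine ⟨hR.le, fun x h1 h2 => Finset.mem_insert_of_mem (hR.memA x h1 h2), hR.memB, hR.not_memB,
      ?_, ?_, fun x hx => ?_, fun x => ?_⟩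
    · simp only [Finset.mem_insert, not_or]; exact ⟨by omega, hR.succ_not_memA⟩
    · rw [hH]; have := hR.pos; split_ifs <;> omega
    · rw [hH, hH]; have := hR.lt x hx; split_ifs <;> omega
    · rw [hH, hH]; have := hR.max x; split_ifs <;> omega
  have ha : IsStep A (B.erase b) a r := by
    refine ⟨hL.le, hL.memA, fun x h1 h2 => ?_, ?_, hL.succ_not_memA, ?_, fun x hx => ?_,
      fun x => ?_⟩
    · rw [Finset.mem_erase]; exact ⟨by omega, hL.memB x h1 h2⟩
    · exact fun h => hL.not_memB (Finset.mem_of_mem_erase h)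
    · rw [hG]; have := hL.pos; split_ifs <;> omega
    · rw [hG, hG]; have := hL.lt x hx; split_ifs <;> omega
    · rw [hG, hG]; have := hL.max x; have := hlt x; split_ifs <;> omega
  refine ⟨?_, _, ⟨b, q, hb, rfl⟩, a, r, ha, ?_⟩
  · have := hb.ht_eq
    rw [hH, if_pos (by omega)] at this; omega
  · have hne : r ≠ b := fun h => hL.not_memB (h ▸ hR.mem_left)
    simp [Finset.erase_insert_of_ne hne]

/-- The conclusion of the degree four Stembridge relation. -/
def Deg4 (x y z : Finset ℤ × Finset ℤ × Finset ℤ) : Prop :=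
  ∃ y1 y2 z1 z2 t, StepR y y1 ∧ StepR y1 y2 ∧ StepL y2 t ∧ StepL z z1 ∧ StepL z1 z2 ∧
    StepR z2 t ∧ epsR z2 = epsR x ∧ epsL y2 = epsL x

set_option maxHeartbeats 2000000 in
theorem deg4_of_lt {G : Set (Finset ℤ × Finset ℤ × Finset ℤ)} (hG : Closed3 G)
    {A B C : Finset ℤ} (hx : (A, B, C) ∈ G) {a r b q : ℤ} (hL : IsStep A B a r)
    (hR : IsStep B C b q) (hba : b < a) (hex : ∃ x, r ≤ x ∧ ht B C x = ht B C b) :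
    Deg4 (A, B, C) (A.erase a, insert r B, C) (A, B.erase b, insert q C) := by
  have har := hL.le
  have hbq := hR.le
  have hK := hR.ht_eq
  have hM := hL.ht_eq
  have hqa : q + 1 < a := by
    by_contra hc
    exact hL.pred_not_memB (hR.memA _ (by omega) (by omega))
  have hH1 : ∀ x, ht (insert r B) C x = ht B C x + if r ≤ x then 1 else 0 :=
    ht_insert_upper hL.not_memB
  have hG1 : ∀ x, ht A (B.erase b) x = ht A B x + if b < x then 1 else 0 :=
    ht_erase_lower hR.mem_left
  have hy : (A.erase a, insert r B, C) ∈ G := hG.stepL _ hx _ ⟨a, r, hL, rfl⟩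
  have hz : (A, B.erase b, insert q C) ∈ G := hG.stepR _ hx _ ⟨b, q, hR, rfl⟩
  have hpR := hR.pos
  have hpL := hL.pos
  obtain ⟨b1, hb1, hb1M, hb1A, hb1B, hb1lt⟩ := exists_first (A := insert r B) (B := C)
    (M := ht B C b + 1) (lo := r - 1)
    (fun x hx => by rw [hH1, if_neg (by omega)]; have := hR.max x; omega)
    (by obtain ⟨x, h1, h2⟩ := hex
        exact ⟨x, by rw [hH1, if_pos h1]; omega⟩)
  obtain ⟨q1, hq1⟩ := exists_isStep (hG.redR _ hy) hb1A hb1B (by rw [hb1M]; omega)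
    (by rwa [hb1M]) (fun x => by rw [hb1M, hH1]; have := hR.max x; split_ifs <;> omega)
  have hbq1 := hq1.le
  have hH2 : ∀ x, ht ((insert r B).erase b1) (insert q1 C) x = _ := hq1.ht_after
  have s2 : IsStep ((insert r B).erase b1) (insert q1 C) b q := by
    refine ⟨hbq, fun x h1 h2 => ?_, fun x h1 h2 => ?_, ?_, ?_, ?_, fun x hx => ?_, fun x => ?_⟩
    · rw [Finset.mem_erase, Finset.mem_insert]; exact ⟨by omega, Or.inr (hR.memA x h1 h2)⟩
    · exact Finset.mem_insert_of_mem (hR.memB x h1 h2)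
    · rw [Finset.mem_insert, not_or]; exact ⟨by omega, hR.not_memB⟩
    · rw [Finset.mem_erase, Finset.mem_insert]
      have := hR.succ_not_memA
      rintro ⟨h1, h2 | h2⟩
      · omega
      · exact this h2
    · rw [hH2, hH1]; split_ifs <;> omega
    · rw [hH2, hH2, hH1, hH1]; have := hR.lt x hx; split_ifs <;> omega
    · have h1 := hR.max x
      have h2 := hb1lt x
      rw [hH1] at h2
      rw [hH2, hH2, hH1, hH1]; split_ifs at h2 ⊢ <;> omega
  have sa : IsStep A (B.erase b) a r := by
    refine ⟨hL.le, hL.memA, fun x h1 h2 => ?_, ?_, hL.succ_not_memA, ?_, fun x hx => ?_,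
      fun x => ?_⟩
    · rw [Finset.mem_erase]; exact ⟨by omega, hL.memB x h1 h2⟩
    · exact fun h => hL.not_memB (Finset.mem_of_mem_erase h)
    · rw [hG1]; split_ifs <;> omega
    · rw [hG1, hG1]; have := hL.lt x hx; split_ifs <;> omega
    · rw [hG1, hG1]; have := hL.max x; split_ifs <;> omega
  have hz1 := hG.stepL _ hz _ ⟨a, r, sa, rfl⟩
  have hG2 : ∀ x, ht (A.erase a) (insert r (B.erase b)) x = _ := sa.ht_after
  obtain ⟨a2, ha2, ha2M, ha2A, ha2B, ha2lt⟩ := exists_first (A := A.erase a)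
    (B := insert r (B.erase b)) (M := ht A B a) (lo := b)
    (fun x hx => by rw [hG2, hG1]; have := hL.lt x; split_ifs <;> omega)
    ⟨a, by rw [hG2, hG1]; split_ifs <;> omega⟩
  have ha2a : a2 < a := by
    rcases lt_trichotomy a2 a with h | h | h
    · exact h
    · exact absurd h (Finset.ne_of_mem_erase ha2A)
    · have := ha2lt a h
      rw [hG2, hG1] at this; split_ifs at this <;> omega
  obtain ⟨r2, hr2⟩ : ∃ r2, IsStep (A.erase a) (insert r (B.erase b)) a2 r2 :=
    exists_isStep (hG.redL _ hz1) ha2A ha2B (by rw [ha2M]; omega)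
    (by rwa [ha2M]) (fun x => by
      rw [ha2M, hG2, hG1]; have := hL.max x; have := hL.lt x; split_ifs <;> omega)
  have ha2r2 := hr2.le
  have hr2a : r2 < a := by
    by_contra hc
    exact Finset.ne_of_mem_erase (hr2.memA a (by omega) (by omega)) rfl
  have hqr2 : q < r2 := by
    by_contra hc
    refine hr2.not_memB (Finset.mem_insert_of_mem (Finset.mem_erase.2 ⟨by omega, ?_⟩))
    exact hR.memA _ (by omega) (by omega)
  have hne1 : r2 ∉ insert r (B.erase b) := hr2.not_memB
  have hr2b1 : b1 ≠ r2 := by omega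
  have hmem1 : b1 ∈ insert r (B.erase b) := by
    rcases Finset.mem_insert.1 hb1A with h | h
    · simp [h]
    · exact Finset.mem_insert_of_mem (Finset.mem_erase.2 ⟨by omega, h⟩)
  have hEqB : ((insert r B).erase b1).erase b = (insert r (B.erase b)).erase b1 := by
    ext x; simp only [Finset.mem_erase, Finset.mem_insert]
    constructor
    · rintro ⟨h1, h2, h3⟩; tauto
    · rintro ⟨h1, h2 | h2⟩
      · exact ⟨by omega, h1, Or.inl h2⟩
      · tauto
  have hG3 : ∀ x, ht (A.erase a) (((insert r B).erase b1).erase b) x =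
      ht (A.erase a) (insert r (B.erase b)) x + if b1 < x then 1 else 0 := by
    rw [hEqB]; exact ht_erase_lower hmem1
  have s3 : IsStep (A.erase a) (((insert r B).erase b1).erase b) a2 r2 := by
    refine ⟨ha2r2, hr2.memA, fun x h1 h2 => ?_, ?_, hr2.succ_not_memA, ?_, fun x hx => ?_,
      fun x => ?_⟩
    · rw [hEqB, Finset.mem_erase]; exact ⟨by omega, hr2.memB x h1 h2⟩
    · rw [hEqB]; exact fun h => hr2.not_memB (Finset.mem_of_mem_erase h)
    · rw [hG3, ha2M]; split_ifs <;> omega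
    · rw [hG3, hG3]; have := hr2.lt x hx; split_ifs <;> omega
    · have h1 := hr2.max x
      have h2 := hL.max x
      have h3 := hG2 x
      rw [hG1] at h3
      rw [hG3, hG3]; split_ifs at h3 ⊢ <;> omega
  have hH3 : ∀ x, ht (insert r2 (insert r (B.erase b))) (insert q C) x =
      ht B C x - (if b ≤ x then 1 else 0) - (if q < x then 1 else 0) +
        (if r ≤ x then 1 else 0) + if r2 ≤ x then 1 else 0 := by
    intro x
    rw [ht_insert_upper hne1, ht_insert_upper sa.not_memB, hR.ht_after]
  have s4 : IsStep (insert r2 (insert r (B.erase b))) (insert q C) b1 q1 := by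
    refine ⟨hbq1, fun x h1 h2 => ?_, fun x h1 h2 => ?_, ?_, ?_, ?_, fun x hx => ?_, fun x => ?_⟩
    · have := hq1.memA x h1 h2
      simp only [Finset.mem_insert, Finset.mem_erase] at this ⊢
      have h3 : x ≠ b := by omega
      tauto
    · exact Finset.mem_insert_of_mem (hq1.memB x h1 h2)
    · rw [Finset.mem_insert, not_or]; exact ⟨by omega, hq1.not_memB⟩
    · have := hq1.succ_not_memA
      simp only [Finset.mem_insert, Finset.mem_erase] at this ⊢
      have h3 : q1 + 1 ≠ r2 := by omega
      tauto
    · rw [hH3]; rw [hH1] at hb1M; split_ifs at hb1M ⊢ <;> omega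
    · have h1 := hR.max x
      have h2 := hb1lt x hx
      have h3 := hR.lt x
      rw [hH1] at h2 hb1M
      rw [hH3, hH3]; split_ifs at h2 hb1M ⊢ <;> omega
    · have h1 := hR.max x
      have h3 := hR.lt x
      rw [hH1] at hb1M
      rw [hH3, hH3]; split_ifs at hb1M ⊢ <;> omega
  refine ⟨_, _, _, _, _, ⟨b1, q1, hq1, rfl⟩, ⟨b, q, s2, rfl⟩, ⟨a2, r2, s3, rfl⟩, ⟨a, r, sa, rfl⟩,
    ⟨a2, r2, hr2, rfl⟩, ⟨b1, q1, s4, ?_⟩, ?_, ?_⟩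
  · simp only [Prod.mk.injEq, true_and]
    constructor
    · rw [hEqB, Finset.erase_insert_of_ne (Ne.symm hr2b1)]
    · exact Finset.insert_comm _ _ _
  · have h1 := s4.ht_eq
    rw [hH3] at h1; rw [hH1] at hb1M
    simp only [epsR]
    split_ifs at h1 hb1M <;> omega
  · have h1 := s3.ht_eq
    rw [hG3, ha2M] at h1
    simp only [epsL]
    split_ifs at h1 <;> omega

set_option maxHeartbeats 2000000 in
theorem deg4_of_gt {G : Set (Finset ℤ × Finset ℤ × Finset ℤ)} (hG : Closed3 G)
    {A B C : Finset ℤ} (hx : (A, B, C) ∈ G) {a r b q : ℤ} (hL : IsStep A B a r)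
    (hR : IsStep B C b q) (hrb : r < b) (hex : ∃ x, b < x ∧ ht A B x = ht A B a) :
    Deg4 (A, B, C) (A.erase a, insert r B, C) (A, B.erase b, insert q C) := by
  have har := hL.le
  have hbq := hR.le
  have hK := hR.ht_eq
  have hM := hL.ht_eq
  have hH1 : ∀ x, ht (insert r B) C x = ht B C x + if r ≤ x then 1 else 0 :=
    ht_insert_upper hL.not_memB
  have hG1 : ∀ x, ht A (B.erase b) x = ht A B x + if b < x then 1 else 0 :=
    ht_erase_lower hR.mem_left
  have hy : (A.erase a, insert r B, C) ∈ G := hG.stepL _ hx _ ⟨a, r, hL, rfl⟩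
  have hz : (A, B.erase b, insert q C) ∈ G := hG.stepR _ hx _ ⟨b, q, hR, rfl⟩
  have hpR := hR.pos
  have hpL := hL.pos
  obtain ⟨a1, ha1, ha1M, ha1A, ha1B, ha1lt⟩ := exists_first (A := A) (B := B.erase b)
    (M := ht A B a + 1) (lo := b)
    (fun x hx => by rw [hG1, if_neg (by omega)]; have := hL.max x; omega)
    (by obtain ⟨x, h1, h2⟩ := hex
        exact ⟨x, by rw [hG1, if_pos h1]; omega⟩)
  obtain ⟨r1, hr1⟩ := exists_isStep (hG.redL _ hz) ha1A ha1B (by rw [ha1M]; omega)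
    (by rwa [ha1M]) (fun x => by rw [ha1M, hG1]; have := hL.max x; split_ifs <;> omega)
  have har1 := hr1.le
  have hqr1 : q < r1 := by
    by_contra hc
    exact hr1.not_memB (Finset.mem_erase.2 ⟨by omega, hR.memA _ (by omega) (by omega)⟩)
  have hG2 : ∀ x, ht (A.erase a1) (insert r1 (B.erase b)) x = _ := hr1.ht_after
  have s2 : IsStep (A.erase a1) (insert r1 (B.erase b)) a r := by
    refine ⟨har, fun x h1 h2 => ?_, fun x h1 h2 => ?_, ?_, ?_, ?_, fun x hx => ?_, fun x => ?_⟩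
    · rw [Finset.mem_erase]; exact ⟨by omega, hL.memA x h1 h2⟩
    · rw [Finset.mem_insert, Finset.mem_erase]; exact Or.inr ⟨by omega, hL.memB x h1 h2⟩
    · rw [Finset.mem_insert, Finset.mem_erase]
      have := hL.not_memB
      rintro (h | h)
      · omega
      · exact this h.2
    · exact fun h => hL.succ_not_memA (Finset.mem_of_mem_erase h)
    · rw [hG2, hG1]; split_ifs <;> omega
    · rw [hG2, hG2, hG1, hG1]; have := hL.lt x hx; split_ifs <;> omega
    · have h1 := hL.max x
      have h2 := ha1lt x
      rw [hG1] at h2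
      rw [hG2, hG2, hG1, hG1]; split_ifs at h2 ⊢ <;> omega
  have sb : IsStep (insert r B) C b q := by
    refine ⟨hR.le, fun x h1 h2 => Finset.mem_insert_of_mem (hR.memA x h1 h2), hR.memB, hR.not_memB,
      ?_, ?_, fun x hx => ?_, fun x => ?_⟩
    · simp only [Finset.mem_insert, not_or]; exact ⟨by omega, hR.succ_not_memA⟩
    · rw [hH1]; split_ifs <;> omega
    · rw [hH1, hH1]; have := hR.lt x hx; split_ifs <;> omega
    · rw [hH1, hH1]; have := hR.max x; split_ifs <;> omega
  have hy1 := hG.stepR _ hy _ ⟨b, q, sb, rfl⟩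
  have hH2 : ∀ x, ht ((insert r B).erase b) (insert q C) x = _ := sb.ht_after
  obtain ⟨b2, hb2, hb2M, hb2A, hb2B, hb2lt⟩ := exists_first (A := (insert r B).erase b)
    (B := insert q C) (M := ht B C b) (lo := r - 1)
    (fun x hx => by rw [hH2, hH1]; have := hR.lt x; split_ifs <;> omega)
    ⟨b, by rw [hH2, hH1]; split_ifs <;> omega⟩
  have hb2b : b2 < b := by
    rcases lt_trichotomy b2 b with h | h | h
    · exact h
    · exact absurd h (Finset.ne_of_mem_erase hb2A)
    · have := hb2lt b h
      rw [hH2, hH1] at this; split_ifs at this <;> omega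
  obtain ⟨q2, hq2⟩ : ∃ q2, IsStep ((insert r B).erase b) (insert q C) b2 q2 :=
    exists_isStep (hG.redR _ hy1) hb2A hb2B (by rw [hb2M]; omega)
    (by rwa [hb2M]) (fun x => by
      rw [hb2M, hH2, hH1]; have := hR.max x; have := hR.lt x; split_ifs <;> omega)
  have hb2q2 := hq2.le
  have hq2b : q2 < b := by
    by_contra hc
    exact Finset.ne_of_mem_erase (hq2.memA b (by omega) (by omega)) rfl
  have hne : r ≠ b := by omega
  have hBe : (insert r B).erase b = insert r (B.erase b) := Finset.erase_insert_of_ne hne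
  have hr1' : r1 ∉ insert r (B.erase b) := by
    rw [Finset.mem_insert, not_or]; exact ⟨by omega, hr1.not_memB⟩
  have hcomm : insert r (insert r1 (B.erase b)) = insert r1 ((insert r B).erase b) := by
    rw [hBe, Finset.insert_comm]
  have hH3 : ∀ x, ht (insert r (insert r1 (B.erase b))) (insert q C) x =
      ht ((insert r B).erase b) (insert q C) x + if r1 ≤ x then 1 else 0 := by
    rw [hcomm]
    exact ht_insert_upper (by rwa [hBe])
  have s4 : IsStep (insert r (insert r1 (B.erase b))) (insert q C) b2 q2 := by
    refine ⟨hb2q2, fun x h1 h2 => ?_, hq2.memB, hq2.not_memB, ?_, ?_, fun x hx => ?_, fun x => ?_⟩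
    · rw [hcomm]; exact Finset.mem_insert_of_mem (hq2.memA x h1 h2)
    · rw [hcomm, Finset.mem_insert, not_or]; exact ⟨by omega, hq2.succ_not_memA⟩
    · rw [hH3, hb2M]; split_ifs <;> omega
    · rw [hH3, hH3]; have := hq2.lt x hx; split_ifs <;> omega
    · have h1 := hq2.max x
      have h2 := hR.max x
      have h3 := hH2 x
      rw [hH1] at h3
      rw [hH3, hH3]; split_ifs at h3 ⊢ <;> omega
  have hG3 : ∀ x, ht (A.erase a) (((insert r B).erase b).erase b2) x =
      ht A B x - (if a ≤ x then 1 else 0) - (if r < x then 1 else 0) +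
        (if b < x then 1 else 0) + if b2 < x then 1 else 0 := by
    intro x
    rw [ht_erase_lower hb2A, ht_erase_lower (Finset.mem_insert_of_mem hR.mem_left), hL.ht_after]
  have s3 : IsStep (A.erase a) (((insert r B).erase b).erase b2) a1 r1 := by
    refine ⟨har1, fun x h1 h2 => ?_, fun x h1 h2 => ?_, ?_, ?_, ?_, fun x hx => ?_, fun x => ?_⟩
    · rw [Finset.mem_erase]; exact ⟨by omega, hr1.memA x h1 h2⟩
    · rw [hBe, Finset.mem_erase]
      exact ⟨by omega, Finset.mem_insert_of_mem (hr1.memB x h1 h2)⟩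
    · rw [hBe]; exact fun h => hr1' (Finset.mem_of_mem_erase h)
    · exact fun h => hr1.succ_not_memA (Finset.mem_of_mem_erase h)
    · rw [hG3]; rw [hG1] at ha1M; split_ifs at ha1M ⊢ <;> omega
    · have h1 := hL.max x
      have h2 := ha1lt x hx
      have h3 := hL.lt x
      rw [hG1] at h2 ha1M
      rw [hG3, hG3]; split_ifs at h2 ha1M ⊢ <;> omega
    · have h1 := hL.max x
      have h3 := hL.lt x
      rw [hG1] at ha1M
      rw [hG3, hG3]; split_ifs at ha1M ⊢ <;> omega
  refine ⟨_, _, _, _, _, ⟨b, q, sb, rfl⟩, ⟨b2, q2, hq2, rfl⟩, ⟨a1, r1, s3, rfl⟩,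
    ⟨a1, r1, hr1, rfl⟩, ⟨a, r, s2, rfl⟩, ⟨b2, q2, s4, ?_⟩, ?_, ?_⟩
  · simp only [Prod.mk.injEq, and_true]
    constructor
    · exact Finset.erase_right_comm
    · rw [hcomm, Finset.erase_insert_of_ne (show r1 ≠ b2 by omega)]
  · have h1 := s4.ht_eq
    rw [hH3, hb2M] at h1
    simp only [epsR]
    split_ifs at h1 <;> omega
  · have h1 := s3.ht_eq
    rw [hG3] at h1; rw [hG1] at ha1M
    simp only [epsL]
    split_ifs at h1 ha1M <;> omega

set_option maxHeartbeats 2000000 in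
theorem deg4_of_mem {G : Set (Finset ℤ × Finset ℤ × Finset ℤ)} (hG : Closed3 G)
    {A B C : Finset ℤ} (hx : (A, B, C) ∈ G) {a r b q : ℤ} (hL : IsStep A B a r)
    (hR : IsStep B C b q) (hab : a ≤ b) (hbr : b < r) :
    Deg4 (A, B, C) (A.erase a, insert r B, C) (A, B.erase b, insert q C) := by
  have har := hL.le
  have hbq := hR.le
  have hK := hR.ht_eq
  have hM := hL.ht_eq
  have hpR := hR.pos
  have hpL := hL.pos
  obtain rfl : r = q + 1 := by
    have h1 : ¬ q + 1 < r := fun h => hR.succ_not_memA (hL.memB _ (by omega) h)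
    have h2 : ¬ r ≤ q := fun h => hL.not_memB (hR.memA _ (by omega) h)
    omega
  have hH1 : ∀ x, ht (insert (q + 1) B) C x = ht B C x + if q + 1 ≤ x then 1 else 0 :=
    ht_insert_upper hL.not_memB
  have hG1 : ∀ x, ht A (B.erase b) x = ht A B x + if b < x then 1 else 0 :=
    ht_erase_lower hR.mem_left
  have hy : (A.erase a, insert (q + 1) B, C) ∈ G := hG.stepL _ hx _ ⟨a, _, hL, rfl⟩
  have hHq := hR.ht_run_eq (q + 1) (by omega) le_rfl
  have hGb := hL.ht_run_eq (b + 1) (by omega) (by omega)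
  obtain ⟨q1, hq1⟩ := exists_isStep (a := q + 1) (hG.redR _ hy) (Finset.mem_insert_self _ _)
    (by rw [add_sub_cancel_right]; exact hR.not_memB) (by rw [hH1]; split_ifs <;> omega)
    (fun x hx => by rw [hH1, hH1]; have := hR.max x; split_ifs <;> omega)
    (fun x => by rw [hH1, hH1]; have := hR.max x; split_ifs <;> omega)
  have hqq1 := hq1.le
  have hBe : (insert (q + 1) B).erase (q + 1) = B := Finset.erase_insert hL.not_memB
  have hH2 : ∀ x, ht ((insert (q + 1) B).erase (q + 1)) (insert q1 C) x = _ := hq1.ht_after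
  have s2 : IsStep ((insert (q + 1) B).erase (q + 1)) (insert q1 C) b q := by
    refine ⟨hbq, fun x h1 h2 => ?_, fun x h1 h2 => ?_, ?_, ?_, ?_, fun x hx => ?_, fun x => ?_⟩
    · rw [hBe]; exact hR.memA x h1 h2
    · exact Finset.mem_insert_of_mem (hR.memB x h1 h2)
    · rw [Finset.mem_insert, not_or]; exact ⟨by omega, hR.not_memB⟩
    · rw [hBe]; exact hR.succ_not_memA
    · rw [hH2, hH1]; split_ifs <;> omega
    · rw [hH2, hH2, hH1, hH1]; have := hR.lt x hx; split_ifs <;> omega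
    · rw [hH2, hH2, hH1, hH1]; have := hR.max x; split_ifs <;> omega
  have hG3 : ∀ x, ht (A.erase a) (((insert (q + 1) B).erase (q + 1)).erase b) x =
      ht A B x - (if a ≤ x then 1 else 0) + if b < x then 1 else 0 := by
    intro x
    rw [hBe, ht_erase_lower hR.mem_left, ht_erase_upper hL.mem_left]
  have s3 : IsStep (A.erase a) (((insert (q + 1) B).erase (q + 1)).erase b) (b + 1) (q + 1) := by
    refine ⟨by omega, fun x h1 h2 => ?_, fun x h1 h2 => ?_, ?_, ?_, ?_, fun x hx => ?_, fun x => ?_⟩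
    · rw [Finset.mem_erase]; exact ⟨by omega, hL.memA x (by omega) h2⟩
    · rw [hBe, Finset.mem_erase]; exact ⟨by omega, hL.memB x (by omega) h2⟩
    · rw [hBe]; exact fun h => hL.not_memB (Finset.mem_of_mem_erase h)
    · exact fun h => hL.succ_not_memA (Finset.mem_of_mem_erase h)
    · rw [hG3]; split_ifs <;> omega
    · rw [hG3, hG3]; have := hL.lt x; have := hL.max x; split_ifs <;> omega
    · rw [hG3, hG3]; have := hL.lt x; have := hL.max x; split_ifs <;> omega
  have t1 : IsStep A (B.erase b) (b + 1) (q + 1) := by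
    refine ⟨by omega, fun x h1 h2 => hL.memA x (by omega) h2, fun x h1 h2 => ?_, ?_,
      hL.succ_not_memA, ?_, fun x hx => ?_, fun x => ?_⟩
    · rw [Finset.mem_erase]; exact ⟨by omega, hL.memB x (by omega) h2⟩
    · exact fun h => hL.not_memB (Finset.mem_of_mem_erase h)
    · rw [hG1]; split_ifs <;> omega
    · rw [hG1, hG1]; have := hL.max x; split_ifs <;> omega
    · rw [hG1, hG1]; have := hL.max x; split_ifs <;> omega
  have hG2 : ∀ x, ht (A.erase (b + 1)) (insert (q + 1) (B.erase b)) x = _ := t1.ht_after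
  have t2 : IsStep (A.erase (b + 1)) (insert (q + 1) (B.erase b)) a b := by
    refine ⟨hab, fun x h1 h2 => ?_, fun x h1 h2 => ?_, ?_, ?_, ?_, fun x hx => ?_, fun x => ?_⟩
    · rw [Finset.mem_erase]; exact ⟨by omega, hL.memA x h1 (by omega)⟩
    · rw [Finset.mem_insert, Finset.mem_erase]
      exact Or.inr ⟨by omega, hL.memB x h1 (by omega)⟩
    · simp; omega
    · simp
    · rw [hG2, hG1]; split_ifs <;> omega
    · rw [hG2, hG2, hG1, hG1]; have := hL.lt x hx; split_ifs <;> omega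
    · rw [hG2, hG2, hG1, hG1]; have := hL.max x; split_ifs <;> omega
  have hBe2 : insert b (insert (q + 1) (B.erase b)) = insert (q + 1) B := by
    rw [Finset.insert_comm, Finset.insert_erase hR.mem_left]
  have hH3 : ∀ x, ht (insert b (insert (q + 1) (B.erase b))) (insert q C) x = ht B C x := by
    intro x
    rw [hBe2, ht_insert_lower hR.not_memB, hH1]
    split_ifs <;> omega
  have t3 : IsStep (insert b (insert (q + 1) (B.erase b))) (insert q C) b q1 := by
    refine ⟨by omega, fun x h1 h2 => ?_, fun x h1 h2 => ?_, ?_, ?_, ?_, fun x hx => ?_, fun x => ?_⟩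
    · rw [hBe2]
      rcases le_or_gt x q with h | h
      · exact Finset.mem_insert_of_mem (hR.memA x h1 h)
      · exact hq1.memA x (by omega) h2
    · rw [Finset.mem_insert]
      rcases lt_trichotomy x q with h | h | h
      · exact Or.inr (hR.memB x h1 h)
      · exact Or.inl h
      · exact Or.inr (hq1.memB x (by omega) h2)
    · rw [Finset.mem_insert, not_or]; exact ⟨by omega, hq1.not_memB⟩
    · rw [hBe2]; exact hq1.succ_not_memA
    · rw [hH3]; exact hR.pos
    · rw [hH3, hH3]; exact hR.lt x hx
    · rw [hH3, hH3]; exact hR.max x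
  refine ⟨_, _, _, _, _, ⟨_, q1, hq1, rfl⟩, ⟨b, q, s2, rfl⟩, ⟨_, _, s3, rfl⟩,
    ⟨_, _, t1, rfl⟩, ⟨a, b, t2, rfl⟩, ⟨b, q1, t3, ?_⟩, ?_, ?_⟩
  · simp only [Prod.mk.injEq]
    refine ⟨Finset.erase_right_comm, ?_, Finset.insert_comm _ _ _⟩
    rw [hBe, hBe2, Finset.erase_insert_of_ne (by omega)]
  · have h1 := t3.ht_eq
    rw [hH3] at h1
    simp only [epsR]
    omega
  · have h1 := s3.ht_eq
    rw [hG3] at h1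
    simp only [epsL]
    split_ifs at h1 <;> omega

theorem Closed3.deg4 {G : Set (Finset ℤ × Finset ℤ × Finset ℤ)} (hG : Closed3 G)
    {x y z : Finset ℤ × Finset ℤ × Finset ℤ} (hx : x ∈ G) (h1 : StepL x y) (h2 : StepR x z)
    (he1 : epsR y = epsR x + 1) (he2 : epsL z = epsL x + 1) : Deg4 x y z := by
  obtain ⟨A, B, C⟩ := x
  obtain ⟨a, r, hL, rfl⟩ := h1
  obtain ⟨b, q, hR, rfl⟩ := h2
  simp only [epsL, epsR] at *
  have hK := hR.ht_eq
  have hM := hL.ht_eq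
  have hb : b ≠ r := fun h => hL.not_memB (h ▸ hR.mem_left)
  by_cases hba : b < a
  · refine deg4_of_lt hG hx hL hR hba ?_
    obtain ⟨x, hx⟩ := exists_ht_eq_hEps (insert r B) C
    have h3 := hR.max x
    rw [ht_insert_upper hL.not_memB] at hx
    exact ⟨x, by split_ifs at hx <;> omega, by split_ifs at hx <;> omega⟩
  by_cases hrb : r < b
  · refine deg4_of_gt hG hx hL hR hrb ?_
    obtain ⟨x, hx⟩ := exists_ht_eq_hEps A (B.erase b)
    have h3 := hL.max x
    rw [ht_erase_lower hR.mem_left] at hx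
    exact ⟨x, by split_ifs at hx <;> omega, by split_ifs at hx <;> omega⟩
  · exact deg4_of_mem hG hx hL hR (by omega) (by omega)

/-- Reflection of a triple, exchanging raising and lowering. -/
def neg3 (x : Finset ℤ × Finset ℤ × Finset ℤ) : Finset ℤ × Finset ℤ × Finset ℤ :=
  (negF x.2.2, negF x.2.1, negF x.1)

@[simp] theorem neg3_neg3 (x : Finset ℤ × Finset ℤ × Finset ℤ) : neg3 (neg3 x) = x := by
  simp [neg3]

theorem StepL.neg3 {x y : Finset ℤ × Finset ℤ × Finset ℤ} (h : StepL x y) :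
    StepR (neg3 y) (neg3 x) := by
  obtain ⟨a, r, h, rfl⟩ := h
  refine ⟨-r, -a, h.neg, ?_⟩
  simp only [_root_.neg3]
  rw [h.negF_upper, h.negF_lower]

theorem StepR.neg3 {x y : Finset ℤ × Finset ℤ × Finset ℤ} (h : StepR x y) :
    StepL (neg3 y) (neg3 x) := by
  obtain ⟨a, r, h, rfl⟩ := h
  refine ⟨-r, -a, h.neg, ?_⟩
  simp only [_root_.neg3]
  rw [h.negF_upper, h.negF_lower]

theorem Closed3.neg3 {G : Set (Finset ℤ × Finset ℤ × Finset ℤ)} (hG : Closed3 G) :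
    Closed3 {x | _root_.neg3 x ∈ G} where
  redL x hx := by simpa [_root_.neg3] using (hG.redR _ hx).neg
  redR x hx := by simpa [_root_.neg3] using (hG.redL _ hx).neg
  stepL x hx y h := hG.backR _ hx _ h.neg3
  stepR x hx y h := hG.backL _ hx _ h.neg3
  backL x hx y h := hG.stepR _ hx _ h.neg3
  backR x hx y h := hG.stepL _ hx _ h.neg3

/-! ### Abstract crystals -/

/-- Indices adjacent in the Dynkin diagram. -/
def Near (i j : ℕ) : Prop := i = j + 1 ∨ j = i + 1

/-- Distinct indices that are not adjacent in the Dynkin diagram. -/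
def Far (i j : ℕ) : Prop := i + 1 < j ∨ j + 1 < i

theorem Near.symm {i j : ℕ} (h : Near i j) : Near j i := Or.symm h
theorem Far.symm {i j : ℕ} (h : Far i j) : Far j i := Or.symm h

theorem eq_or_near_or_far (i j : ℕ) : i = j ∨ Near i j ∨ Far i j := by
  unfold Near Far; omega

/-- A crystal satisfying local axioms; `step i x y` means that the raising operator of index `i`
sends `x` to `y`. -/
structure Crys (X : Type) where
  step : ℕ → X → X → Prop
  eps : ℕ → X → ℕ
  phi : ℕ → X → ℕ
  depth : X → ℕ
  det : ∀ {i x y z}, step i x y → step i x z → y = z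
  inj : ∀ {i x y z}, step i x z → step i y z → x = y
  exists_step : ∀ {i x}, 0 < eps i x → ∃ y, step i x y
  exists_back : ∀ {i y}, 0 < phi i y → ∃ x, step i x y
  step_eps : ∀ {i x y}, step i x y → eps i x = eps i y + 1
  step_phi : ∀ {i x y}, step i x y → phi i y = phi i x + 1
  step_depth : ∀ {i x y}, step i x y → depth x = depth y + 1
  far_eps : ∀ {i j x y}, step i x y → Far i j → eps j y = eps j x
  far_phi : ∀ {i j x y}, step i x y → Far i j → phi j y = phi j x
  near_label : ∀ {i j x y}, step i x y → Near i j →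
    (eps j y = eps j x ∧ phi j x = phi j y + 1) ∨ (eps j y = eps j x + 1 ∧ phi j y = phi j x)
  far_comm : ∀ {i j x y z}, step i x y → step j x z → Far i j → ∃ t, step j y t ∧ step i z t
  near_comm : ∀ {i j x y z}, step i x y → step j x z → Near i j → eps j y = eps j x →
    eps i z = eps i x + 1 ∧ ∃ t, step j y t ∧ step i z t
  near_deg4 : ∀ {i j x y z}, step i x y → step j x z → Near i j → eps j y = eps j x + 1 →
    eps i z = eps i x + 1 → ∃ y1 y2 z1 z2 t, step j y y1 ∧ step j y1 y2 ∧ step i y2 t ∧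
      step i z z1 ∧ step i z1 z2 ∧ step j z2 t ∧ eps j z2 = eps j x ∧ eps i y2 = eps i x
  near_comm' : ∀ {i j x y z}, step i y x → step j z x → Near i j → phi j y = phi j x →
    ∃ t, step j t y ∧ step i t z
  near_deg4' : ∀ {i j x y z}, step i y x → step j z x → Near i j → phi j y = phi j x + 1 →
    phi i z = phi i x + 1 → ∃ y1 y2 z1 z2 t, step j y1 y ∧ step j y2 y1 ∧ step i t y2 ∧
      step i z1 z ∧ step i z2 z1 ∧ step j t z2

namespace Crys
variable {X : Type} (K : Crys X)

/-- `K.Reach x y`: some sequence of raising operators sends `x` to `y`. -/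
def Reach : X → X → Prop := Relation.ReflTransGen fun x y => ∃ i, K.step i x y

/-- Highest weight elements. -/
def IsHW (u : X) : Prop := ∀ i, K.eps i u = 0

variable {K}

theorem eps_pos_of_step {i : ℕ} {x y : X} (h : K.step i x y) : 0 < K.eps i x := by
  rw [K.step_eps h]; omega

theorem IsHW.not_step {u y : X} {i : ℕ} (h : K.IsHW u) : ¬ K.step i u y := fun hs => by
  have := eps_pos_of_step hs
  rw [h i] at this; omega

theorem IsHW.eq_of_reach {u v : X} (h : K.IsHW u) (hr : K.Reach u v) : v = u := by
  rcases Relation.ReflTransGen.cases_head hr with h1 | ⟨c, ⟨i, hc⟩, -⟩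
  · exact h1.symm
  · exact absurd hc h.not_step

theorem Reach.of_step {i : ℕ} {x y z : X} (h : K.step i x y) (hr : K.Reach y z) : K.Reach x z :=
  Relation.ReflTransGen.head ⟨i, h⟩ hr

theorem Reach.single {i : ℕ} {x y : X} (h : K.step i x y) : K.Reach x y :=
  Reach.of_step h .refl

theorem Reach.trans {x y z : X} (h : K.Reach x y) (h' : K.Reach y z) : K.Reach x z :=
  Relation.ReflTransGen.trans h h'

theorem exists_hw (K : Crys X) (x : X) : ∃ u, K.IsHW u ∧ K.Reach x u := by
  induction hn : K.depth x using Nat.strong_induction_on generalizing x with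
  | _ n ih =>
    by_cases h : K.IsHW x
    · exact ⟨x, h, .refl⟩
    · unfold IsHW at h
      push Not at h
      obtain ⟨i, hi⟩ := h
      obtain ⟨y, hy⟩ := K.exists_step (Nat.pos_of_ne_zero hi)
      obtain ⟨u, hu, hr⟩ := ih (K.depth y) (by have := K.step_depth hy; omega) y rfl
      exact ⟨u, hu, .of_step hy hr⟩

theorem exists_join {i j : ℕ} {x y z : X} (hy : K.step i x y) (hz : K.step j x z) :
    ∃ t, K.Reach y t ∧ K.Reach z t := by
  rcases eq_or_near_or_far i j with rfl | h | h
  · rw [K.det hy hz]; exact ⟨z, .refl, .refl⟩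
  · rcases K.near_label hy h with h1 | h1
    · obtain ⟨-, t, h2, h3⟩ := K.near_comm hy hz h h1.1
      exact ⟨t, .single h2, .single h3⟩
    · rcases K.near_label hz h.symm with h2 | h2
      · obtain ⟨-, t, h2, h3⟩ := K.near_comm hz hy h.symm h2.1
        exact ⟨t, .single h3, .single h2⟩
      · obtain ⟨y1, y2, z1, z2, t, a1, a2, a3, b1, b2, b3, -⟩ := K.near_deg4 hy hz h h1.1 h2.1
        exact ⟨t, .of_step a1 (.of_step a2 (.single a3)), .of_step b1 (.of_step b2 (.single b3))⟩
  · obtain ⟨t, h2, h3⟩ := K.far_comm hy hz h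
    exact ⟨t, .single h2, .single h3⟩

theorem hw_unique {x u v : X} (hu : K.IsHW u) (hv : K.IsHW v) (hxu : K.Reach x u)
    (hxv : K.Reach x v) : u = v := by
  induction hn : K.depth x using Nat.strong_induction_on generalizing x u v with
  | _ n ih =>
    rcases Relation.ReflTransGen.cases_head hxu with h | ⟨y, ⟨i, hy⟩, hyu⟩
    · subst h; exact (hu.eq_of_reach hxv).symm
    rcases Relation.ReflTransGen.cases_head hxv with h | ⟨z, ⟨j, hz⟩, hzv⟩
    · subst h; exact hv.eq_of_reach hxu
    obtain ⟨t, hyt, hzt⟩ := exists_join hy hz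
    obtain ⟨w, hw, htw⟩ := K.exists_hw t
    have h1 := ih (K.depth y) (by have := K.step_depth hy; omega) hu hw hyu (hyt.trans htw) rfl
    have h2 := ih (K.depth z) (by have := K.step_depth hz; omega) hv hw hzv (hzt.trans htw) rfl
    rw [h1, h2]

theorem reach_of_reach {x y u : X} (hu : K.IsHW u) (hxu : K.Reach x u) (hxy : K.Reach x y) :
    K.Reach y u := by
  obtain ⟨v, hv, hyv⟩ := K.exists_hw y
  rwa [hw_unique hu hv hxu (hxy.trans hyv)]

theorem weight_step {i j : ℕ} {x y x' y' : X} {X' : Type} {K' : Crys X'} {a a' b b' : X'}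
    (_ : x = x') (_ : y = y') (_ : a = a') (_ : b = b') (h : K.step i x y) (h' : K'.step i a b)
    (he : K.eps j y = K'.eps j b) (hp : K.phi j y = K'.phi j b) (hx : K.eps j x = K'.eps j a) :
    K.phi j x = K'.phi j a := by
  rcases eq_or_near_or_far i j with rfl | hn | hf
  · have := K.step_phi h; have := K'.step_phi h'; omega
  · have := K.near_label h hn; have := K'.near_label h' hn; omega
  · have := K.far_phi h hf; have := K'.far_phi h' hf; omega

end Crys

/-! ### Isomorphism of components -/

/-- Elements of two crystals obtained from `u`, `u'` by the same lowering operators. -/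
inductive Matched {X X' : Type} (K : Crys X) (K' : Crys X') (u : X) (u' : X') :
    ℕ → X → X' → Prop
  | base : Matched K K' u u' 0 u u'
  | step {n i x y x' y'} : Matched K K' u u' n y y' → K.step i x y → K'.step i x' y' →
      Matched K K' u u' (n + 1) x x'

namespace Matched
variable {X X' : Type} {K : Crys X} {K' : Crys X'} {u : X} {u' : X'}

theorem symm {n : ℕ} {x : X} {x' : X'} (h : Matched K K' u u' n x x') :
    Matched K' K u' u n x' x := by
  induction h with
  | base => exact .base
  | step _ h1 h2 ih => exact .step ih h2 h1

theorem reach {n : ℕ} {x : X} {x' : X'} (h : Matched K K' u u' n x x') : K.Reach x u := by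
  induction h with
  | base => exact .refl
  | step _ h1 _ ih => exact .of_step h1 ih

/-- The assertion that matched pairs at level at most `n` look alike. -/
def Good (K : Crys X) (K' : Crys X') (u : X) (u' : X') (n : ℕ) : Prop :=
  ∀ m ≤ n, ∀ x x', Matched K K' u u' m x x' →
    (∀ i, K.eps i x = K'.eps i x' ∧ K.phi i x = K'.phi i x') ∧
    (∀ i z, K.step i x z → ∃ m' z', m = m' + 1 ∧ K'.step i x' z' ∧ Matched K K' u u' m' z z')

theorem Good.symm {n : ℕ} (h : Good K K' u u' n) : Good K' K u' u n := by
  intro m hm x' x hx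
  obtain ⟨h1, h2⟩ := h m hm x x' hx.symm
  refine ⟨fun i => ⟨(h1 i).1.symm, (h1 i).2.symm⟩, fun i z' hz' => ?_⟩
  obtain ⟨z, hz⟩ := K.exists_step (i := i) (x := x)
    (by rw [(h1 i).1]; exact Crys.eps_pos_of_step hz')
  obtain ⟨m', z'', h3, h4, h5⟩ := h2 i z hz
  rw [K'.det hz' h4]
  exact ⟨m', z, h3, hz, h5.symm⟩

theorem exists_lower {n m : ℕ} (hG : Good K K' u u' n) (hm : m < n) {i : ℕ} {y z : X} {y' : X'}
    (hy : Matched K K' u u' m y y') (h : K.step i z y) :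
    ∃ z', K'.step i z' y' ∧ Matched K K' u u' (m + 1) z z' := by
  obtain ⟨z', hz'⟩ := K'.exists_back (i := i) (y := y')
    (by rw [← ((hG m hm.le y y' hy).1 i).2, K.step_phi h]; omega)
  exact ⟨z', hz', hy.step h hz'⟩

theorem forward {n : ℕ} (hG : Good K K' u u' n) {i j : ℕ} {x y z : X} {x' y' : X'}
    (hy : Matched K K' u u' n y y') (hxy : K.step i x y) (hxy' : K'.step i x' y')
    (hxz : K.step j x z) : ∃ z', K'.step j x' z' ∧ Matched K K' u u' n z z' := by
  have hyG := hG n le_rfl y y' hy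
  rcases eq_or_near_or_far i j with rfl | h | h
  · exact ⟨y', hxy', K.det hxy hxz ▸ hy⟩
  · rcases K.near_label hxy h with h1 | h1
    · obtain ⟨h2, t, hyt, hzt⟩ := K.near_comm hxy hxz h h1.1
      obtain ⟨m, t', rfl, hyt', ht⟩ := hyG.2 j t hyt
      obtain ⟨z', hzt', hz⟩ := exists_lower hG (Nat.lt_succ_self m) ht hzt
      have e1 := K.step_eps hxy
      have e2 := K.step_eps hzt
      have e3 : K.phi i y = K.phi i t := by
        have := K.near_label hyt h.symm; omega
      rw [(hyG.1 i).2, ((hG m (by omega) t t' ht).1 i).2] at e3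
      obtain ⟨w, hw1, hw2⟩ := K'.near_comm' hyt' hzt' h.symm e3
      rw [K'.inj hw1 hxy'] at hw2
      exact ⟨z', hw2, hz⟩
    · rcases K.near_label hxz h.symm with h2 | h2
      · obtain ⟨h3, t, hzt, hyt⟩ := K.near_comm hxz hxy h.symm h2.1
        obtain ⟨m, t', rfl, hyt', ht⟩ := hyG.2 j t hyt
        obtain ⟨z', hzt', hz⟩ := exists_lower hG (Nat.lt_succ_self m) ht hzt
        have e1 := K.step_eps hxz
        have e2 := K.step_eps hyt
        have e3 : K.phi j z = K.phi j t := by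
          have := K.near_label hzt h; omega
        rw [((hG _ le_rfl z z' hz).1 j).2, ((hG m (by omega) t t' ht).1 j).2] at e3
        obtain ⟨w, hw1, hw2⟩ := K'.near_comm' hzt' hyt' h e3
        rw [K'.inj hw2 hxy'] at hw1
        exact ⟨z', hw1, hz⟩
      · obtain ⟨y1, y2, z1, z2, t, a1, a2, a3, b1, b2, b3, l1, l2⟩ :=
          K.near_deg4 hxy hxz h h1.1 h2.1
        obtain ⟨m, y1', rfl, a1', hy1⟩ := hyG.2 _ _ a1
        obtain ⟨m, y2', rfl, a2', hy2⟩ := (hG _ (by omega) _ _ hy1).2 _ _ a2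
        obtain ⟨m, t', rfl, a3', ht⟩ := (hG _ (by omega) _ _ hy2).2 _ _ a3
        obtain ⟨z2', b3', hz2⟩ := exists_lower hG (by omega) ht b3
        obtain ⟨z1', b2', hz1⟩ := exists_lower hG (by omega) hz2 b2
        obtain ⟨z', b1', hz⟩ := exists_lower hG (by omega) hz1 b1
        have e1 := K.step_eps hxy
        have e2 := K.step_eps hxz
        have e3 := K.step_eps a1
        have e4 := K.step_eps a2
        have e5 := K.step_eps a3
        have e6 := K.step_eps b1
        have e7 := K.step_eps b2
        have e8 := K.step_eps b3
        have f1 : K.phi j y2 = K.phi j t + 1 := by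
          have := K.near_label a3 h; omega
        have f2 : K.phi i z2 = K.phi i t + 1 := by
          have := K.near_label b3 h.symm; omega
        have hTt := (hG _ (by omega) _ _ ht).1
        rw [((hG _ (by omega) _ _ hy2).1 j).2, (hTt j).2] at f1
        rw [((hG _ (by omega) _ _ hz2).1 i).2, (hTt i).2] at f2
        obtain ⟨p1, p2, q1, q2, w, c1, c2, c3, d1, d2, d3⟩ := K'.near_deg4' a3' b3' h f1 f2
        rw [K'.inj c1 a2'] at c2
        rw [K'.inj c2 a1'] at c3
        rw [K'.inj c3 hxy'] at d3
        rw [K'.inj d1 b2'] at d2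
        rw [K'.inj d2 b1'] at d3
        exact ⟨z', d3, hz⟩
  · obtain ⟨t, hyt, hzt⟩ := K.far_comm hxy hxz h
    obtain ⟨m, t', rfl, hyt', ht⟩ := hyG.2 j t hyt
    obtain ⟨z', hz'⟩ := K'.exists_step (i := j) (x := x')
      (by rw [← K'.far_eps hxy' h]; exact Crys.eps_pos_of_step hyt')
    obtain ⟨t'', h1, h2⟩ := K'.far_comm hxy' hz' h
    rw [K'.det h1 hyt'] at h2
    exact ⟨z', hz', ht.step hzt h2⟩

theorem good (hu : K.IsHW u) (hu' : K'.IsHW u') (hp : ∀ i, K.phi i u = K'.phi i u') (n : ℕ) :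
    Good K K' u u' n := by
  induction n with
  | zero =>
    intro m hm x x' hx
    obtain rfl : m = 0 := by omega
    cases hx
    exact ⟨fun i => ⟨by rw [hu i, hu' i], hp i⟩, fun i z hz => absurd hz hu.not_step⟩
  | succ n ih =>
    intro m hm x x' hx
    rcases Nat.lt_or_ge m (n + 1) with h | h
    · exact ih m (by omega) x x' hx
    obtain rfl : m = n + 1 := by omega
    cases hx with
    | @step _ i _ y _ y' hy h1 h2 =>
      have hf : ∀ j z, K.step j x z → ∃ z', K'.step j x' z' ∧ Matched K K' u u' n z z' :=
        fun j z hz => forward ih hy h1 h2 hz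
      have heps : ∀ j, K.eps j x = K'.eps j x' := by
        intro j
        rcases Nat.eq_zero_or_pos (K.eps j x) with h0 | h0
        · rcases Nat.eq_zero_or_pos (K'.eps j x') with h0' | h0'
          · rw [h0, h0']
          · obtain ⟨z', hz'⟩ := K'.exists_step h0'
            obtain ⟨z, hz, -⟩ := forward ih.symm hy.symm h2 h1 hz'
            have := Crys.eps_pos_of_step hz
            omega
        · obtain ⟨z, hz⟩ := K.exists_step h0
          obtain ⟨z', hz', hm⟩ := hf j z hz
          rw [K.step_eps hz, K'.step_eps hz', ((ih n le_rfl _ _ hm).1 j).1]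
      refine ⟨fun j => ⟨heps j, ?_⟩, fun j z hz => ?_⟩
      · have hyG := (ih n le_rfl _ _ hy).1 j
        exact Crys.weight_step rfl rfl rfl rfl h1 h2 hyG.1 hyG.2 (heps j)
      · obtain ⟨z', hz', hm⟩ := hf j z hz
        exact ⟨n, z', rfl, hz', hm⟩

theorem unique (hu : K.IsHW u) (hu' : K'.IsHW u') (hp : ∀ i, K.phi i u = K'.phi i u')
    {n m : ℕ} {x : X} {x' x'' : X'} (h : Matched K K' u u' n x x')
    (h' : Matched K K' u u' m x x'') : x' = x'' := by
  induction n generalizing m x x' x'' with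
  | zero =>
    cases h
    cases h' with
    | base => rfl
    | step _ h1 _ => exact absurd h1 hu.not_step
  | succ n ih =>
    cases h with
    | step hy h1 h2 =>
      obtain ⟨m', y'', -, h3, h4⟩ := (good hu hu' hp m m le_rfl _ _ h').2 _ _ h1
      rw [ih hy h4] at h2
      exact K'.inj h2 h3

theorem exists_right (hu : K.IsHW u) (hu' : K'.IsHW u') (hp : ∀ i, K.phi i u = K'.phi i u')
    {x : X} (h : K.Reach x u) : ∃ n x', Matched K K' u u' n x x' := by
  induction h using Relation.ReflTransGen.head_induction_on with
  | refl => exact ⟨0, u', .base⟩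
  | head hs _ ih =>
    obtain ⟨i, hs⟩ := hs
    obtain ⟨n, y', hy⟩ := ih
    obtain ⟨x', h1, h2⟩ := exists_lower (good hu hu' hp (n + 1)) (Nat.lt_succ_self n) hy hs
    exact ⟨n + 1, x', h2⟩

end Matched

/-! ### Crystals of block sequences -/

theorem hEps_insert_upper (A B : Finset ℤ) {r : ℤ} (h : r ∉ A) :
    hEps (insert r A) B = hEps A B ∨ hEps (insert r A) B = hEps A B + 1 := by
  obtain ⟨x, hx⟩ := exists_ht_eq_hEps A B
  obtain ⟨y, hy⟩ := exists_ht_eq_hEps (insert r A) B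
  have h1 := ht_insert_upper (B := B) h x
  have h2 := ht_insert_upper (B := B) h y
  have h3 := ht_le_hEps A B y
  have h4 := ht_le_hEps (insert r A) B x
  split_ifs at h1 h2 <;> omega

theorem hEps_erase_lower (A B : Finset ℤ) {r : ℤ} (h : r ∈ B) :
    hEps A (B.erase r) = hEps A B ∨ hEps A (B.erase r) = hEps A B + 1 := by
  obtain ⟨x, hx⟩ := exists_ht_eq_hEps A B
  obtain ⟨y, hy⟩ := exists_ht_eq_hEps A (B.erase r)
  have h1 := ht_erase_lower (A := A) h x
  have h2 := ht_erase_lower (A := A) h y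
  have h3 := ht_le_hEps A B y
  have h4 := ht_le_hEps A (B.erase r) x
  split_ifs at h1 h2 <;> omega

/-- Number of unpaired lower letters in the first two blocks. -/
def phiL (x : Finset ℤ × Finset ℤ × Finset ℤ) : ℕ := hPhi x.1 x.2.1

/-- Number of unpaired lower letters in the last two blocks. -/
def phiR (x : Finset ℤ × Finset ℤ × Finset ℤ) : ℕ := hPhi x.2.1 x.2.2

theorem epsL_neg3 (x) : epsL (neg3 x) = phiR x := hEps_neg _ _
theorem epsR_neg3 (x) : epsR (neg3 x) = phiL x := hEps_neg _ _

theorem StepL.label {x y} (h : StepL x y) :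
    (epsR y = epsR x ∧ phiR x = phiR y + 1) ∨ (epsR y = epsR x + 1 ∧ phiR y = phiR x) := by
  obtain ⟨A, B, C⟩ := x
  obtain ⟨a, r, h, rfl⟩ := h
  simp only [epsR, phiR]
  have h1 := hEps_insert_upper B C h.not_memB
  have h2 := hPhi_add B C
  have h3 := hPhi_add (insert r B) C
  have h4 := Finset.card_insert_of_notMem h.not_memB
  simp only at *
  omega

theorem StepR.label {x y} (h : StepR x y) :
    (epsL y = epsL x ∧ phiL x = phiL y + 1) ∨ (epsL y = epsL x + 1 ∧ phiL y = phiL x) := by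
  obtain ⟨A, B, C⟩ := x
  obtain ⟨a, r, h, rfl⟩ := h
  simp only [epsL, phiL]
  have h1 := hEps_erase_lower A B h.mem_left
  have h2 := hPhi_add A B
  have h3 := hPhi_add A (B.erase a)
  have h4 := Finset.card_erase_add_one h.mem_left
  simp only at *
  omega

theorem stepR_of_neg3 {x y} (h : StepL (neg3 x) (neg3 y)) : StepR y x := by
  have := h.neg3
  rwa [neg3_neg3, neg3_neg3] at this

theorem stepL_of_neg3 {x y} (h : StepR (neg3 x) (neg3 y)) : StepL y x := by
  have := h.neg3
  rwa [neg3_neg3, neg3_neg3] at this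

theorem step_commute_of_phiR_eq {x y z} (h1 : StepL y x) (h2 : StepR z x)
    (he : phiR y = phiR x) : ∃ t, StepR t y ∧ StepL t z := by
  obtain ⟨-, t, ha, hb⟩ := step_commute_of_epsL_eq h2.neg3 h1.neg3
    (by rw [epsL_neg3, epsL_neg3, he])
  rw [← neg3_neg3 t] at ha hb
  exact ⟨neg3 t, stepR_of_neg3 hb, stepL_of_neg3 ha⟩

theorem step_commute_of_phiL_eq {x y z} (h1 : StepL y x) (h2 : StepR z x)
    (he : phiL z = phiL x) : ∃ t, StepR t y ∧ StepL t z := by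
  obtain ⟨-, t, ha, hb⟩ := step_commute_of_epsR_eq h2.neg3 h1.neg3
    (by rw [epsR_neg3, epsR_neg3, he])
  rw [← neg3_neg3 t] at ha hb
  exact ⟨neg3 t, stepR_of_neg3 hb, stepL_of_neg3 ha⟩

theorem deg4_of_closed3' {G : Set (Finset ℤ × Finset ℤ × Finset ℤ)} (hG : Closed3 G)
    {x y z} (hx : x ∈ G) (h1 : StepL y x) (h2 : StepR z x) (he1 : phiR y = phiR x + 1)
    (he2 : phiL z = phiL x + 1) :
    ∃ y1 y2 z1 z2 t, StepR y1 y ∧ StepR y2 y1 ∧ StepL t y2 ∧ StepL z1 z ∧ StepL z2 z1 ∧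
      StepR t z2 := by
  obtain ⟨z1, z2, y1, y2, t, a1, a2, a3, b1, b2, b3, -⟩ :=
    hG.neg3.deg4 (x := neg3 x) (by simpa [neg3_neg3] using hx) h2.neg3 h1.neg3
      (by rw [epsR_neg3, epsR_neg3, he2]) (by rw [epsL_neg3, epsL_neg3, he1])
  rw [← neg3_neg3 z1] at a1 a2
  rw [← neg3_neg3 z2] at a2 a3
  rw [← neg3_neg3 y1] at b1 b2
  rw [← neg3_neg3 y2] at b2 b3
  rw [← neg3_neg3 t] at a3 b3
  exact ⟨neg3 y1, neg3 y2, neg3 z1, neg3 z2, neg3 t, stepR_of_neg3 b1, stepR_of_neg3 b2,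
    stepL_of_neg3 b3, stepL_of_neg3 a1, stepL_of_neg3 a2, stepR_of_neg3 a3⟩

/-- Objects determined by a finitely supported sequence of blocks, closed under raising and
lowering. -/
structure Model (X : Type) where
  blk : X → ℕ → Finset ℤ
  blk_inj : ∀ {x y}, blk x = blk y → x = y
  fin : ∀ x, ∃ N, ∀ m ≥ N, blk x m = ∅
  red : ∀ x i, Red (blk x (i + 1)) (blk x i)
  fwd : ∀ {x i a r}, IsStep (blk x (i + 1)) (blk x i) a r →
    ∃ y, blk y (i + 1) = (blk x (i + 1)).erase a ∧ blk y i = insert r (blk x i) ∧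
      ∀ m, m ≠ i → m ≠ i + 1 → blk y m = blk x m
  bwd : ∀ {y i A B a r}, IsStep A B a r → blk y (i + 1) = A.erase a → blk y i = insert r B →
    ∃ x, blk x (i + 1) = A ∧ blk x i = B ∧ ∀ m, m ≠ i → m ≠ i + 1 → blk x m = blk y m

namespace Model
variable {X : Type} (M : Model X)

/-- The raising relation. -/
def Step (i : ℕ) (x y : X) : Prop :=
  ∃ a r, IsStep (M.blk x (i + 1)) (M.blk x i) a r ∧
    M.blk y (i + 1) = (M.blk x (i + 1)).erase a ∧ M.blk y i = insert r (M.blk x i) ∧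
    ∀ m, m ≠ i → m ≠ i + 1 → M.blk y m = M.blk x m

/-- Three consecutive blocks. -/
def tr (i : ℕ) (x : X) : Finset ℤ × Finset ℤ × Finset ℤ :=
  (M.blk x (i + 2), M.blk x (i + 1), M.blk x i)

/-- Agreement outside three consecutive blocks. -/
def Agree (i : ℕ) (x y : X) : Prop :=
  ∀ m, m ≠ i → m ≠ i + 1 → m ≠ i + 2 → M.blk x m = M.blk y m

variable {M}

theorem Agree.symm {i : ℕ} {x y : X} (h : M.Agree i x y) : M.Agree i y x :=
  fun m h0 h1 h2 => (h m h0 h1 h2).symm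

theorem Agree.trans {i : ℕ} {x y z : X} (h : M.Agree i x y) (h' : M.Agree i y z) :
    M.Agree i x z := fun m h0 h1 h2 => (h m h0 h1 h2).trans (h' m h0 h1 h2)

theorem Agree.eq {i : ℕ} {x y : X} (h : M.Agree i x y) (ht : M.tr i x = M.tr i y) : x = y := by
  simp only [tr, Prod.mk.injEq] at ht
  refine M.blk_inj (funext fun m => ?_)
  by_cases h0 : m = i
  · rw [h0, ht.2.2]
  by_cases h1 : m = i + 1
  · rw [h1, ht.2.1]
  by_cases h2 : m = i + 2
  · rw [h2, ht.1]
  exact h m h0 h1 h2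

theorem Step.agreeR {i : ℕ} {x y : X} (h : M.Step i x y) : M.Agree i x y := by
  obtain ⟨a, r, -, -, -, h⟩ := h
  exact fun m h0 h1 _ => (h m h0 h1).symm

theorem Step.agreeL {i : ℕ} {x y : X} (h : M.Step (i + 1) x y) : M.Agree i x y := by
  obtain ⟨a, r, -, -, -, h⟩ := h
  exact fun m _ h1 h2 => (h m h1 h2).symm

theorem Step.stepR {i : ℕ} {x y : X} (h : M.Step i x y) : StepR (M.tr i x) (M.tr i y) := by
  obtain ⟨a, r, hs, h1, h2, h3⟩ := h
  exact ⟨a, r, hs, by simp only [tr]; rw [h1, h2, h3 (i + 2) (by omega) (by omega)]⟩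

theorem Step.stepL {i : ℕ} {x y : X} (h : M.Step (i + 1) x y) :
    StepL (M.tr i x) (M.tr i y) := by
  obtain ⟨a, r, hs, h1, h2, h3⟩ := h
  exact ⟨a, r, hs, by
    simp only [tr]; rw [show i + 2 = i + 1 + 1 from rfl, h1, h2, h3 i (by omega) (by omega)]⟩

theorem exists_of_stepR {i : ℕ} {x : X} {t} (h : StepR (M.tr i x) t) :
    ∃ y, M.Step i x y ∧ M.tr i y = t := by
  obtain ⟨a, r, hs, rfl⟩ := h
  obtain ⟨y, h1, h2, h3⟩ := M.fwd hs
  exact ⟨y, ⟨a, r, hs, h1, h2, h3⟩, by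
    simp only [tr]; rw [h1, h2, h3 (i + 2) (by omega) (by omega)]⟩

theorem exists_of_stepL {i : ℕ} {x : X} {t} (h : StepL (M.tr i x) t) :
    ∃ y, M.Step (i + 1) x y ∧ M.tr i y = t := by
  obtain ⟨a, r, hs, rfl⟩ := h
  obtain ⟨y, h1, h2, h3⟩ := M.fwd (i := i + 1) hs
  refine ⟨y, ⟨a, r, hs, h1, h2, h3⟩, ?_⟩
  simp only [tr]; rw [show i + 2 = i + 1 + 1 from rfl, h1, h2, h3 i (by omega) (by omega)]

theorem exists_of_stepR' {i : ℕ} {y : X} {t} (h : StepR t (M.tr i y)) :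
    ∃ x, M.Step i x y ∧ M.tr i x = t := by
  obtain ⟨A, B, C⟩ := t
  obtain ⟨a, r, hs, he⟩ := h
  simp only [tr, Prod.mk.injEq] at he
  obtain ⟨x, h1, h2, h3⟩ := M.bwd hs he.2.1 he.2.2
  simp only at h1 h2
  refine ⟨x, ⟨a, r, by rw [h1, h2]; exact hs, by rw [h1]; exact he.2.1, by rw [h2]; exact he.2.2,
    fun m h4 h5 => (h3 m h4 h5).symm⟩, ?_⟩
  simp only [tr]; rw [h1, h2, h3 (i + 2) (by omega) (by omega), he.1]

theorem exists_of_stepL' {i : ℕ} {y : X} {t} (h : StepL t (M.tr i y)) :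
    ∃ x, M.Step (i + 1) x y ∧ M.tr i x = t := by
  obtain ⟨A, B, C⟩ := t
  obtain ⟨a, r, hs, he⟩ := h
  simp only [tr, Prod.mk.injEq] at he
  obtain ⟨x, h1, h2, h3⟩ := M.bwd (i := i + 1) hs he.1 he.2.1
  simp only at h1 h2
  refine ⟨x, ⟨a, r, by rw [h1, h2]; exact hs, by rw [h1]; exact he.1, by rw [h2]; exact he.2.1,
    fun m h4 h5 => (h3 m h4 h5).symm⟩, ?_⟩
  simp only [tr]
  rw [show i + 2 = i + 1 + 1 from rfl, h1, h2, h3 i (by omega) (by omega), he.2.2]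

variable (M) in
theorem closed3 (i : ℕ) (x0 : X) : Closed3 {t | ∃ x, M.Agree i x x0 ∧ M.tr i x = t} where
  redL := by rintro t ⟨x, -, rfl⟩; exact M.red x (i + 1)
  redR := by rintro t ⟨x, -, rfl⟩; exact M.red x i
  stepL := by
    rintro t ⟨x, hx, rfl⟩ s hs
    obtain ⟨y, hy, rfl⟩ := exists_of_stepL hs
    exact ⟨y, hy.agreeL.symm.trans hx, rfl⟩
  stepR := by
    rintro t ⟨x, hx, rfl⟩ s hs
    obtain ⟨y, hy, rfl⟩ := exists_of_stepR hs
    exact ⟨y, hy.agreeR.symm.trans hx, rfl⟩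
  backL := by
    rintro t ⟨x, hx, rfl⟩ s hs
    obtain ⟨y, hy, rfl⟩ := exists_of_stepL' hs
    exact ⟨y, hy.agreeL.trans hx, rfl⟩
  backR := by
    rintro t ⟨x, hx, rfl⟩ s hs
    obtain ⟨y, hy, rfl⟩ := exists_of_stepR' hs
    exact ⟨y, hy.agreeR.trans hx, rfl⟩

variable (M) in
/-- The number of available raising steps. -/
def eps (i : ℕ) (x : X) : ℕ := hEps (M.blk x (i + 1)) (M.blk x i)

variable (M) in
/-- The number of available lowering steps. -/
def phi (i : ℕ) (x : X) : ℕ := hPhi (M.blk x (i + 1)) (M.blk x i)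

variable (M) in
/-- A statistic decreasing along raising steps. -/
def depth (x : X) : ℕ := ∑ᶠ m, m * (M.blk x m).card

theorem depth_eq {x : X} {N : ℕ} (h : ∀ m ≥ N, M.blk x m = ∅) :
    M.depth x = ∑ m ∈ Finset.range N, m * (M.blk x m).card := by
  refine finsum_eq_sum_of_support_subset _ fun m hm => ?_
  simp only [Finset.coe_range, Set.mem_Iio]
  by_contra hc
  exact hm (by simp [h m (by omega)])

theorem Step.depth_eq {i : ℕ} {x y : X} (h : M.Step i x y) : M.depth x = M.depth y + 1 := by
  obtain ⟨a, r, hs, h1, h2, h3⟩ := h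
  obtain ⟨N, hN⟩ := M.fin x
  obtain ⟨N', hN'⟩ := M.fin y
  set n := N + N' + (i + 2)
  rw [Model.depth_eq (N := n) fun m hm => hN m (by omega),
    Model.depth_eq (N := n) fun m hm => hN' m (by omega)]
  have hi : i ∈ Finset.range n := Finset.mem_range.2 (by omega)
  have hi1 : i + 1 ∈ (Finset.range n).erase i :=
    Finset.mem_erase.2 ⟨by omega, Finset.mem_range.2 (by omega)⟩
  rw [← Finset.add_sum_erase _ _ hi, ← Finset.add_sum_erase _ _ hi1,
    ← Finset.add_sum_erase _ _ hi, ← Finset.add_sum_erase _ _ hi1, h1, h2,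
    Finset.card_insert_of_notMem hs.not_memB]
  have hc := Finset.card_erase_add_one hs.mem_left
  rw [← hc]
  have : ∑ m ∈ ((Finset.range n).erase i).erase (i + 1), m * (M.blk x m).card =
      ∑ m ∈ ((Finset.range n).erase i).erase (i + 1), m * (M.blk y m).card := by
    refine Finset.sum_congr rfl fun m hm => ?_
    simp only [Finset.mem_erase] at hm
    rw [h3 m hm.2.1 hm.1]
  rw [this]; ring

theorem step_det {i : ℕ} {x y z : X} (h : M.Step i x y) (h' : M.Step i x z) : y = z := by
  refine (h.agreeR.symm.trans h'.agreeR).eq ?_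
  obtain ⟨a, r, h1, h2⟩ := h.stepR
  obtain ⟨a', r', h1', h2'⟩ := h'.stepR
  obtain ⟨rfl, rfl⟩ := h1.unique h1'
  rw [h2, h2']

theorem step_inj {i : ℕ} {x y z : X} (h : M.Step i x z) (h' : M.Step i y z) : x = y := by
  refine (h.agreeR.trans h'.agreeR.symm).eq ?_
  obtain ⟨a, r, h1, h2⟩ := h.stepR.neg3
  obtain ⟨a', r', h1', h2'⟩ := h'.stepR.neg3
  obtain ⟨rfl, rfl⟩ := h1.unique h1'
  rw [← neg3_neg3 (M.tr i x), ← neg3_neg3 (M.tr i y), h2, h2']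

theorem step_far_comm {i j : ℕ} {x y z : X} (hy : M.Step i x y) (hz : M.Step j x z)
    (h : Far i j) : ∃ t, M.Step j y t ∧ M.Step i z t := by
  unfold Far at h
  obtain ⟨a, r, hs, h1, h2, h3⟩ := hy
  obtain ⟨b, q, gs, g1, g2, g3⟩ := hz
  have hs' : IsStep (M.blk z (i + 1)) (M.blk z i) a r := by
    rw [g3 _ (by omega) (by omega), g3 _ (by omega) (by omega)]; exact hs
  have gs' : IsStep (M.blk y (j + 1)) (M.blk y j) b q := by
    rw [h3 _ (by omega) (by omega), h3 _ (by omega) (by omega)]; exact gs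
  obtain ⟨t, t1, t2, t3⟩ := M.fwd hs'
  refine ⟨t, ⟨b, q, gs', ?_, ?_, fun m m1 m2 => ?_⟩, a, r, hs', t1, t2, t3⟩
  · rw [t3 _ (by omega) (by omega), g1, h3 _ (by omega) (by omega)]
  · rw [t3 _ (by omega) (by omega), g2, h3 _ (by omega) (by omega)]
  · by_cases m3 : m = i
    · rw [m3, t2, h2, g3 _ (by omega) (by omega)]
    by_cases m4 : m = i + 1
    · rw [m4, t1, h1, g3 _ (by omega) (by omega)]
    rw [t3 m m3 m4, h3 m m3 m4, g3 m m1 m2]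

theorem comm_lift {i : ℕ} {y z : X} (hyz : M.Agree i y z)
    (h : ∃ t, StepR (M.tr i y) t ∧ StepL (M.tr i z) t) :
    ∃ t, M.Step i y t ∧ M.Step (i + 1) z t := by
  obtain ⟨t, h1, h2⟩ := h
  obtain ⟨y', h3, h4⟩ := exists_of_stepR h1
  obtain ⟨z', h5, h6⟩ := exists_of_stepL h2
  rw [(h5.agreeL.symm.trans (hyz.symm.trans h3.agreeR)).eq (h6.trans h4.symm)] at h5
  exact ⟨y', h3, h5⟩

theorem comm_lift' {i : ℕ} {y z : X} (hyz : M.Agree i y z)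
    (h : ∃ t, StepR t (M.tr i y) ∧ StepL t (M.tr i z)) :
    ∃ t, M.Step i t y ∧ M.Step (i + 1) t z := by
  obtain ⟨t, h1, h2⟩ := h
  obtain ⟨y', h3, h4⟩ := exists_of_stepR' h1
  obtain ⟨z', h5, h6⟩ := exists_of_stepL' h2
  rw [(h5.agreeL.trans (hyz.symm.trans h3.agreeR.symm)).eq (h6.trans h4.symm)] at h5
  exact ⟨y', h3, h5⟩

theorem step_deg4 {i : ℕ} {x y z : X} (hy : M.Step (i + 1) x y) (hz : M.Step i x z)
    (h1 : M.eps i y = M.eps i x + 1) (h2 : M.eps (i + 1) z = M.eps (i + 1) x + 1) :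
    ∃ y1 y2 z1 z2 t, M.Step i y y1 ∧ M.Step i y1 y2 ∧ M.Step (i + 1) y2 t ∧
      M.Step (i + 1) z z1 ∧ M.Step (i + 1) z1 z2 ∧ M.Step i z2 t ∧
      M.eps i z2 = M.eps i x ∧ M.eps (i + 1) y2 = M.eps (i + 1) x := by
  obtain ⟨y1, y2, z1, z2, t, a1, a2, a3, b1, b2, b3, c1, c2⟩ :=
    (M.closed3 i x).deg4 ⟨x, fun _ _ _ _ => rfl, rfl⟩ hy.stepL hz.stepR h1 h2
  obtain ⟨y1, ha1, rfl⟩ := exists_of_stepR a1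
  obtain ⟨y2, ha2, rfl⟩ := exists_of_stepR a2
  obtain ⟨z1, hb1, rfl⟩ := exists_of_stepL b1
  obtain ⟨z2, hb2, rfl⟩ := exists_of_stepL b2
  have hag : M.Agree i z2 y2 :=
    (hz.agreeR.trans (hb1.agreeL.trans hb2.agreeL)).symm.trans
      (hy.agreeL.trans (ha1.agreeR.trans ha2.agreeR))
  obtain ⟨t, t1, t2⟩ := comm_lift hag ⟨t, b3, a3⟩
  exact ⟨y1, y2, z1, z2, t, ha1, ha2, t2, hb1, hb2, t1, c1, c2⟩

theorem step_deg4' {i : ℕ} {x y z : X} (hy : M.Step (i + 1) y x) (hz : M.Step i z x)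
    (h1 : M.phi i y = M.phi i x + 1) (h2 : M.phi (i + 1) z = M.phi (i + 1) x + 1) :
    ∃ y1 y2 z1 z2 t, M.Step i y1 y ∧ M.Step i y2 y1 ∧ M.Step (i + 1) t y2 ∧
      M.Step (i + 1) z1 z ∧ M.Step (i + 1) z2 z1 ∧ M.Step i t z2 := by
  obtain ⟨y1, y2, z1, z2, t, a1, a2, a3, b1, b2, b3⟩ :=
    deg4_of_closed3' (M.closed3 i x) ⟨x, fun _ _ _ _ => rfl, rfl⟩ hy.stepL hz.stepR h1 h2
  obtain ⟨y1, ha1, rfl⟩ := exists_of_stepR' a1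
  obtain ⟨y2, ha2, rfl⟩ := exists_of_stepR' a2
  obtain ⟨z1, hb1, rfl⟩ := exists_of_stepL' b1
  obtain ⟨z2, hb2, rfl⟩ := exists_of_stepL' b2
  have hag : M.Agree i z2 y2 :=
    (hb2.agreeL.trans (hb1.agreeL.trans hz.agreeR)).trans
      (ha2.agreeR.trans (ha1.agreeR.trans hy.agreeL)).symm
  obtain ⟨t, t1, t2⟩ := comm_lift' hag ⟨t, b3, a3⟩
  exact ⟨y1, y2, z1, z2, t, ha1, ha2, t2, hb1, hb2, t1⟩

variable (M) in
/-- The crystal attached to a model. -/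
def crys : Crys X where
  step := M.Step
  eps := M.eps
  phi := M.phi
  depth := M.depth
  det := step_det
  inj := step_inj
  exists_step {i x} h := by
    obtain ⟨a, r, hs⟩ := exists_isStep_of_hEps (M.red x i) h
    obtain ⟨y, h1⟩ := M.fwd hs
    exact ⟨y, a, r, hs, h1⟩
  exists_back {i y} h := by
    have h' : 0 < hEps (negF (M.blk y i)) (negF (M.blk y (i + 1))) := by
      rw [hEps_neg]; exact h
    obtain ⟨a, r, hs⟩ := exists_isStep_of_hEps (M.red y i).neg h'
    have hr : StepL (neg3 (M.tr i y))
        ((negF (M.blk y i)).erase a, insert r (negF (M.blk y (i + 1))), negF (M.blk y (i + 2))) :=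
      ⟨a, r, hs, rfl⟩
    rw [← neg3_neg3 (_, _, _)] at hr
    obtain ⟨x, hx, -⟩ := exists_of_stepR' (stepR_of_neg3 hr)
    exact ⟨x, hx⟩
  step_eps := by
    rintro i x y ⟨a, r, hs, h1, h2, -⟩
    have := hs.hEps_after
    unfold eps; rw [h1, h2]; omega
  step_phi := by
    rintro i x y ⟨a, r, hs, h1, h2, -⟩
    have := hs.hPhi_after
    unfold phi; rw [h1, h2]; omega
  step_depth h := h.depth_eq
  far_eps := by
    rintro i j x y ⟨a, r, hs, h1, h2, h3⟩ h
    unfold Far at h; unfold eps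
    rw [h3 _ (by omega) (by omega), h3 _ (by omega) (by omega)]
  far_phi := by
    rintro i j x y ⟨a, r, hs, h1, h2, h3⟩ h
    unfold Far at h; unfold phi
    rw [h3 _ (by omega) (by omega), h3 _ (by omega) (by omega)]
  near_label := by
    rintro i j x y h (rfl | rfl)
    · exact h.stepL.label
    · exact h.stepR.label
  far_comm := step_far_comm
  near_comm := by
    rintro i j x y z hy hz (rfl | rfl) he
    · obtain ⟨h1, h2⟩ := step_commute_of_epsR_eq hy.stepL hz.stepR he
      exact ⟨h1, comm_lift (hy.agreeL.symm.trans hz.agreeR) h2⟩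
    · obtain ⟨h1, h2⟩ := step_commute_of_epsL_eq hz.stepL hy.stepR he
      obtain ⟨t, h3, h4⟩ := comm_lift (hz.agreeL.symm.trans hy.agreeR) h2
      exact ⟨h1, t, h4, h3⟩
  near_deg4 := by
    rintro i j x y z hy hz (rfl | rfl) h1 h2
    · exact step_deg4 hy hz h1 h2
    · obtain ⟨z1, z2, y1, y2, t, a1, a2, a3, b1, b2, b3, c1, c2⟩ := step_deg4 hz hy h2 h1
      exact ⟨y1, y2, z1, z2, t, b1, b2, b3, a1, a2, a3, c2, c1⟩
  near_comm' := by
    rintro i j x y z hy hz (rfl | rfl) he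
    · exact comm_lift' (hy.agreeL.trans hz.agreeR.symm)
        (step_commute_of_phiR_eq hy.stepL hz.stepR he)
    · obtain ⟨t, h3, h4⟩ := comm_lift' (hz.agreeL.trans hy.agreeR.symm)
        (step_commute_of_phiL_eq hz.stepL hy.stepR he)
      exact ⟨t, h4, h3⟩
  near_deg4' := by
    rintro i j x y z hy hz (rfl | rfl) h1 h2
    · exact step_deg4' hy hz h1 h2
    · obtain ⟨z1, z2, y1, y2, t, a1, a2, a3, b1, b2, b3⟩ := step_deg4' hz hy h2 h1
      exact ⟨y1, y2, z1, z2, t, b1, b2, b3, a1, a2, a3⟩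

end Model

/-! ### Full raising operators -/

namespace Crys
variable {X : Type} (K : Crys X)

theorem exists_top (i : ℕ) (x : X) : ∃ y, Relation.ReflTransGen (K.step i) x y ∧ K.eps i y = 0 := by
  induction hn : K.eps i x using Nat.strong_induction_on generalizing x with
  | _ n ih =>
    rcases Nat.eq_zero_or_pos (K.eps i x) with h | h
    · exact ⟨x, .refl, h⟩
    · obtain ⟨y, hy⟩ := K.exists_step h
      obtain ⟨z, h1, h2⟩ := ih (K.eps i y) (by have := K.step_eps hy; omega) y rfl
      exact ⟨z, .head hy h1, h2⟩

/-- The end of the raising string of index `i` through `x`. -/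
def up (i : ℕ) (x : X) : X := (K.exists_top i x).choose

/-- Successive full raisings; the head of the word acts first. -/
def ups : List ℕ → X → X
  | [], x => x
  | i :: l, x => ups l (K.up i x)

/-- Steps with labels in `J`. -/
def JReach (J : Set ℕ) : X → X → Prop := Relation.ReflTransGen fun x y => ∃ i ∈ J, K.step i x y

variable {K}

theorem up_spec (i : ℕ) (x : X) : Relation.ReflTransGen (K.step i) x (K.up i x) :=
  (K.exists_top i x).choose_spec.1

@[simp] theorem eps_up (i : ℕ) (x : X) : K.eps i (K.up i x) = 0 :=
  (K.exists_top i x).choose_spec.2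

theorem top_unique {i : ℕ} {x y z : X} (h : Relation.ReflTransGen (K.step i) x y)
    (hy : K.eps i y = 0) (h' : Relation.ReflTransGen (K.step i) x z) (hz : K.eps i z = 0) :
    y = z := by
  induction h using Relation.ReflTransGen.head_induction_on with
  | refl =>
    rcases Relation.ReflTransGen.cases_head h' with h | ⟨c, hc, -⟩
    · exact h
    · have := eps_pos_of_step hc; omega
  | head hs _ ih =>
    rcases Relation.ReflTransGen.cases_head h' with h | ⟨c, hc, h2⟩
    · subst h; have := eps_pos_of_step hs; omega
    · rw [K.det hs hc] at ih; exact ih h2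

theorem up_of_eps {i : ℕ} {x : X} (h : K.eps i x = 0) : K.up i x = x :=
  top_unique (up_spec i x) (eps_up i x) .refl h

theorem up_of_step {i : ℕ} {x y : X} (h : K.step i x y) : K.up i x = K.up i y :=
  top_unique (up_spec i x) (eps_up i x) (.head h (up_spec i y)) (eps_up i y)

/-- Induction along a raising string. -/
theorem up_induction {i : ℕ} {P : X → Prop} (h0 : ∀ x, K.eps i x = 0 → P x)
    (h1 : ∀ x y, K.step i x y → P y → P x) (x : X) : P x := by
  induction hn : K.eps i x using Nat.strong_induction_on generalizing x with
  | _ n ih =>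
    rcases Nat.eq_zero_or_pos (K.eps i x) with h | h
    · exact h0 x h
    · obtain ⟨y, hy⟩ := K.exists_step h
      exact h1 x y hy (ih _ (by have := K.step_eps hy; omega) y rfl)

theorem reach_up (i : ℕ) (x : X) : K.Reach x (K.up i x) :=
  Relation.ReflTransGen.mono (fun _ _ h => ⟨i, h⟩) _ _ (up_spec i x)

theorem jreach_up {J : Set ℕ} {i : ℕ} (hi : i ∈ J) (x : X) : K.JReach J x (K.up i x) :=
  Relation.ReflTransGen.mono (fun _ _ h => ⟨i, hi, h⟩) _ _ (up_spec i x)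

theorem reach_ups (l : List ℕ) (x : X) : K.Reach x (K.ups l x) := by
  induction l generalizing x with
  | nil => exact .refl
  | cons i l ih => exact (reach_up i x).trans (ih _)

theorem ups_append (l l' : List ℕ) (x : X) : K.ups (l ++ l') x = K.ups l' (K.ups l x) := by
  induction l generalizing x with
  | nil => rfl
  | cons i l ih => exact ih _

theorem IsHW.up_eq {u : X} (h : K.IsHW u) (i : ℕ) : K.up i u = u := up_of_eps (h i)

theorem IsHW.ups_eq {u : X} (h : K.IsHW u) (l : List ℕ) : K.ups l u = u := by
  induction l with
  | nil => rfl
  | cons i l ih => rw [ups, h.up_eq, ih]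

theorem phi_up (i : ℕ) (x : X) : K.phi i (K.up i x) = K.phi i x + K.eps i x := by
  induction x using up_induction (K := K) (i := i) with
  | h0 x h => rw [up_of_eps h, h]; rfl
  | h1 x y h ih =>
    rw [up_of_step h, ih]
    have := K.step_eps h; have := K.step_phi h; omega

theorem up_near {i j : ℕ} (h : Near i j) (x : X) : ∃ p q, p + q = K.eps i x ∧
    K.eps j (K.up i x) = K.eps j x + p ∧ K.phi j (K.up i x) + q = K.phi j x := by
  induction x using up_induction (K := K) (i := i) with
  | h0 x h => exact ⟨0, 0, by rw [h], by rw [up_of_eps h]; rfl, by rw [up_of_eps h]; rfl⟩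
  | h1 x y hs ih =>
    obtain ⟨p, q, h1, h2, h3⟩ := ih
    rw [up_of_step hs]
    have := K.step_eps hs
    rcases K.near_label hs h with h4 | h4
    · exact ⟨p, q + 1, by omega, by omega, by omega⟩
    · exact ⟨p + 1, q, by omega, by omega, by omega⟩

theorem eps_up_far {i j : ℕ} (h : Far i j) (x : X) : K.eps j (K.up i x) = K.eps j x := by
  induction x using up_induction (K := K) (i := i) with
  | h0 x h => rw [up_of_eps h]
  | h1 x y hs ih => rw [up_of_step hs, ih, K.far_eps hs h]

theorem eq_of_up_eq {i : ℕ} {x u : X} (h : K.up i x = u) (hu : K.phi i u = 0) : x = u := by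
  have h1 := phi_up i x (K := K)
  rw [h, hu] at h1
  rw [← h, up_of_eps (by omega)]

theorem ups_eq_iff_of_phi {l : List ℕ} {x u : X} (hu : K.IsHW u) (h : ∀ i ∈ l, K.phi i u = 0) :
    K.ups l x = u ↔ x = u := by
  induction l generalizing x with
  | nil => rfl
  | cons i l ih =>
    rw [ups, ih fun j hj => h j (List.mem_cons_of_mem _ hj)]
    exact ⟨fun h1 => eq_of_up_eq h1 (h i List.mem_cons_self), fun h1 => by rw [h1, hu.up_eq]⟩

theorem exists_jjoin {J : Set ℕ} {i j : ℕ} (hi : i ∈ J) (hj : j ∈ J) {x y z : X}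
    (hy : K.step i x y) (hz : K.step j x z) : ∃ t, K.JReach J y t ∧ K.JReach J z t := by
  have I : ∀ {a b}, K.step i a b → K.JReach J a b := fun h => .single ⟨i, hi, h⟩
  have I' : ∀ {a b}, K.step j a b → K.JReach J a b := fun h => .single ⟨j, hj, h⟩
  rcases eq_or_near_or_far i j with rfl | h | h
  · rw [K.det hy hz]; exact ⟨z, .refl, .refl⟩
  · rcases K.near_label hy h with h1 | h1
    · obtain ⟨-, t, h2, h3⟩ := K.near_comm hy hz h h1.1
      exact ⟨t, I' h2, I h3⟩
    · rcases K.near_label hz h.symm with h2 | h2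
      · obtain ⟨-, t, h2, h3⟩ := K.near_comm hz hy h.symm h2.1
        exact ⟨t, I' h3, I h2⟩
      · obtain ⟨y1, y2, z1, z2, t, a1, a2, a3, b1, b2, b3, -⟩ := K.near_deg4 hy hz h h1.1 h2.1
        exact ⟨t, (I' a1).trans ((I' a2).trans (I a3)), (I b1).trans ((I b2).trans (I' b3))⟩
  · obtain ⟨t, h2, h3⟩ := K.far_comm hy hz h
    exact ⟨t, I' h2, I h3⟩

theorem exists_jtop (K : Crys X) (J : Set ℕ) (x : X) :
    ∃ u, (∀ i ∈ J, K.eps i u = 0) ∧ K.JReach J x u := by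
  induction hn : K.depth x using Nat.strong_induction_on generalizing x with
  | _ n ih =>
    by_cases h : ∀ i ∈ J, K.eps i x = 0
    · exact ⟨x, h, .refl⟩
    · push Not at h
      obtain ⟨i, hJ, hi⟩ := h
      obtain ⟨y, hy⟩ := K.exists_step (Nat.pos_of_ne_zero hi)
      obtain ⟨u, hu, hr⟩ := ih (K.depth y) (by have := K.step_depth hy; omega) y rfl
      exact ⟨u, hu, .head ⟨i, hJ, hy⟩ hr⟩

theorem jtop_unique {J : Set ℕ} {x u v : X} (hu : ∀ i ∈ J, K.eps i u = 0)
    (hv : ∀ i ∈ J, K.eps i v = 0) (hxu : K.JReach J x u) (hxv : K.JReach J x v) : u = v := by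
  induction hn : K.depth x using Nat.strong_induction_on generalizing x u v with
  | _ n ih =>
    have key : ∀ {a b : X}, (∀ i ∈ J, K.eps i a = 0) → K.JReach J a b → b = a := by
      intro a b ha hr
      rcases Relation.ReflTransGen.cases_head hr with h1 | ⟨c, ⟨i, hi, hc⟩, -⟩
      · exact h1.symm
      · have := eps_pos_of_step hc
        rw [ha i hi] at this; omega
    rcases Relation.ReflTransGen.cases_head hxu with h | ⟨y, ⟨i, hi, hy⟩, hyu⟩
    · subst h; exact (key hu hxv).symm
    rcases Relation.ReflTransGen.cases_head hxv with h | ⟨z, ⟨j, hj, hz⟩, hzv⟩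
    · subst h; exact key hv hxu
    obtain ⟨t, hyt, hzt⟩ := exists_jjoin hi hj hy hz
    obtain ⟨w, hw, htw⟩ := K.exists_jtop J t
    have h1 := ih (K.depth y) (by have := K.step_depth hy; omega) hu hw hyu (hyt.trans htw) rfl
    have h2 := ih (K.depth z) (by have := K.step_depth hz; omega) hv hw hzv (hzt.trans htw) rfl
    rw [h1, h2]

theorem up_far_comm {i j : ℕ} (h : Far i j) (x : X) :
    K.up i (K.up j x) = K.up j (K.up i x) := by
  have hi : i ∈ ({i, j} : Set ℕ) := by simp
  have hj : j ∈ ({i, j} : Set ℕ) := by simp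
  refine jtop_unique (J := {i, j}) (x := x) ?_ ?_ ((jreach_up hj _).trans (jreach_up hi _))
    ((jreach_up hi _).trans (jreach_up hj _))
  · rintro k (rfl | rfl)
    · exact eps_up _ _
    · rw [eps_up_far h, eps_up]
  · rintro k (rfl | rfl)
    · rw [eps_up_far h.symm, eps_up]
    · exact eps_up _ _

theorem up_idem (i : ℕ) (x : X) : K.up i (K.up i x) = K.up i x := up_of_eps (eps_up i x)

theorem up_braid {i : ℕ} {x : X} (h1 : K.eps (i + 1) (K.up i (K.up (i + 1) (K.up i x))) = 0)
    (h2 : K.eps i (K.up (i + 1) (K.up i (K.up (i + 1) x))) = 0) :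
    K.up i (K.up (i + 1) (K.up i x)) = K.up (i + 1) (K.up i (K.up (i + 1) x)) := by
  have hi : i ∈ ({i, i + 1} : Set ℕ) := by simp
  have hj : i + 1 ∈ ({i, i + 1} : Set ℕ) := by simp
  refine jtop_unique (J := {i, i + 1}) (x := x) ?_ ?_
    ((jreach_up hi _).trans ((jreach_up hj _).trans (jreach_up hi _)))
    ((jreach_up hj _).trans ((jreach_up hi _).trans (jreach_up hj _)))
  · rintro k (rfl | rfl)
    · exact eps_up _ _
    · exact h1
  · rintro k (rfl | rfl)
    · exact h2
    · exact eps_up _ _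

end Crys

/-! ### Transfer of full raisings along isomorphisms of components -/

/-- Highest weight elements of the same weight in two crystals. -/
structure Comp {X X' : Type} (K : Crys X) (K' : Crys X') (u : X) (u' : X') : Prop where
  hw : K.IsHW u
  hw' : K'.IsHW u'
  phi : ∀ i, K.phi i u = K'.phi i u'

namespace Comp
variable {X X' : Type} {K : Crys X} {K' : Crys X'} {u : X} {u' : X'}

theorem symm (c : Comp K K' u u') : Comp K' K u' u := ⟨c.hw', c.hw, fun i => (c.phi i).symm⟩

/-- The isomorphism of components, as a relation. -/
def Rel (_ : Comp K K' u u') (x : X) (x' : X') : Prop := ∃ n, Matched K K' u u' n x x'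

theorem rel_symm (c : Comp K K' u u') {x : X} {x' : X'} (h : c.Rel x x') : c.symm.Rel x' x :=
  ⟨h.choose, h.choose_spec.symm⟩

theorem rel_base (c : Comp K K' u u') : c.Rel u u' := ⟨0, .base⟩

theorem Rel.reach {c : Comp K K' u u'} {x : X} {x' : X'} (h : c.Rel x x') : K.Reach x u :=
  h.choose_spec.reach

theorem Rel.reach' {c : Comp K K' u u'} {x : X} {x' : X'} (h : c.Rel x x') : K'.Reach x' u' :=
  h.choose_spec.symm.reach

theorem exists_rel (c : Comp K K' u u') {x : X} (h : K.Reach x u) : ∃ x', c.Rel x x' := by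
  obtain ⟨n, x', h⟩ := Matched.exists_right c.hw c.hw' c.phi h
  exact ⟨x', n, h⟩

theorem exists_rel' (c : Comp K K' u u') {x' : X'} (h : K'.Reach x' u') : ∃ x, c.Rel x x' := by
  obtain ⟨x, h⟩ := c.symm.exists_rel h
  exact ⟨x, c.symm.rel_symm h⟩

theorem Rel.right_unique {c : Comp K K' u u'} {x : X} {x' x'' : X'} (h : c.Rel x x')
    (h' : c.Rel x x'') : x' = x'' :=
  h.choose_spec.unique c.hw c.hw' c.phi h'.choose_spec

theorem Rel.left_unique {c : Comp K K' u u'} {x y : X} {x' : X'} (h : c.Rel x x')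
    (h' : c.Rel y x') : x = y :=
  (c.rel_symm h).right_unique (c.rel_symm h')

theorem Rel.eps_eq {c : Comp K K' u u'} {x : X} {x' : X'} (h : c.Rel x x') (i : ℕ) :
    K.eps i x = K'.eps i x' :=
  ((Matched.good c.hw c.hw' c.phi _ _ le_rfl _ _ h.choose_spec).1 i).1

theorem Rel.phi_eq {c : Comp K K' u u'} {x : X} {x' : X'} (h : c.Rel x x') (i : ℕ) :
    K.phi i x = K'.phi i x' :=
  ((Matched.good c.hw c.hw' c.phi _ _ le_rfl _ _ h.choose_spec).1 i).2

theorem Rel.step {c : Comp K K' u u'} {x z : X} {x' : X'} (h : c.Rel x x') {i : ℕ}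
    (hs : K.step i x z) : ∃ z', K'.step i x' z' ∧ c.Rel z z' := by
  obtain ⟨m, z', -, h1, h2⟩ :=
    (Matched.good c.hw c.hw' c.phi _ _ le_rfl _ _ h.choose_spec).2 i z hs
  exact ⟨z', h1, m, h2⟩

theorem Rel.up {c : Comp K K' u u'} {x : X} {x' : X'} (h : c.Rel x x') (i : ℕ) :
    c.Rel (K.up i x) (K'.up i x') := by
  induction x using Crys.up_induction (K := K) (i := i) generalizing x' with
  | h0 x hx => rwa [Crys.up_of_eps hx, Crys.up_of_eps (by rw [← h.eps_eq, hx])]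
  | h1 x y hs ih =>
    obtain ⟨z', h1, h2⟩ := h.step hs
    rw [Crys.up_of_step hs, Crys.up_of_step h1]
    exact ih h2

theorem Rel.ups {c : Comp K K' u u'} {x : X} {x' : X'} (h : c.Rel x x') (l : List ℕ) :
    c.Rel (K.ups l x) (K'.ups l x') := by
  induction l generalizing x x' with
  | nil => exact h
  | cons i l ih => exact ih (h.up i)

theorem Rel.ups_eq_iff {c : Comp K K' u u'} {x : X} {x' : X'} (h : c.Rel x x') (l : List ℕ) :
    K.ups l x = u ↔ K'.ups l x' = u' := by
  refine ⟨fun h1 => ?_, fun h1 => ?_⟩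
  · have := h.ups l
    rw [h1] at this
    exact this.right_unique c.rel_base
  · have := h.ups l
    rw [h1] at this
    exact this.left_unique c.rel_base

end Comp

/-! ### The crystal of words -/

/-- Positions (doubled, counted from the end of the list) of the letter `m` in the word `y`. -/
def blkW (y : List ℕ) (m : ℕ) : Finset ℤ :=
  ((Finset.range y.length).filter fun p => y.reverse[p]? = some m).image fun p : ℕ => 2 * (p : ℤ)

theorem mem_blkW {y : List ℕ} {m : ℕ} {x : ℤ} :
    x ∈ blkW y m ↔ ∃ p : ℕ, x = 2 * (p : ℤ) ∧ y.reverse[p]? = some m := by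
  simp only [blkW, Finset.mem_image, Finset.mem_filter, Finset.mem_range]
  constructor
  · rintro ⟨p, ⟨-, h⟩, rfl⟩; exact ⟨p, rfl, h⟩
  · rintro ⟨p, rfl, h⟩
    refine ⟨p, ⟨?_, h⟩, rfl⟩
    by_contra hc
    rw [List.getElem?_eq_none (by simpa using hc)] at h
    simp at h

theorem two_mul_mem_blkW {y : List ℕ} {m p : ℕ} :
    2 * (p : ℤ) ∈ blkW y m ↔ y.reverse[p]? = some m := by
  rw [mem_blkW]
  constructor
  · rintro ⟨q, h, h'⟩
    obtain rfl : p = q := by omega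
    exact h'
  · exact fun h => ⟨p, rfl, h⟩

theorem blkW_exists_set {y : List ℕ} {a b p : ℕ} (hab : a ≠ b) (h : y.reverse[p]? = some a) :
    ∃ y', blkW y' a = (blkW y a).erase (2 * p) ∧ blkW y' b = insert (2 * (p : ℤ)) (blkW y b) ∧
      ∀ m, m ≠ a → m ≠ b → blkW y' m = blkW y m := by
  have hp : p < y.reverse.length := by
    by_contra hc
    rw [List.getElem?_eq_none (by omega)] at h; simp at h
  have key : ∀ q : ℕ, ((y.reverse.set p b).reverse).reverse[q]? =
      if p = q then some b else y.reverse[q]? := by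
    intro q
    rw [List.reverse_reverse, List.getElem?_set]
    split_ifs <;> rfl
  refine ⟨(y.reverse.set p b).reverse, ?_, ?_, fun m h1 h2 => ?_⟩
  · ext x
    simp only [mem_blkW, Finset.mem_erase, key]
    constructor
    · rintro ⟨q, rfl, hq⟩
      split_ifs at hq with hpq
      · simp at hq; omega
      · exact ⟨by omega, q, rfl, hq⟩
    · rintro ⟨h1, q, rfl, hq⟩
      exact ⟨q, rfl, by rwa [if_neg (by rintro rfl; exact h1 rfl)]⟩
  · ext x
    simp only [mem_blkW, Finset.mem_insert, key]
    constructor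
    · rintro ⟨q, rfl, hq⟩
      split_ifs at hq with hpq
      · left; rw [hpq]
      · exact Or.inr ⟨q, rfl, hq⟩
    · rintro (rfl | ⟨q, rfl, hq⟩)
      · exact ⟨p, rfl, by simp⟩
      · exact ⟨q, rfl, by split_ifs with hpq <;> simp_all⟩
  · ext x
    simp only [mem_blkW, key]
    refine exists_congr fun q => and_congr_right fun _ => ?_
    split_ifs with hpq
    · subst hpq; rw [h]; simp [h1.symm, h2.symm]
    · rfl

/-- Words, as a model. -/
def wordModel : Model (List ℕ) where
  blk := blkW
  blk_inj {x y} h := by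
    rw [← List.reverse_inj]
    refine List.ext_getElem? fun p => Option.ext fun m => ?_
    rw [← two_mul_mem_blkW, h, two_mul_mem_blkW]
  fin y := by
    refine ⟨y.sum + 1, fun m hm => Finset.eq_empty_of_forall_notMem fun x hx => ?_⟩
    obtain ⟨p, -, h⟩ := mem_blkW.1 hx
    have := List.le_sum_of_mem (List.mem_reverse.1 (List.mem_of_getElem? h))
    omega
  red y i a r h1 h2 _ _ := by
    obtain ⟨h3, h4⟩ := h2 a le_rfl h1
    obtain ⟨p, rfl, h⟩ := mem_blkW.1 h3
    rw [two_mul_mem_blkW, h] at h4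
    simp at h4
  fwd {y i a r} hs := by
    obtain ⟨p, rfl, h⟩ := mem_blkW.1 hs.mem_left
    have hr : r = 2 * p := by
      by_contra hc
      obtain ⟨q, h1, -⟩ := mem_blkW.1 (hs.memA (2 * p + 1) (by omega) (by have := hs.le; omega))
      omega
    obtain ⟨y', h1, h2, h3⟩ := blkW_exists_set (b := i) (by omega) h
    exact ⟨y', h1, by rw [h2, hr], fun m h4 h5 => h3 m h5 h4⟩
  bwd {y i A B a r} hs hA hB := by
    obtain ⟨p, rfl, h⟩ := mem_blkW.1 (show r ∈ blkW y i by rw [hB]; exact Finset.mem_insert_self _ _)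
    have ha : a = 2 * p := by
      by_contra hc
      have h1 := hs.memB (2 * p - 1) (by have := hs.le; omega) (by omega)
      have h2 : 2 * (p : ℤ) - 1 ∈ blkW y i := by rw [hB]; exact Finset.mem_insert_of_mem h1
      obtain ⟨q, h1, -⟩ := mem_blkW.1 h2
      omega
    obtain ⟨x, h1, h2, h3⟩ := blkW_exists_set (b := i + 1) (by omega) h
    refine ⟨x, ?_, ?_, h3⟩
    · rw [h2, hA, ← ha, Finset.insert_erase hs.mem_left]
    · rw [h1, hB, Finset.erase_insert hs.not_memB]

/-- The crystal of words. -/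
abbrev WC : Crys (List ℕ) := wordModel.crys

/-! ### Appending a letter to a word -/

theorem ht_eq_card {A B : Finset ℤ} {x : ℤ} (hA : ∀ a ∈ A, a ≤ x) (hB : ∀ b ∈ B, b < x) :
    ht A B x = A.card - B.card := by
  unfold ht
  rw [Finset.sum_congr rfl fun a ha => if_pos (hA a ha),
    Finset.sum_congr rfl fun b hb => if_pos (hB b hb)]
  simp

theorem hEps_insert_top {A B : Finset ℤ} {p : ℤ} (hA : ∀ a ∈ A, a < p) (hB : ∀ b ∈ B, b < p) :
    hEps (insert p A) B = if hPhi A B = 0 then hEps A B + 1 else hEps A B := by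
  have hp : p ∉ A := fun h => lt_irrefl _ (hA p h)
  have h0 := hPhi_add A B
  have h1 := ht_eq_card (x := p) (fun a ha => (hA a ha).le) hB
  obtain ⟨y, hy⟩ := exists_ht_eq_hEps (insert p A) B
  have h2 := ht_insert_upper (B := B) hp y
  have h3 := ht_insert_upper (B := B) hp p
  have h4 := ht_le_hEps (insert p A) B p
  have h5 := ht_le_hEps A B y
  have h6 := hEps_insert_upper A B hp
  rw [if_pos le_rfl] at h3
  split_ifs with h
  · omega
  · have h7 : p ≤ y → ht A B y = A.card - B.card := fun hle =>
      ht_eq_card (fun a ha => by have := hA a ha; omega) (fun b hb => by have := hB b hb; omega)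
    split_ifs at h2 with hle
    · have := h7 hle; omega
    · omega

theorem hEps_insert_lower_top {A B : Finset ℤ} {p : ℤ} (hA : ∀ a ∈ A, a < p)
    (hB : ∀ b ∈ B, b < p) : hEps A (insert p B) = hEps A B := by
  have hp : p ∉ B := fun h => lt_irrefl _ (hB p h)
  obtain ⟨y, hy⟩ := exists_ht_eq_hEps A (insert p B)
  obtain ⟨z, hz⟩ := exists_ht_eq_hEps A B
  have h1 := ht_insert_lower (A := A) hp
  have h2 := ht_le_hEps A (insert p B)
  have h3 := ht_le_hEps A B y
  have h4 := h1 y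
  have h5 := h1 z
  have h6 := h1 p
  have h7 := h2 z
  have h8 := h2 p
  rw [if_neg (lt_irrefl _)] at h6
  by_cases hzp : p < z
  · have e1 := ht_eq_card (A := A) (B := B) (x := z) (fun a ha => by have := hA a ha; omega)
      (fun b hb => by have := hB b hb; omega)
    have e2 := ht_eq_card (A := A) (B := B) (x := p) (fun a ha => (hA a ha).le) hB
    split_ifs at h4 <;> omega
  · rw [if_neg hzp] at h5
    split_ifs at h4 <;> omega

theorem blkW_cons (q : ℕ) (y : List ℕ) (m : ℕ) :
    blkW (q :: y) m = if q = m then insert (2 * (y.length : ℤ)) (blkW y m) else blkW y m := by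
  ext x
  have key : ∀ p : ℕ, (q :: y).reverse[p]? = if p < y.length then y.reverse[p]? else
      if p = y.length then some q else none := by
    intro p
    rw [List.reverse_cons, List.getElem?_append]
    simp only [List.length_reverse]
    split_ifs with h1 h2
    · rfl
    · simp [h2]
    · rw [List.getElem?_eq_none]; simp; omega
  have hlt : ∀ p : ℕ, y.reverse[p]? = some m → p < y.length := by
    intro p h
    by_contra hc
    rw [List.getElem?_eq_none (by simpa using hc)] at h; simp at h
  split_ifs with hq
  · rw [Finset.mem_insert, mem_blkW, mem_blkW]
    constructor
    · rintro ⟨p, rfl, hp⟩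
      rw [key] at hp
      split_ifs at hp with h1 h2
      · exact Or.inr ⟨p, rfl, hp⟩
      · left; rw [h2]
    · rintro (rfl | ⟨p, rfl, hp⟩)
      · exact ⟨y.length, rfl, by rw [key]; simp [hq]⟩
      · exact ⟨p, rfl, by rw [key, if_pos (hlt p hp), hp]⟩
  · rw [mem_blkW, mem_blkW]
    refine exists_congr fun p => and_congr_right fun _ => ?_
    rw [key]
    split_ifs with h1 h2
    · rfl
    · simp only [Option.some.injEq, hq, false_iff]; intro h; exact h1 (hlt p h)
    · simp only [false_iff]; intro h; exact h1 (hlt p h)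

theorem lt_of_mem_blkW {y : List ℕ} {m : ℕ} {x : ℤ} (h : x ∈ blkW y m) :
    x < 2 * (y.length : ℤ) := by
  obtain ⟨p, rfl, h'⟩ := mem_blkW.1 h
  by_contra hc
  rw [List.getElem?_eq_none (by simp; omega)] at h'
  simp at h'

namespace WC

theorem eps_def (i : ℕ) (y : List ℕ) : WC.eps i y = hEps (blkW y (i + 1)) (blkW y i) := rfl
theorem phi_def (i : ℕ) (y : List ℕ) : WC.phi i y = hPhi (blkW y (i + 1)) (blkW y i) := rfl

theorem eps_cons (i q : ℕ) (y : List ℕ) :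
    WC.eps i (q :: y) = if q = i + 1 ∧ WC.phi i y = 0 then WC.eps i y + 1 else WC.eps i y := by
  by_cases h1 : q = i + 1
  · subst h1
    have h2 := hEps_insert_top (A := blkW y (i + 1)) (B := blkW y i)
      (fun a => lt_of_mem_blkW) (fun a => lt_of_mem_blkW)
    rw [← phi_def, ← eps_def] at h2
    rw [eps_def, blkW_cons, blkW_cons, if_pos rfl, if_neg (by omega), h2]
    by_cases h3 : WC.phi i y = 0
    · rw [if_pos h3, if_pos ⟨rfl, h3⟩]
    · rw [if_neg h3, if_neg (by tauto)]
  rw [if_neg (by tauto), eps_def, eps_def, blkW_cons, blkW_cons, if_neg h1]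
  by_cases h2 : q = i
  · rw [if_pos h2, hEps_insert_lower_top (fun a => lt_of_mem_blkW) (fun a => lt_of_mem_blkW)]
  · rw [if_neg h2]

theorem phi_cons (i q : ℕ) (y : List ℕ) :
    WC.phi i (q :: y) =
      if q = i then WC.phi i y + 1 else if q = i + 1 then WC.phi i y - 1 else WC.phi i y := by
  have h0 := eps_cons i q y
  have h1 : WC.phi i (q :: y) + (blkW (q :: y) (i + 1)).card =
      WC.eps i (q :: y) + (blkW (q :: y) i).card := hPhi_add _ _
  have h2 : WC.phi i y + (blkW y (i + 1)).card = WC.eps i y + (blkW y i).card := hPhi_add _ _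
  have c : ∀ m, (blkW (q :: y) m).card = (blkW y m).card + if q = m then 1 else 0 := by
    intro m
    rw [blkW_cons]
    split_ifs
    · rw [Finset.card_insert_of_notMem fun h => lt_irrefl _ (lt_of_mem_blkW h)]
    · rfl
  rw [c, c] at h1
  by_cases q1 : q = i
  · rw [if_pos q1]
    rw [if_neg (by omega)] at h0 h1
    rw [if_pos q1] at h1
    omega
  by_cases q2 : q = i + 1
  · rw [if_neg q1, if_pos q2]
    rw [if_neg q1, if_pos q2] at h1
    by_cases q3 : WC.phi i y = 0
    · rw [if_pos ⟨q2, q3⟩] at h0; omega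
    · rw [if_neg (by tauto)] at h0; omega
  · rw [if_neg q1, if_neg q2]
    rw [if_neg q1, if_neg q2] at h1
    rw [if_neg (by tauto)] at h0
    omega

theorem eps_nil (i : ℕ) : WC.eps i [] = 0 := by
  rw [eps_def]
  have h : ∀ m, blkW [] m = ∅ := fun m => by simp [blkW]
  rw [h, h]
  obtain ⟨x, hx⟩ := exists_ht_eq_hEps ∅ ∅
  simp [ht] at hx
  omega

theorem phi_nil (i : ℕ) : WC.phi i [] = 0 := by
  have h1 := hPhi_add (blkW [] (i + 1)) (blkW [] i)
  have h : ∀ m, blkW [] m = ∅ := fun m => by simp [blkW]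
  have h2 := eps_nil i
  rw [eps_def] at h2
  rw [phi_def]
  rw [h, h] at *
  simp at h1
  omega

theorem step_cons_of_phi {i : ℕ} {y : List ℕ} (h : WC.phi i y = 0) :
    WC.step i ((i + 1) :: y) (i :: y) := by
  have h0 : 0 < WC.eps i ((i + 1) :: y) := by rw [eps_cons, if_pos ⟨rfl, h⟩]; omega
  have hA : ∀ a ∈ blkW y (i + 1), a < 2 * (y.length : ℤ) := fun a => lt_of_mem_blkW
  have hB : ∀ a ∈ blkW y i, a < 2 * (y.length : ℤ) := fun a => lt_of_mem_blkW
  have hp : 2 * (y.length : ℤ) ∉ blkW y (i + 1) := fun h => lt_irrefl _ (hA _ h)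
  have hp' : 2 * (y.length : ℤ) ∉ blkW y i := fun h => lt_irrefl _ (hB _ h)
  have e1 : blkW ((i + 1) :: y) (i + 1) = insert (2 * (y.length : ℤ)) (blkW y (i + 1)) := by
    rw [blkW_cons, if_pos rfl]
  have e2 : blkW ((i + 1) :: y) i = blkW y i := by rw [blkW_cons, if_neg (by omega)]
  have e3 : blkW (i :: y) i = insert (2 * (y.length : ℤ)) (blkW y i) := by
    rw [blkW_cons, if_pos rfl]
  have e4 : blkW (i :: y) (i + 1) = blkW y (i + 1) := by rw [blkW_cons, if_neg (by omega)]
  have k1 := ht_eq_card (x := 2 * (y.length : ℤ)) (fun a ha => (hA a ha).le) hB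
  have k2 := hPhi_add (blkW y (i + 1)) (blkW y i)
  rw [phi_def] at h
  have k3 := ht_insert_upper (B := blkW y i) hp
  have k4 := ht_le_hEps (blkW y (i + 1)) (blkW y i)
  have k5 := k3 (2 * (y.length : ℤ))
  rw [if_pos le_rfl] at k5
  refine ⟨2 * y.length, 2 * y.length, ?_, ?_, ?_, ?_⟩
  · change IsStep (blkW _ _) (blkW _ _) _ _
    rw [e1, e2]
    refine ⟨le_rfl, fun x h1 h2 => ?_, fun x h1 h2 => by omega, hp', ?_, by omega, ?_, ?_⟩
    · rw [show x = 2 * (y.length : ℤ) by omega]; exact Finset.mem_insert_self _ _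
    · rw [Finset.mem_insert]
      rintro (h1 | h1)
      · omega
      · have := hA _ h1; omega
    · intro x hx
      have h1 := k3 x
      have h2 := k4 x
      rw [if_neg (by omega)] at h1
      omega
    · intro x
      have h1 := k3 x
      have h2 := k4 x
      split_ifs at h1 <;> omega
  · change blkW _ _ = (blkW _ _).erase _
    rw [e4, e1, Finset.erase_insert hp]
  · change blkW _ _ = insert _ (blkW _ _)
    rw [e3, e2]
  · intro m h1 h2
    change blkW _ _ = blkW _ _
    rw [blkW_cons, blkW_cons, if_neg (by omega), if_neg (by omega)]

theorem length_of_step {i : ℕ} {y y' : List ℕ} (h : WC.step i y y') : y.length = y'.length := by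
  obtain ⟨a, r, hs, h1, h2, h3⟩ := h
  change blkW _ _ = (blkW _ _).erase _ at h1
  change blkW _ _ = insert _ (blkW _ _) at h2
  change ∀ m, m ≠ i → m ≠ i + 1 → blkW _ _ = blkW _ _ at h3
  have hs' : IsStep (blkW y (i + 1)) (blkW y i) a r := hs
  have har : a = r := by
    obtain ⟨p, rfl, h⟩ := mem_blkW.1 hs'.mem_left
    by_contra hc
    obtain ⟨q, h1, -⟩ := mem_blkW.1 (hs'.memA (2 * p + 1) (by omega) (by have := hs'.le; omega))
    omega
  subst har
  have key : ∀ x, (∃ m, x ∈ blkW y m) ↔ ∃ m, x ∈ blkW y' m := by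
    intro x
    constructor
    · rintro ⟨m, hm⟩
      by_cases m1 : m = i
      · subst m1; exact ⟨m, by rw [h2]; exact Finset.mem_insert_of_mem hm⟩
      by_cases m2 : m = i + 1
      · subst m2
        by_cases hxa : x = a
        · exact ⟨i, by rw [h2, hxa]; exact Finset.mem_insert_self _ _⟩
        · exact ⟨i + 1, by rw [h1]; exact Finset.mem_erase.2 ⟨hxa, hm⟩⟩
      · exact ⟨m, by rw [h3 m m1 m2]; exact hm⟩
    · rintro ⟨m, hm⟩
      by_cases m1 : m = i
      · subst m1
        rw [h2, Finset.mem_insert] at hm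
        rcases hm with rfl | hm
        · exact ⟨m + 1, hs'.mem_left⟩
        · exact ⟨m, hm⟩
      by_cases m2 : m = i + 1
      · subst m2
        rw [h1] at hm
        exact ⟨i + 1, Finset.mem_of_mem_erase hm⟩
      · exact ⟨m, by rw [← h3 m m1 m2]; exact hm⟩
  have char : ∀ (z : List ℕ) (p : ℕ), (∃ m, 2 * (p : ℤ) ∈ blkW z m) ↔ p < z.length := by
    intro z p
    constructor
    · rintro ⟨m, hm⟩; have := lt_of_mem_blkW hm; omega
    · intro hp
      refine ⟨z.reverse[p]'(by simpa using hp), ?_⟩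
      rw [two_mul_mem_blkW]
      exact List.getElem?_eq_getElem _
  have h4 := fun p : ℕ => (char y p).symm.trans ((key _).trans (char y' p))
  have h5 := h4 y.length
  have h6 := h4 y'.length
  omega

theorem step_cons_of_step {i q : ℕ} {y y' : List ℕ} (h : WC.step i y y')
    (hq : q = i + 1 → 0 < WC.phi i y) : WC.step i (q :: y) (q :: y') := by
  have hlen := length_of_step h
  obtain ⟨a, r, hs, h1, h2, h3⟩ := h
  change blkW _ _ = (blkW _ _).erase _ at h1
  change blkW _ _ = insert _ (blkW _ _) at h2
  change ∀ m, m ≠ i → m ≠ i + 1 → blkW _ _ = blkW _ _ at h3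
  have hs' : IsStep (blkW y (i + 1)) (blkW y i) a r := hs
  have hA : ∀ a ∈ blkW y (i + 1), a < 2 * (y.length : ℤ) := fun a => lt_of_mem_blkW
  have hB : ∀ a ∈ blkW y i, a < 2 * (y.length : ℤ) := fun a => lt_of_mem_blkW
  have hp : 2 * (y.length : ℤ) ∉ blkW y (i + 1) := fun h => lt_irrefl _ (hA _ h)
  have hp' : 2 * (y.length : ℤ) ∉ blkW y i := fun h => lt_irrefl _ (hB _ h)
  have har : a = r := by
    obtain ⟨p, rfl, h⟩ := mem_blkW.1 hs'.mem_left
    by_contra hc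
    obtain ⟨q, h1, -⟩ := mem_blkW.1 (hs'.memA (2 * p + 1) (by omega) (by have := hs'.le; omega))
    omega
  subst har
  have ha := hA a hs'.mem_left
  have hodd : a + 1 < 2 * (y.length : ℤ) := by
    obtain ⟨p, rfl, h⟩ := mem_blkW.1 hs'.mem_left
    omega
  have hK := hs'.ht_eq
  refine ⟨a, a, ?_, ?_, ?_, ?_⟩
  · change IsStep (blkW _ _) (blkW _ _) _ _
    rw [blkW_cons, blkW_cons]
    by_cases q1 : q = i + 1
    · rw [if_pos q1, if_neg (by omega)]
      have k3 := ht_insert_upper (B := blkW y i) hp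
      have ka := k3 a
      rw [if_neg (by omega)] at ka
      have hph := hq q1
      rw [phi_def] at hph
      have k2 := hPhi_add (blkW y (i + 1)) (blkW y i)
      refine ⟨le_rfl, fun x h4 h5 => Finset.mem_insert_of_mem (hs'.memA x h4 h5),
        fun x h4 h5 => by omega, hs'.not_memB, ?_, ?_, fun x hx => ?_, fun x => ?_⟩
      · rw [Finset.mem_insert]
        rintro (h4 | h4)
        · omega
        · exact hs'.succ_not_memA h4
      · have := hs'.pos; omega
      · have := hs'.lt x hx; have := k3 x; rw [if_neg (by omega)] at this; omega
      · have h4 := hs'.max x; have h5 := k3 x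
        split_ifs at h5 with hle
        · have := ht_eq_card (A := blkW y (i + 1)) (B := blkW y i) (x := x)
            (fun a ha => by have := hA a ha; omega) (fun b hb => by have := hB b hb; omega)
          omega
        · omega
    by_cases q2 : q = i
    · rw [if_neg q1, if_pos q2]
      have k3 := ht_insert_lower (A := blkW y (i + 1)) hp'
      have ka := k3 a
      rw [if_neg (by omega)] at ka
      refine ⟨le_rfl, hs'.memA, fun x h4 h5 => by omega, ?_, hs'.succ_not_memA, ?_,
        fun x hx => ?_, fun x => ?_⟩
      · rw [Finset.mem_insert]
        rintro (h4 | h4)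
        · omega
        · exact hs'.not_memB h4
      · have := hs'.pos; omega
      · have := hs'.lt x hx; have := k3 x; rw [if_neg (by omega)] at this; omega
      · have h4 := hs'.max x; have h5 := k3 x
        split_ifs at h5 <;> omega
    · rw [if_neg q1, if_neg q2]; exact hs'
  · change blkW _ _ = (blkW _ _).erase _
    rw [blkW_cons, blkW_cons, h1, hlen]
    split_ifs
    · rw [Finset.erase_insert_of_ne (by omega)]
    · rfl
  · change blkW _ _ = insert _ (blkW _ _)
    rw [blkW_cons, blkW_cons, h2, hlen]
    split_ifs
    · rw [Finset.insert_comm]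
    · rfl
  · intro m h4 h5
    change blkW _ _ = blkW _ _
    rw [blkW_cons, blkW_cons, h3 m h4 h5, hlen]

theorem step_cons_inv {i q : ℕ} {y x : List ℕ} (h : WC.step i (q :: y) x) :
    (q = i + 1 ∧ WC.phi i y = 0 ∧ x = i :: y) ∨
      ∃ y', WC.step i y y' ∧ x = q :: y' ∧ (q = i + 1 → 0 < WC.phi i y) := by
  by_cases hc : q = i + 1 ∧ WC.phi i y = 0
  · obtain ⟨rfl, h0⟩ := hc
    exact Or.inl ⟨rfl, h0, WC.det h (step_cons_of_phi h0)⟩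
  · right
    have h1 := Crys.eps_pos_of_step h
    rw [eps_cons, if_neg hc] at h1
    obtain ⟨y', hy'⟩ := WC.exists_step h1
    have h2 : q = i + 1 → 0 < WC.phi i y := fun h2 =>
      Nat.pos_of_ne_zero fun h3 => hc ⟨h2, h3⟩
    exact ⟨y', hy', WC.det h (step_cons_of_step hy' h2), h2⟩

theorem up_cons (i q : ℕ) (y : List ℕ) :
    WC.up i (q :: y) = (if q = i + 1 ∧ WC.phi i y = 0 then i else q) :: WC.up i y := by
  have gen : ∀ (p : ℕ) (y : List ℕ), (p = i + 1 → 0 < WC.phi i y) →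
      WC.up i (p :: y) = p :: WC.up i y := by
    intro p y
    induction y using Crys.up_induction (K := WC) (i := i) with
    | h0 y hy =>
      intro hp
      rw [Crys.up_of_eps hy, Crys.up_of_eps]
      rw [eps_cons, if_neg, hy]
      rintro ⟨h1, h2⟩
      have := hp h1; omega
    | h1 y y' hs ih =>
      intro hp
      rw [Crys.up_of_step (step_cons_of_step hs hp), Crys.up_of_step hs, ih]
      intro h1; rw [WC.step_phi hs]; omega
  split_ifs with h
  · obtain ⟨rfl, h0⟩ := h
    rw [Crys.up_of_step (step_cons_of_phi h0), gen _ _ (by omega)]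
  · exact gen q y fun h1 => Nat.pos_of_ne_zero fun h2 => h ⟨h1, h2⟩

theorem up_nil (i : ℕ) : WC.up i [] = [] := Crys.up_of_eps (eps_nil i)

theorem eps_up_up_up (i : ℕ) (x : List ℕ) :
    WC.eps (i + 1) (WC.up i (WC.up (i + 1) (WC.up i x))) = 0 ∧
      WC.eps i (WC.up (i + 1) (WC.up i (WC.up (i + 1) x))) = 0 := by
  induction x with
  | nil => simp only [up_nil, eps_nil, and_self]
  | cons q y ih =>
    have n1 : Near i (i + 1) := Or.inr rfl
    have n2 : Near (i + 1) i := Or.inl rfl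
    constructor
    · rw [up_cons, up_cons, up_cons, eps_cons, if_neg, ih.1]
      rintro ⟨h1, h2⟩
      obtain ⟨a, b, h3, h4, h5⟩ := Crys.up_near (K := WC) n1 (WC.up (i + 1) (WC.up i y))
      obtain ⟨a', b', h6, h7, h8⟩ := Crys.up_near (K := WC) n2 (WC.up i y)
      have h9 := Crys.phi_up (K := WC) (i + 1) (WC.up i y)
      rw [ih.1, Crys.eps_up] at h4
      rw [Crys.eps_up] at h7
      split_ifs at h1 <;> omega
    · rw [up_cons, up_cons, up_cons, eps_cons, if_neg, ih.2]
      rintro ⟨h1, h2⟩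
      obtain ⟨a, b, h3, h4, h5⟩ := Crys.up_near (K := WC) n2 (WC.up i (WC.up (i + 1) y))
      obtain ⟨a', b', h6, h7, h8⟩ := Crys.up_near (K := WC) n1 (WC.up (i + 1) y)
      have h9 := Crys.phi_up (K := WC) i (WC.up (i + 1) y)
      have h10 := Crys.phi_up (K := WC) (i + 1) y
      rw [ih.2, Crys.eps_up] at h4
      rw [Crys.eps_up] at h7
      split_ifs at h1 <;> omega

theorem braid (i : ℕ) (x : List ℕ) :
    WC.up i (WC.up (i + 1) (WC.up i x)) = WC.up (i + 1) (WC.up i (WC.up (i + 1) x)) :=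
  Crys.up_braid (eps_up_up_up i x).1 (eps_up_up_up i x).2

end WC

/-! ### Descending runs and Hecke normal forms -/

/-- The descending run `[p + n - 1, …, p]`. -/
def dn (p : ℕ) : ℕ → List ℕ
  | 0 => []
  | n + 1 => (p + n) :: dn p n

theorem dn_add (p m n : ℕ) : dn p (m + n) = dn (p + m) n ++ dn p m := by
  induction n with
  | zero => rfl
  | succ n ih => rw [← add_assoc, dn, ih, dn, List.cons_append, add_assoc]

theorem mem_dn {p n i : ℕ} : i ∈ dn p n ↔ p ≤ i ∧ i < p + n := by
  induction n with
  | zero => simp [dn]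
  | succ n ih => rw [dn, List.mem_cons, ih]; omega

theorem dn_succ' (p n : ℕ) : dn p (n + 1) = dn (p + 1) n ++ [p] := by
  rw [add_comm, dn_add]; rfl

/-- Normal forms for words in the letters `0, …, n - 1`. -/
inductive NF : ℕ → List ℕ → Prop
  | nil : NF 0 []
  | snoc {j a : ℕ} {l : List ℕ} : NF j l → a ≤ j + 1 → NF (j + 1) (l ++ dn a (j + 1 - a))

theorem NF.succ {j : ℕ} {l : List ℕ} (h : NF j l) : NF (j + 1) l := by
  have := NF.snoc h (le_refl (j + 1))
  rwa [Nat.sub_self, dn, List.append_nil] at this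

theorem NF.mono {j k : ℕ} {l : List ℕ} (h : NF j l) (hk : j ≤ k) : NF k l := by
  induction hk with
  | refl => exact h
  | step _ ih => exact ih.succ

theorem NF.lt {j : ℕ} {l : List ℕ} (h : NF j l) : ∀ i ∈ l, i < j := by
  induction h with
  | nil => simp
  | @snoc j a l h ha ih =>
    intro i hi
    rw [List.mem_append, mem_dn] at hi
    rcases hi with hi | hi
    · have := ih i hi; omega
    · omega

namespace WC

/-- Two words inducing the same composite of maximal raising operators. -/
def Eqv (l l' : List ℕ) : Prop := ∀ x, WC.ups l x = WC.ups l' x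

theorem Eqv.append {l l' m m' : List ℕ} (h : Eqv l l') (h' : Eqv m m') :
    Eqv (l ++ m) (l' ++ m') := fun x => by
  rw [Crys.ups_append, Crys.ups_append, h, h']

theorem Eqv.refl (l : List ℕ) : Eqv l l := fun _ => rfl
theorem Eqv.trans {l l' l'' : List ℕ} (h : Eqv l l') (h' : Eqv l' l'') : Eqv l l'' :=
  fun x => (h x).trans (h' x)

theorem eqv_far {i : ℕ} {l : List ℕ} (h : ∀ j ∈ l, Far i j) : Eqv (i :: l) (l ++ [i]) := by
  induction l with
  | nil => exact Eqv.refl _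
  | cons j l ih =>
    have h1 := ih fun k hk => h k (List.mem_cons_of_mem _ hk)
    intro x
    have h2 := h1 (WC.up j x)
    change WC.ups l (WC.up j (WC.up i x)) = WC.ups (l ++ [i]) (WC.up j x)
    rw [Crys.up_far_comm (h j List.mem_cons_self).symm x, ← h2]
    rfl

theorem eqv_snoc_dn {a n i : ℕ} (h1 : a < i) (h2 : i < a + n) :
    Eqv (dn a n ++ [i]) ((i - 1) :: dn a n) := by
  obtain ⟨k, rfl⟩ : ∃ k, i = a + 1 + k := ⟨i - a - 1, by omega⟩
  obtain ⟨m, rfl⟩ : ∃ m, n = (k + 2) + m := ⟨n - k - 2, by omega⟩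
  have e : dn a ((k + 2) + m) = dn (a + (k + 2)) m ++ ([a + k + 1, a + k] ++ dn a k) := by
    rw [dn_add, dn, dn]; rfl
  have c1 : Eqv (dn a k ++ [a + 1 + k]) ([a + k + 1] ++ dn a k) := by
    intro x
    rw [show a + 1 + k = a + k + 1 by omega]
    refine (eqv_far (fun j hj => ?_) x).symm
    rw [mem_dn] at hj; right; omega
  have c2 : Eqv ([a + k + 1, a + k] ++ [a + k + 1]) ([a + k] ++ [a + k + 1, a + k]) := fun x =>
    (WC.braid (a + k) x).symm
  have c3 : Eqv (dn (a + (k + 2)) m ++ [a + k]) ([a + k] ++ dn (a + (k + 2)) m) := by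
    intro x
    refine (eqv_far (fun j hj => ?_) x).symm
    rw [mem_dn] at hj; left; omega
  rw [e, show a + 1 + k - 1 = a + k by omega]
  have s1 := (Eqv.refl (dn (a + (k + 2)) m)).append
    ((Eqv.refl [a + k + 1, a + k]).append c1)
  have s2 := (Eqv.refl (dn (a + (k + 2)) m)).append (c2.append (Eqv.refl (dn a k)))
  have s3 := c3.append (Eqv.refl ([a + k + 1, a + k] ++ dn a k))
  simp only [List.append_assoc, List.cons_append, List.nil_append] at s1 s2 s3 ⊢
  exact (s1.trans s2).trans s3

theorem exists_nf_snoc {n : ℕ} {l : List ℕ} (h : NF n l) :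
    ∀ {i : ℕ}, i < n → ∃ l', NF n l' ∧ Eqv (l ++ [i]) l' := by
  induction h with
  | nil => intro i hi; omega
  | @snoc j a l h ha ih =>
    intro i hi
    rcases lt_trichotomy i a with h1 | rfl | h1
    · by_cases h2 : i + 1 = a
      · refine ⟨l ++ dn i (j + 1 - i), .snoc h (by omega), ?_⟩
        rw [show j + 1 - i = (j + 1 - a) + 1 by omega, dn_succ', h2, List.append_assoc]
        exact Eqv.refl _
      · obtain ⟨l', h3, h4⟩ := ih (i := i) (by omega)
        refine ⟨l' ++ dn a (j + 1 - a), .snoc h3 ha, ?_⟩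
        have h5 : Eqv (i :: dn a (j + 1 - a)) (dn a (j + 1 - a) ++ [i]) := by
          refine eqv_far fun k hk => ?_
          rw [mem_dn] at hk; left; omega
        intro x
        have h6 := h4.append (Eqv.refl (dn a (j + 1 - a))) x
        have h7 := (Eqv.refl l).append h5 x
        simp only [List.append_assoc, List.cons_append, List.nil_append] at h6 h7 ⊢
        rw [← h7, h6]
    · refine ⟨l ++ dn i (j + 1 - i), .snoc h ha, fun x => ?_⟩
      rw [show j + 1 - i = (j - i) + 1 by omega, dn_succ']
      simp only [Crys.ups_append]
      exact Crys.up_idem _ _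
    · obtain ⟨l', h3, h4⟩ := ih (i := i - 1) (by omega)
      refine ⟨l' ++ dn a (j + 1 - a), .snoc h3 ha, fun x => ?_⟩
      have h6 := h4.append (Eqv.refl (dn a (j + 1 - a))) x
      have h7 := (Eqv.refl l).append (eqv_snoc_dn (n := j + 1 - a) h1 (by omega)) x
      simp only [List.append_assoc, List.cons_append, List.nil_append] at h6 h7 ⊢
      rw [h7, h6]

theorem NF.id (n : ℕ) : NF n [] := NF.nil.mono (Nat.zero_le n)

theorem exists_nf {n : ℕ} (l : List ℕ) (hl : ∀ i ∈ l, i < n) : ∃ l', NF n l' ∧ Eqv l l' := by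
  induction l using List.reverseRecOn with
  | nil => exact ⟨[], NF.id n, Eqv.refl _⟩
  | append_singleton l i ih =>
    obtain ⟨l1, h1, h2⟩ := ih fun k hk => hl k (by simp [hk])
    obtain ⟨l2, h3, h4⟩ := exists_nf_snoc h1 (hl i (by simp))
    exact ⟨l2, h3, (h2.append (Eqv.refl [i])).trans h4⟩

/-! ### Regions of words with bounded letters -/

/-- Words obtained from `z0` by adding letters bounded by `cs`. -/
def Region (z0 : List ℕ) : List ℕ → List ℕ → Prop
  | [], b => b = z0
  | c :: cs, b => ∃ q b', b = q :: b' ∧ q ≤ c ∧ Region z0 cs b'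

theorem region_cons {z0 cs b : List ℕ} {c q : ℕ} :
    Region z0 (c :: cs) (q :: b) ↔ q ≤ c ∧ Region z0 cs b := by
  constructor
  · rintro ⟨q', b', h, h1⟩
    obtain ⟨rfl, rfl⟩ := List.cons.inj h
    exact h1
  · intro h; exact ⟨q, b, rfl, h⟩

/-- `l` cuts out the region given by `cs` in the component of `z`. -/
def Cuts (z0 cs l z : List ℕ) : Prop :=
  ∀ b, WC.Reach b z → (Region z0 cs b ↔ WC.ups l b = z)

theorem isHW_tail {q : ℕ} {y : List ℕ} (h : WC.IsHW (q :: y)) : WC.IsHW y := fun i => by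
  have := h i
  rw [eps_cons] at this
  split_ifs at this
  exact this

theorem reach_cons {b z : List ℕ} {p : ℕ} (h : WC.Reach b (p :: z)) :
    ∃ q b', b = q :: b' ∧ WC.Reach b' z := by
  induction h using Relation.ReflTransGen.head_induction_on with
  | refl => exact ⟨p, z, rfl, .refl⟩
  | head hs _ ih =>
    obtain ⟨i, hs⟩ := hs
    obtain ⟨q, b', rfl, hr⟩ := ih
    rename_i b _
    cases b with
    | nil => exact absurd (length_of_step hs) (by simp)
    | cons q' b =>
      refine ⟨q', b, rfl, ?_⟩
      rcases step_cons_inv hs with ⟨-, -, h⟩ | ⟨y', h1, h, -⟩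
      · rw [(List.cons.inj h).2] at hr; exact hr
      · rw [(List.cons.inj h).2] at hr; exact Crys.Reach.of_step h1 hr

theorem ups_cons (l : List ℕ) (q : ℕ) (y : List ℕ) :
    ∃ q', WC.ups l (q :: y) = q' :: WC.ups l y ∧ q' ≤ q ∧
      ∀ c, (∀ i ∈ l, i + 1 ≤ c) → c < q → q' = q := by
  induction l generalizing q y with
  | nil => exact ⟨q, rfl, le_rfl, fun _ _ _ => rfl⟩
  | cons i l ih =>
    obtain ⟨q', h1, h2, h3⟩ := ih (if q = i + 1 ∧ WC.phi i y = 0 then i else q) (WC.up i y)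
    refine ⟨q', ?_, ?_, ?_⟩
    · change WC.ups l (WC.up i (q :: y)) = q' :: WC.ups l (WC.up i y)
      rw [up_cons, h1]
    · split_ifs at h2 <;> omega
    · intro c hc hq
      have h4 := hc i List.mem_cons_self
      have h5 := h3 c fun k hk => hc k (List.mem_cons_of_mem _ hk)
      rw [if_neg (by omega)] at h5
      exact h5 hq

theorem ups_dn_eq {u : List ℕ} (hu : WC.IsHW u) {p : ℕ} {n : ℕ} :
    ∀ {q : ℕ}, (∀ i, p ≤ i → i < p + n → WC.phi i u = 0) → p ≤ q →
      (WC.ups (dn p n) (q :: u) = p :: u ↔ q ≤ p + n) := by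
  induction n with
  | zero =>
    intro q _ hq
    change q :: u = p :: u ↔ _
    simp; omega
  | succ n ih =>
    intro q h hq
    change WC.ups (dn p n) (WC.up (p + n) (q :: u)) = p :: u ↔ _
    rw [up_cons, hu.up_eq, ih (fun i h1 h2 => h i h1 (by omega))]
    · have := h (p + n) (by omega) (by omega)
      split_ifs with h1
      · omega
      · have : q ≠ p + n + 1 := fun h2 => h1 ⟨h2, this⟩
        omega
    · split_ifs <;> omega

theorem reach_cons_hw {u : List ℕ} (hu : WC.IsHW u) {p q : ℕ} (h : WC.Reach (q :: u) (p :: u)) :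
    p ≤ q ∧ ∀ i, p ≤ i → i < q → WC.phi i u = 0 := by
  generalize hb : q :: u = b at h
  induction h using Relation.ReflTransGen.head_induction_on generalizing q with
  | refl => obtain ⟨rfl, -⟩ := List.cons.inj hb; exact ⟨le_rfl, fun i h1 h2 => by omega⟩
  | head hs _ ih =>
    obtain ⟨i, hs⟩ := hs
    subst hb
    rcases step_cons_inv hs with ⟨rfl, h1, rfl⟩ | ⟨y', h1, -⟩
    · obtain ⟨h2, h3⟩ := ih rfl
      refine ⟨by omega, fun k h4 h5 => ?_⟩
      by_cases h6 : k = i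
      · rw [h6, h1]
      · exact h3 k h4 (by omega)
    · exact absurd h1 hu.not_step

theorem Cuts.cons {z0 cs L u : List ℕ} {c p P : ℕ} (h : Cuts z0 cs L u)
    (hL : ∀ i ∈ L, i + 1 ≤ c) (hu : WC.IsHW (p :: u)) (hpP : p ≤ P) (hPc : P ≤ c)
    (h0 : ∀ i, p ≤ i → i < P → WC.phi i u = 0) (hP : P = c ∨ WC.phi P u ≠ 0) :
    Cuts z0 (c :: cs) (L ++ dn p (P - p)) (p :: u) := by
  have hu' := isHW_tail hu
  intro b hb
  obtain ⟨q, b', rfl, hb'⟩ := reach_cons hb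
  obtain ⟨q', h1, h2, h3⟩ := ups_cons L q b'
  have hdn : ∀ i, p ≤ i → i < p + (P - p) → WC.phi i u = 0 := fun i h4 h5 =>
    h0 i h4 (by omega)
  rw [region_cons, h b' hb', Crys.ups_append, h1]
  constructor
  · rintro ⟨h4, h5⟩
    rw [h5] at h1 ⊢
    have hr := Crys.reach_of_reach hu hb (Crys.reach_ups (K := WC) L (q :: b'))
    rw [h1] at hr
    obtain ⟨h6, h7⟩ := reach_cons_hw hu' hr
    rw [ups_dn_eq hu' hdn h6]
    by_contra h8
    rcases hP with hP | hP
    · omega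
    · exact hP (h7 P hpP (by omega))
  · intro h4
    obtain ⟨q'', h5, h6, h7⟩ := ups_cons (dn p (P - p)) q' (WC.ups L b')
    rw [h5] at h4
    obtain ⟨rfl, h8⟩ := List.cons.inj h4
    rw [Crys.ups_eq_iff_of_phi hu' (fun i hi => h0 i (mem_dn.1 hi).1 (by
      have := (mem_dn.1 hi).2; omega))] at h8
    refine ⟨?_, h8⟩
    rw [h8] at h5
    have h9 : q' ≤ P := by
      have := (ups_dn_eq hu' hdn h6 (q := q')).1 (by
        rw [h5, hu'.ups_eq])
      omega
    by_contra h10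
    have := h3 c hL (by omega)
    omega

theorem exists_bound (c p : ℕ) (hp : p ≤ c) (u : List ℕ) :
    ∃ P, p ≤ P ∧ P ≤ c ∧ (∀ i, p ≤ i → i < P → WC.phi i u = 0) ∧ (P = c ∨ WC.phi P u ≠ 0) := by
  obtain ⟨n, rfl⟩ := Nat.exists_eq_add_of_le hp
  induction n generalizing p with
  | zero => exact ⟨p, le_rfl, by omega, fun i h1 h2 => by omega, Or.inl (by omega)⟩
  | succ n ih =>
    by_cases h : WC.phi p u = 0
    · obtain ⟨P, h1, h2, h3, h4⟩ := ih (p + 1) (by omega)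
      refine ⟨P, by omega, by omega, fun i h5 h6 => ?_, h4.imp (by omega) id⟩
      by_cases h7 : i = p
      · rw [h7, h]
      · exact h3 i (by omega) h6
    · exact ⟨p, le_rfl, by omega, fun i h1 h2 => by omega, Or.inr h⟩

theorem exists_cuts {z0 : List ℕ} {cs : List ℕ} (hcs : cs.Pairwise (· ≥ ·))
    {z : List ℕ} (hz : WC.IsHW z) (hr : Region z0 cs z) :
    ∃ l, (∀ C, (∀ c ∈ cs, c ≤ C) → ∀ i ∈ l, i + 1 ≤ C) ∧ Cuts z0 cs l z := by
  induction cs generalizing z with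
  | nil =>
    refine ⟨[], by simp, fun b _ => ?_⟩
    have h1 : z = z0 := hr
    rw [h1]; rfl
  | cons c cs ih =>
    obtain ⟨p, u, rfl, hp, hr⟩ := hr
    rw [List.pairwise_cons] at hcs
    obtain ⟨L, h1, h2⟩ := ih hcs.2 (isHW_tail hz) hr
    obtain ⟨P, h3, h4, h5, h6⟩ := exists_bound c p hp u
    refine ⟨_, fun C hC i hi => ?_, h2.cons (h1 c hcs.1) hz h3 h4 h5 h6⟩
    have hcC := hC c List.mem_cons_self
    rw [List.mem_append, mem_dn] at hi
    rcases hi with hi | hi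
    · exact h1 C (fun d hd => hC d (List.mem_cons_of_mem _ hd)) i hi
    · omega

/-! ### Realizing normal forms by regions -/

theorem isHW_cons {q : ℕ} {y : List ℕ} (h : WC.IsHW y)
    (hq : ∀ i, q = i + 1 → WC.phi i y ≠ 0) : WC.IsHW (q :: y) := fun i => by
  rw [eps_cons, if_neg, h i]
  rintro ⟨h1, h2⟩
  exact hq i h1 h2

theorem isHW_nil : WC.IsHW [] := fun i => eps_nil i

theorem Cuts.of_append {z0 cs L M u : List ℕ} (hu : WC.IsHW u)
    (hM : ∀ i ∈ M, WC.phi i u = 0) : Cuts z0 cs (L ++ M) u ↔ Cuts z0 cs L u := by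
  refine forall_congr' fun b => imp_congr_right fun _ => ?_
  rw [Crys.ups_append, Crys.ups_eq_iff_of_phi hu hM]

/-- A region realizing the word `l` with dominant weight `φ`. -/
def Realizes (n : ℕ) (φ : ℕ → ℕ) (l cs z : List ℕ) : Prop :=
  cs.Pairwise (· ≥ ·) ∧ (∀ c ∈ cs, c ≤ n) ∧ WC.IsHW z ∧ Region [] cs z ∧
    (∀ i, WC.phi i z = φ i) ∧ Cuts [] cs l z

theorem Realizes.cons {n : ℕ} {φ ψ : ℕ → ℕ} {l cs z : List ℕ} {i : ℕ}
    (h : Realizes n φ l cs z) (hl : ∀ k ∈ l, k + 1 ≤ n) (hi : i ≤ n)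
    (hpos : φ i ≠ 0)
    (h2 : ∀ k, i = k + 1 → φ k ≠ 0)
    (hψ : ∀ m, ψ m = if m = i then φ m + 1 else if i = m + 1 then φ m - 1 else φ m) :
    Realizes n ψ l (n :: cs) (i :: z) := by
  obtain ⟨a1, a2, a3, a4, a5, a6⟩ := h
  have hw : WC.IsHW (i :: z) := isHW_cons a3 fun k hk => by rw [a5]; exact h2 k hk
  refine ⟨?_, ?_, hw, region_cons.2 ⟨hi, a4⟩, fun m => ?_, ?_⟩
  · rw [List.pairwise_cons]; exact ⟨a2, a1⟩
  · intro c hc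
    rcases List.mem_cons.1 hc with rfl | hc
    · exact le_rfl
    · exact a2 c hc
  · rw [phi_cons, hψ, a5]
    simp only [eq_comm]
  · have := a6.cons hl hw le_rfl hi (fun i h1 h2 => by omega) (Or.inr (by rw [a5]; exact hpos))
    rwa [Nat.sub_self, dn, List.append_nil] at this

theorem Realizes.cons_first {n : ℕ} {φ ψ : ℕ → ℕ} {l cs z : List ℕ} {i : ℕ}
    (h : Realizes n φ (l ++ dn (i + 1) (n - (i + 1))) cs z) (hl : ∀ k ∈ l, k + 1 ≤ n) (hi : i ≤ n)
    (hzero : φ i = 0)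
    (h2 : ∀ k, i = k + 1 → φ k ≠ 0)
    (hψ : ∀ m, ψ m = if m = i then φ m + 1 else if i = m + 1 then φ m - 1 else φ m) :
    Realizes n ψ (l ++ dn i (n - i)) (n :: cs) (i :: z) := by
  obtain ⟨a1, a2, a3, a4, a5, a6⟩ := h
  have hw : WC.IsHW (i :: z) := isHW_cons a3 fun k hk => by rw [a5]; exact h2 k hk
  refine ⟨?_, ?_, hw, region_cons.2 ⟨hi, a4⟩, fun m => ?_, ?_⟩
  · rw [List.pairwise_cons]; exact ⟨a2, a1⟩
  · intro c hc
    rcases List.mem_cons.1 hc with rfl | hc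
    · exact le_rfl
    · exact a2 c hc
  · rw [phi_cons, hψ, a5]
    simp only [eq_comm]
  · obtain ⟨P, b1, b2, b3, b4⟩ := exists_bound n i hi z
    have key : Cuts [] cs (l ++ dn P (n - P)) z := by
      by_cases hin : i = n
      · subst hin
        obtain rfl : P = i := by omega
        rwa [show P - (P + 1) = P - P by omega, Nat.sub_self] at *
      · have hPi : i + 1 ≤ P := by
          by_contra hc
          obtain rfl : P = i := by omega
          rcases b4 with b4 | b4
          · exact hin b4
          · rw [a5] at b4; exact b4 hzero
        rw [show n - (i + 1) = (P - (i + 1)) + (n - P) by omega, dn_add,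
          show i + 1 + (P - (i + 1)) = P by omega, ← List.append_assoc,
          Cuts.of_append a3] at a6
        · exact a6
        · intro k hk
          rw [mem_dn] at hk
          exact b3 k (by omega) (by omega)
    have := key.cons (p := i) (c := n) (P := P) (fun k hk => ?_) hw b1 b2 b3 b4
    · rwa [List.append_assoc, show dn P (n - P) ++ dn i (P - i) = dn i (n - i) by
        rw [show n - i = (P - i) + (n - P) by omega, dn_add, show i + (P - i) = P by omega]] at this
    · rw [List.mem_append, mem_dn] at hk
      rcases hk with hk | hk
      · exact hl k hk
      · omega

theorem Realizes.cons_many {n : ℕ} {φ : ℕ → ℕ} {l cs z : List ℕ} {i k : ℕ}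
    (h : Realizes n φ (l ++ dn (i + 1) (n - (i + 1))) cs z) (hl : ∀ k ∈ l, k + 1 ≤ n) (hi : i ≤ n)
    (hzero : φ i = 0)
    (h2 : ∀ m, i = m + 1 → k ≤ φ m) :
    ∃ cs' z', Realizes n (fun m => if m = i then k else if i = m + 1 then φ m - k else φ m)
      (l ++ dn i (n - i)) cs' z' := by
  induction k with
  | zero =>
    refine ⟨cs, z, h.1, h.2.1, h.2.2.1, h.2.2.2.1, fun m => ?_, ?_⟩
    · rw [h.2.2.2.2.1]
      simp only [Nat.sub_zero]
      split_ifs with h1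
      · rw [h1, hzero]
      · rfl
      · rfl
    · have h3 := h.2.2.2.2.2
      by_cases hin : i = n
      · rw [hin] at h3 ⊢
        rwa [show n - (n + 1) = n - n by omega, Nat.sub_self] at *
      · rw [show n - i = (n - (i + 1)) + 1 by omega, dn_succ', ← List.append_assoc,
          Cuts.of_append h.2.2.1]
        · exact h3
        · intro m hm
          rw [List.mem_singleton] at hm
          rw [hm, h.2.2.2.2.1, hzero]
  | succ k ih =>
    by_cases hk : k = 0
    · subst hk
      refine ⟨_, _, h.cons_first hl hi hzero (fun m hm => ?_) fun m => ?_⟩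
      · have := h2 m hm; omega
      · split_ifs with h3
        · rw [h3, hzero]
        · rfl
        · rfl
    · obtain ⟨cs', z', h'⟩ := ih fun m hm => by have := h2 m hm; omega
      refine ⟨_, _, h'.cons (i := i) (fun m hm => ?_) hi ?_ (fun m hm => ?_) fun m => ?_⟩
      · rw [List.mem_append, mem_dn] at hm
        rcases hm with hm | hm
        · exact hl m hm
        · omega
      · rw [if_pos rfl]; exact hk
      · have := h2 m hm
        rw [if_neg (by omega), if_pos hm]; omega
      · split_ifs <;> omega

theorem exists_realizes {n : ℕ} {l : List ℕ} (hl : NF n l) :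
    ∀ φ : ℕ → ℕ, (∀ m, n < m → φ m = 0) → ∃ cs z, Realizes n φ l cs z := by
  induction hl with
  | nil =>
    intro φ hφ
    have h0 : Realizes 0 (fun _ => 0) ([] ++ dn 1 (0 - 1)) [] [] :=
      ⟨List.Pairwise.nil, by simp, isHW_nil, rfl, phi_nil, fun b _ => Iff.rfl⟩
    obtain ⟨cs, z, h⟩ := h0.cons_many (i := 0) (k := φ 0) (by simp) le_rfl rfl (by omega)
    refine ⟨cs, z, ?_⟩
    have h' : Realizes 0 _ [] cs z := h
    convert h' using 1
    funext m
    by_cases h1 : m = 0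
    · rw [if_pos h1, h1]
    · rw [if_neg h1, hφ m (by omega)]; simp
  | @snoc j a l h ha ih =>
    intro φ hφ
    obtain ⟨cs, z, h0⟩ := ih
      (fun m => if m + 1 < a then φ m else if m + 1 = a then φ m + φ (m + 1) else φ (m + 1))
      (fun m hm => by
        rw [if_neg (by omega), if_neg (by omega)]; exact hφ _ (by omega))
    have key : ∀ t i, i + t = j + 2 → a ≤ i → ∃ cs z, Realizes (j + 1) (fun m =>
        if i ≤ m then φ m else if m + 1 = i then (if i = a then φ m else 0) else
          if m + 1 < a then φ m else if m + 1 = a then φ m + φ (m + 1) else φ (m + 1))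
        (l ++ dn i (j + 1 - i)) cs z := by
      intro t
      induction t with
      | zero =>
        intro i hi hai
        refine ⟨cs, z, h0.1, fun c hc => (h0.2.1 c hc).trans (by omega), h0.2.2.1, h0.2.2.2.1,
          fun m => ?_, ?_⟩
        · rw [h0.2.2.2.2.1]
          dsimp only
          have hz : ∀ m, j + 1 < m → φ m = 0 := hφ
          by_cases c1 : i ≤ m
          · rw [if_neg (by omega), if_neg (by omega), if_pos c1, hz _ (by omega), hz _ (by omega)]
          · rw [if_neg c1]
            by_cases c2 : m + 1 = i
            · rw [if_pos c2, if_neg (by omega), if_neg (by omega), if_neg (by omega),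
                hz _ (by omega)]
            · rw [if_neg c2]
        · rw [show j + 1 - i = 0 by omega, dn, List.append_nil]
          exact h0.2.2.2.2.2
      | succ t iht =>
        intro i hi hai
        obtain ⟨cs, z, h1⟩ := iht (i + 1) (by omega) (by omega)
        obtain ⟨cs', z', h2⟩ := h1.cons_many (i := i) (k := φ i)
          (fun k hk => by have := h.lt k hk; omega) (by omega)
          (by rw [if_neg (by omega), if_pos rfl, if_neg (by omega)])
          (fun m hm => by
            subst hm
            rw [if_neg (by omega), if_neg (by omega)]
            by_cases c1 : m + 1 = a
            · rw [if_neg (by omega), if_pos c1]; omega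
            · rw [if_neg (by omega), if_neg c1])
        refine ⟨cs', z', ?_⟩
        convert h2 using 1
        funext m
        by_cases c1 : m = i
        · subst c1; simp
        rw [if_neg c1]
        by_cases c2 : i = m + 1
        · subst c2
          split_ifs <;> omega
        rw [if_neg c2]
        by_cases c3 : i ≤ m
        · rw [if_pos c3, if_pos (by omega)]
        · split_ifs <;> first | rfl | omega
    obtain ⟨cs', z', h1⟩ := key (j + 2 - a) a (by omega) le_rfl
    refine ⟨cs', z', ?_⟩
    convert h1 using 1
    funext m
    split_ifs <;> first | rfl | omega

end WC

open Crys in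
/-- Every set cut out by a word is realized by a region of words. -/
theorem Crys.exists_region {X : Type} {K : Crys X} {u : X} (hu : K.IsHW u)
    (hfin : ∃ N, ∀ m, N ≤ m → K.phi m u = 0) (l : List ℕ) :
    ∃ cs z, cs.Pairwise (· ≥ ·) ∧ WC.Region [] cs z ∧ ∃ c : Comp K WC u z,
      ∀ b b', c.Rel b b' → (WC.Region [] cs b' ↔ K.ups l b = u) := by
  obtain ⟨N, hN⟩ := hfin
  obtain ⟨M, hM⟩ : ∃ M, ∀ i ∈ l, i < M := ⟨l.sum + 1, fun i hi => by
    have := List.single_le_sum (fun x _ => Nat.zero_le x) i hi; omega⟩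
  obtain ⟨l', h1, h2⟩ := WC.exists_nf (n := max N M) l fun i hi => by
    have := hM i hi; omega
  obtain ⟨cs, z, a1, -, a3, a4, a5, a6⟩ := WC.exists_realizes h1 (fun m => K.phi m u)
    fun m hm => hN m (by omega)
  have c : Comp K WC u z := ⟨hu, a3, fun i => (a5 i).symm⟩
  refine ⟨cs, z, a1, a4, c, fun b b' hb => ?_⟩
  rw [a6 b' hb.reach', ← h2 b']
  exact (hb.ups_eq_iff l).symm

/-- Words cutting out the same set: normal forms suffice. -/
theorem Crys.exists_nf {X : Type} {K : Crys X} {u : X} (hu : K.IsHW u)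
    (hfin : ∃ N, ∀ m, N ≤ m → K.phi m u = 0) (l : List ℕ) {n : ℕ} (hl : ∀ i ∈ l, i < n) :
    ∃ l', NF n l' ∧ ∀ b, K.Reach b u → (K.ups l b = u ↔ K.ups l' b = u) := by
  obtain ⟨N, hN⟩ := hfin
  obtain ⟨l', h1, h2⟩ := WC.exists_nf l hl
  obtain ⟨cs, z, a1, -, a3, a4, a5, a6⟩ := WC.exists_realizes (h1.mono (le_max_left n N))
    (fun m => K.phi m u) fun m hm => hN m (by omega)
  have c : Comp K WC u z := ⟨hu, a3, fun i => (a5 i).symm⟩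
  refine ⟨l', h1, fun b hb => ?_⟩
  obtain ⟨b', hb'⟩ := c.exists_rel hb
  rw [hb'.ups_eq_iff, hb'.ups_eq_iff, h2 b']

/-! ### Words of finite sets and their permutations -/

theorem wordPerm_nil : wordPerm [] = 1 := rfl

theorem wordPerm_cons (a : ℕ) (l : List ℕ) : wordPerm (a :: l) = sPerm a * wordPerm l := by
  simp [wordPerm]

theorem wordPerm_append (l l' : List ℕ) : wordPerm (l ++ l') = wordPerm l * wordPerm l' := by
  simp [wordPerm]

theorem wordPerm_singleton (a : ℕ) : wordPerm [a] = sPerm a := by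
  simp [wordPerm]

theorem sPerm_mul_self (a : ℕ) : sPerm a * sPerm a = 1 := Equiv.swap_mul_self _ _

theorem sPerm_far {a b : ℕ} (h : a + 1 < b ∨ b + 1 < a) : Commute (sPerm a) (sPerm b) := by
  apply Equiv.Perm.Disjoint.commute
  intro x
  unfold sPerm
  by_cases h1 : x = a ∨ x = a + 1
  · right
    apply Equiv.swap_apply_of_ne_of_ne <;> omega
  · left
    apply Equiv.swap_apply_of_ne_of_ne <;> omega

theorem sPerm_braid (a : ℕ) :
    sPerm a * sPerm (a + 1) * sPerm a = sPerm (a + 1) * sPerm a * sPerm (a + 1) := by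
  ext x
  simp only [sPerm, Equiv.Perm.coe_mul, Function.comp, Equiv.swap_apply_def]
  split_ifs <;> omega

theorem wordPerm_far {l l' : List ℕ} (h : ∀ x ∈ l, ∀ y ∈ l', x + 1 < y ∨ y + 1 < x) :
    Commute (wordPerm l) (wordPerm l') := by
  have one : ∀ (a : ℕ) (m : List ℕ), (∀ y ∈ m, a + 1 < y ∨ y + 1 < a) →
      Commute (sPerm a) (wordPerm m) := by
    intro a m
    induction m with
    | nil => intro _; exact Commute.one_right _
    | cons b m ih =>
      intro hm
      rw [wordPerm_cons]
      exact (sPerm_far (hm b (by simp))).mul_right (ih fun y hy => hm y (by simp [hy]))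
  induction l with
  | nil => exact Commute.one_left _
  | cons a l ih =>
    rw [wordPerm_cons]
    exact (one a l' fun y hy => h a (by simp) y hy).mul_left
      (ih fun x hx y hy => h x (by simp [hx]) y hy)

/-- The permutation of the word `a, a+1, …, a+n-1`. -/
def cyc (a n : ℕ) : Equiv.Perm ℕ := wordPerm (List.range' a n)

theorem cyc_succ (a n : ℕ) : cyc a (n + 1) = sPerm a * cyc (a + 1) n := by
  simp [cyc, List.range'_succ, wordPerm_cons]

theorem cyc_succ' (a n : ℕ) : cyc a (n + 1) = cyc a n * sPerm (a + n) := by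
  simp [cyc, List.range'_concat, wordPerm_append, wordPerm_singleton]

theorem cyc_mul_cyc (a n : ℕ) : cyc a (n + 1) * cyc a n = cyc (a + 1) n * cyc a (n + 1) := by
  induction n generalizing a with
  | zero => simp [cyc, wordPerm]
  | succ n ih =>
    have hc : Commute (sPerm a) (cyc (a + 1 + 1) n) := by
      rw [← wordPerm_singleton]
      apply wordPerm_far
      intro x hx y hy
      simp only [List.mem_singleton] at hx
      rw [List.mem_range'_1] at hy
      omega
    have h1 := ih (a + 1)
    calc cyc a (n + 1 + 1) * cyc a (n + 1)
        = sPerm a * (sPerm (a + 1) * cyc (a + 1 + 1) n) * (sPerm a * cyc (a + 1) n) := by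
          rw [cyc_succ a (n + 1), cyc_succ (a + 1) n, cyc_succ a n]
      _ = sPerm a * sPerm (a + 1) * (cyc (a + 1 + 1) n * sPerm a) * cyc (a + 1) n := by
          simp only [mul_assoc]
      _ = (sPerm a * sPerm (a + 1) * sPerm a) * (cyc (a + 1 + 1) n * cyc (a + 1) n) := by
          rw [← hc.eq]; simp only [mul_assoc]
      _ = sPerm (a + 1) * sPerm a * (sPerm (a + 1) * cyc (a + 1 + 1) n * cyc (a + 1) n) := by
          rw [sPerm_braid]; simp only [mul_assoc]
      _ = sPerm (a + 1) * sPerm a * (cyc (a + 1 + 1) n * cyc (a + 1) (n + 1)) := by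
          rw [← cyc_succ (a + 1) n, h1]
      _ = sPerm (a + 1) * (cyc (a + 1 + 1) n * sPerm a) * cyc (a + 1) (n + 1) := by
          rw [← hc.eq]; simp only [mul_assoc]
      _ = cyc (a + 1) (n + 1) * cyc a (n + 1 + 1) := by
          rw [cyc_succ (a + 1) n, cyc_succ a (n + 1), cyc_succ (a + 1) n]; simp only [mul_assoc]

/-- The increasing word of a finite set. -/
def srt (A : Finset ℕ) : List ℕ := A.sort (· ≤ ·)

theorem mem_srt {A : Finset ℕ} {x : ℕ} : x ∈ srt A ↔ x ∈ A := Finset.mem_sort _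

theorem length_srt (A : Finset ℕ) : (srt A).length = A.card := Finset.length_sort _

theorem pairwise_srt (A : Finset ℕ) : (srt A).Pairwise (· < ·) :=
  (Finset.sortedLT_sort A).pairwise

theorem eq_of_pairwise {l l' : List ℕ} (h : l.Pairwise (· < ·)) (h' : l'.Pairwise (· < ·))
    (hm : ∀ x, x ∈ l ↔ x ∈ l') : l = l' :=
  List.Pairwise.eq_of_mem_iff h h' (by simpa using hm)

theorem srt_eq {A : Finset ℕ} {l : List ℕ} (h : l.Pairwise (· < ·)) (hm : ∀ x, x ∈ l ↔ x ∈ A) :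
    srt A = l :=
  eq_of_pairwise (pairwise_srt A) h fun x => by rw [mem_srt, hm]

@[simp] theorem srt_empty : srt ∅ = [] := srt_eq List.Pairwise.nil (by simp)

theorem srt_split {A : Finset ℕ} {a n : ℕ} (h : ∀ x, a ≤ x → x < a + n → x ∈ A) :
    srt A = srt (A.filter (· < a)) ++ List.range' a n ++ srt (A.filter (a + n ≤ ·)) := by
  apply srt_eq
  · rw [List.pairwise_append, List.pairwise_append]
    refine ⟨⟨pairwise_srt _, List.pairwise_lt_range', ?_⟩, pairwise_srt _, ?_⟩
    · intro x hx y hy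
      rw [mem_srt, Finset.mem_filter] at hx
      rw [List.mem_range'_1] at hy
      omega
    · intro x hx y hy
      rw [mem_srt, Finset.mem_filter] at hy
      rw [List.mem_append, mem_srt, Finset.mem_filter, List.mem_range'_1] at hx
      omega
  · intro x
    rw [List.mem_append, List.mem_append, mem_srt, mem_srt, Finset.mem_filter, Finset.mem_filter,
      List.mem_range'_1]
    constructor
    · rintro ((hx | hx) | hx)
      · exact hx.1
      · exact h x hx.1 hx.2
      · exact hx.1
    · intro hx
      by_cases h1 : x < a
      · exact Or.inl (Or.inl ⟨hx, h1⟩)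
      · by_cases h2 : x < a + n
        · exact Or.inl (Or.inr ⟨by omega, h2⟩)
        · exact Or.inr ⟨hx, by omega⟩

/-- The permutation of the increasing word of a finite set. -/
def pm (A : Finset ℕ) : Equiv.Perm ℕ := wordPerm (srt A)

theorem pm_mul_pm {A B : Finset ℕ} {a n k : ℕ} (hA : ∀ x, a ≤ x → x < a + n → x ∈ A)
    (hB : ∀ x, a ≤ x → x < a + k → x ∈ B) (hn : a + n ∉ A) (hk : ∀ x ∈ B, x + 1 ≠ a)
    (hkn : k ≤ n) :
    pm A * pm B = pm (A.filter (· < a)) * pm (B.filter (· < a)) * (cyc a n * cyc a k) *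
      (pm (A.filter (a + n ≤ ·)) * pm (B.filter (a + k ≤ ·))) := by
  have h1 : Commute (pm (A.filter (a + n ≤ ·))) (pm (B.filter (· < a))) := by
    apply wordPerm_far
    intro x hx y hy
    rw [mem_srt, Finset.mem_filter] at hx hy
    have h : x ≠ a + n := fun h => hn (h ▸ hx.1)
    have h' := hk y hy.1
    omega
  have h2 : Commute (pm (A.filter (a + n ≤ ·))) (cyc a k) := by
    apply wordPerm_far
    intro x hx y hy
    rw [mem_srt, Finset.mem_filter] at hx
    rw [List.mem_range'_1] at hy
    have : x ≠ a + n := fun h => hn (h ▸ hx.1)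
    omega
  have h3 : Commute (cyc a n) (pm (B.filter (· < a))) := by
    apply wordPerm_far
    intro x hx y hy
    rw [mem_srt, Finset.mem_filter] at hy
    rw [List.mem_range'_1] at hx
    have := hk y hy.1
    omega
  have eA : pm A = pm (A.filter (· < a)) * cyc a n * pm (A.filter (a + n ≤ ·)) := by
    rw [pm, srt_split hA, wordPerm_append, wordPerm_append]; rfl
  have eB : pm B = pm (B.filter (· < a)) * cyc a k * pm (B.filter (a + k ≤ ·)) := by
    rw [pm, srt_split hB, wordPerm_append, wordPerm_append]; rfl
  generalize pm (A.filter (a + n ≤ ·)) = A2 at *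
  generalize pm (B.filter (a + k ≤ ·)) = B2 at *
  generalize pm (A.filter (· < a)) = A1 at *
  generalize pm (B.filter (· < a)) = B1 at *
  rw [eA, eB]
  calc A1 * cyc a n * A2 * (B1 * cyc a k * B2)
      = A1 * cyc a n * (A2 * B1) * cyc a k * B2 := by simp only [mul_assoc]
    _ = A1 * (cyc a n * B1) * (A2 * cyc a k) * B2 := by rw [h1.eq]; simp only [mul_assoc]
    _ = _ := by rw [h2.eq, h3.eq]; simp only [mul_assoc]

theorem pm_mul_pm' {A B : Finset ℕ} {a n k : ℕ} (hA : ∀ x, a + 1 ≤ x → x < a + 1 + n → x ∈ A)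
    (ha : a ∉ A)
    (hB : ∀ x, a ≤ x → x < a + k → x ∈ B) (hn : a + 1 + n ∉ A)
    (hkn : k ≤ n + 1) :
    pm A * pm B = pm (A.filter (· < a)) * pm (B.filter (· < a)) * (cyc (a + 1) n * cyc a k) *
      (pm (A.filter (a + (n + 1) ≤ ·)) * pm (B.filter (a + k ≤ ·))) := by
  have h1 : Commute (pm (A.filter (a + (n + 1) ≤ ·))) (pm (B.filter (· < a))) := by
    apply wordPerm_far
    intro x hx y hy
    rw [mem_srt, Finset.mem_filter] at hx hy
    omega
  have h2 : Commute (pm (A.filter (a + (n + 1) ≤ ·))) (cyc a k) := by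
    apply wordPerm_far
    intro x hx y hy
    rw [mem_srt, Finset.mem_filter] at hx
    rw [List.mem_range'_1] at hy
    have : x ≠ a + 1 + n := fun h => hn (h ▸ hx.1)
    omega
  have h3 : Commute (cyc (a + 1) n) (pm (B.filter (· < a))) := by
    apply wordPerm_far
    intro x hx y hy
    rw [mem_srt, Finset.mem_filter] at hy
    rw [List.mem_range'_1] at hx
    omega
  have e1 : A.filter (· < a + 1) = A.filter (· < a) := by
    ext x
    simp only [Finset.mem_filter]
    constructor
    · rintro ⟨h, h'⟩
      have : x ≠ a := fun e => ha (e ▸ h)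
      exact ⟨h, by omega⟩
    · rintro ⟨h, h'⟩
      exact ⟨h, by omega⟩
  have e2 : a + 1 + n = a + (n + 1) := by omega
  have eA : pm A = pm (A.filter (· < a)) * cyc (a + 1) n * pm (A.filter (a + (n + 1) ≤ ·)) := by
    rw [pm, srt_split hA, wordPerm_append, wordPerm_append, e1, e2]; rfl
  have eB : pm B = pm (B.filter (· < a)) * cyc a k * pm (B.filter (a + k ≤ ·)) := by
    rw [pm, srt_split hB, wordPerm_append, wordPerm_append]; rfl
  generalize pm (A.filter (a + (n + 1) ≤ ·)) = A2 at *
  generalize pm (B.filter (a + k ≤ ·)) = B2 at *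
  generalize pm (A.filter (· < a)) = A1 at *
  generalize pm (B.filter (· < a)) = B1 at *
  rw [eA, eB]
  calc A1 * cyc (a + 1) n * A2 * (B1 * cyc a k * B2)
      = A1 * cyc (a + 1) n * (A2 * B1) * cyc a k * B2 := by simp only [mul_assoc]
    _ = A1 * (cyc (a + 1) n * B1) * (A2 * cyc a k) * B2 := by rw [h1.eq]; simp only [mul_assoc]
    _ = _ := by rw [h2.eq, h3.eq]; simp only [mul_assoc]

/-- Exchanging the run `[a, a+n]` in the upper and `[a, a+n)` in the lower block. -/
theorem pm_exchange {A B : Finset ℕ} {a n : ℕ} (hA : ∀ x, a ≤ x → x ≤ a + n → x ∈ A)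
    (hB : ∀ x, a ≤ x → x < a + n → x ∈ B) (hnA : a + n + 1 ∉ A) (hnB : a + n ∉ B)
    (hk : ∀ x ∈ B, x + 1 ≠ a) :
    pm A * pm B = pm (A.erase a) * pm (insert (a + n) B) := by
  have e1 : (A.erase a).filter (· < a) = A.filter (· < a) := by
    ext x; simp only [Finset.mem_filter, Finset.mem_erase]
    constructor
    · rintro ⟨h, h'⟩; exact ⟨h.2, h'⟩
    · rintro ⟨h, h'⟩; exact ⟨⟨by omega, h⟩, h'⟩
  have e2 : (insert (a + n) B).filter (· < a) = B.filter (· < a) := by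
    ext x; simp only [Finset.mem_filter, Finset.mem_insert]
    constructor
    · rintro ⟨h | h, h'⟩
      · omega
      · exact ⟨h, h'⟩
    · rintro ⟨h, h'⟩; exact ⟨Or.inr h, h'⟩
  have e3 : (A.erase a).filter (a + (n + 1) ≤ ·) = A.filter (a + (n + 1) ≤ ·) := by
    ext x; simp only [Finset.mem_filter, Finset.mem_erase]
    constructor
    · rintro ⟨h, h'⟩; exact ⟨h.2, h'⟩
    · rintro ⟨h, h'⟩; exact ⟨⟨by omega, h⟩, h'⟩
  have e4 : (insert (a + n) B).filter (a + (n + 1) ≤ ·) = B.filter (a + n ≤ ·) := by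
    ext x; simp only [Finset.mem_filter, Finset.mem_insert]
    constructor
    · rintro ⟨h | h, h'⟩
      · omega
      · exact ⟨h, by omega⟩
    · rintro ⟨h, h'⟩
      have : x ≠ a + n := fun e => hnB (e ▸ h)
      exact ⟨Or.inr h, by omega⟩
  rw [pm_mul_pm (a := a) (n := n + 1) (k := n) (fun x h1 h2 => hA x h1 (by omega)) hB
      (by rwa [← add_assoc]) hk (by omega),
    pm_mul_pm' (a := a) (n := n) (k := n + 1) (A := A.erase a) (B := insert (a + n) B)
      (fun x h1 h2 => Finset.mem_erase.2 ⟨by omega, hA x (by omega) (by omega)⟩) (by simp)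
      ?_ ?_ le_rfl, cyc_mul_cyc, e1, e2, e3, e4]
  · intro x h1 h2
    by_cases h : x = a + n
    · simp [h]
    · exact Finset.mem_insert_of_mem (hB x h1 (by omega))
  · intro h
    apply hnA
    have := Finset.mem_of_mem_erase h
    rwa [show a + n + 1 = a + 1 + n by omega]

/-- A common run shared by two consecutive blocks can be shortened. -/
theorem pm_mul_pm_not_reduced {A B : Finset ℕ} {a n : ℕ} (hA : ∀ x, a ≤ x → x ≤ a + n → x ∈ A)
    (hB : ∀ x, a ≤ x → x ≤ a + n → x ∈ B) (hnA : a + n + 1 ∉ A)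
    (hk : ∀ x ∈ B, x + 1 ≠ a) :
    ∃ l : List ℕ, wordPerm l = pm A * pm B ∧ l.length < A.card + B.card ∧
      ∀ x ∈ l, x ∈ A ∨ x ∈ B := by
  refine ⟨srt (A.filter (· < a)) ++ srt (B.filter (· < a)) ++ (List.range' (a + 1) n ++
    List.range' a n) ++ (srt (A.filter (a + (n + 1) ≤ ·)) ++ srt (B.filter (a + (n + 1) ≤ ·))),
    ?_, ?_, ?_⟩
  · rw [pm_mul_pm (a := a) (n := n + 1) (k := n + 1) (fun x h1 h2 => hA x h1 (by omega))
      (fun x h1 h2 => hB x h1 (by omega)) (by rwa [← add_assoc]) hk le_rfl]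
    have : cyc a (n + 1) * cyc a (n + 1) = cyc (a + 1) n * cyc a n := by
      conv_lhs => rhs; rw [cyc_succ' a n]
      rw [← mul_assoc, cyc_mul_cyc, cyc_succ' a n, mul_assoc, mul_assoc, sPerm_mul_self, mul_one]
    rw [this]
    simp only [wordPerm_append]
    rfl
  · have h1 := congrArg List.length (srt_split (A := A) (a := a) (n := n + 1)
      (fun x h1 h2 => hA x h1 (by omega)))
    have h2 := congrArg List.length (srt_split (A := B) (a := a) (n := n + 1)
      (fun x h1 h2 => hB x h1 (by omega)))
    simp only [List.length_append, length_srt, List.length_range'] at h1 h2 ⊢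
    omega
  · intro x hx
    simp only [List.mem_append, mem_srt, Finset.mem_filter, List.mem_range'_1] at hx
    rcases hx with ((hx | hx) | (hx | hx)) | (hx | hx)
    · exact Or.inl hx.1
    · exact Or.inr hx.1
    · exact Or.inl (hA x (by omega) (by omega))
    · exact Or.inl (hA x (by omega) (by omega))
    · exact Or.inl hx.1
    · exact Or.inr hx.1

/-! ### The crystal of increasing factorizations -/

/-- The concatenation of the increasing words of the blocks `f (M-1), …, f 0`. -/
def wd (f : ℕ → Finset ℕ) : ℕ → List ℕ
  | 0 => []
  | M + 1 => srt (f M) ++ wd f M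

/-- All blocks of index at least `M` are empty. -/
def Bd (f : ℕ → Finset ℕ) (M : ℕ) : Prop := ∀ m, M ≤ m → f m = ∅

theorem mem_wd {f : ℕ → Finset ℕ} {M x : ℕ} : x ∈ wd f M ↔ ∃ m < M, x ∈ f m := by
  induction M with
  | zero => simp [wd]
  | succ M ih =>
    rw [wd, List.mem_append, mem_srt, ih]
    constructor
    · rintro (h | ⟨m, h, h'⟩)
      · exact ⟨M, by omega, h⟩
      · exact ⟨m, by omega, h'⟩
    · rintro ⟨m, h, h'⟩
      by_cases e : m = M
      · exact Or.inl (e ▸ h')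
      · exact Or.inr ⟨m, by omega, h'⟩

theorem wd_congr {f g : ℕ → Finset ℕ} {M : ℕ} (h : ∀ m < M, f m = g m) : wd f M = wd g M := by
  induction M with
  | zero => rfl
  | succ M ih => rw [wd, wd, h M (by omega), ih fun m hm => h m (by omega)]

theorem wd_of_bd {f : ℕ → Finset ℕ} {M M' : ℕ} (h : Bd f M) (hM : M ≤ M') :
    wd f M' = wd f M := by
  induction M', hM using Nat.le_induction with
  | base => rfl
  | succ M' hM ih => rw [wd, h M' hM, srt_empty, List.nil_append, ih]

theorem wd_split (f : ℕ → Finset ℕ) {i M : ℕ} (hM : i + 2 ≤ M) :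
    ∃ p q : List ℕ, ∀ g : ℕ → Finset ℕ, (∀ m, m ≠ i → m ≠ i + 1 → g m = f m) →
      wd g M = p ++ (srt (g (i + 1)) ++ srt (g i)) ++ q := by
  induction M, hM using Nat.le_induction with
  | base =>
    refine ⟨[], wd f i, fun g hg => ?_⟩
    rw [wd, wd, wd_congr (g := f) (M := i) fun m hm => hg m (by omega) (by omega)]
    simp
  | succ M hM ih =>
    obtain ⟨p, q, h⟩ := ih
    refine ⟨srt (f M) ++ p, q, fun g hg => ?_⟩
    rw [wd, h g hg, hg M (by omega) (by omega)]
    simp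

/-- Two bounds give the same word up to empty blocks. -/
theorem wd_eq_of_bd {f : ℕ → Finset ℕ} {M M' : ℕ} (h : Bd f M) (h' : Bd f M') :
    wd f M = wd f M' := by
  rcases le_total M M' with hM | hM
  · exact (wd_of_bd h hM).symm
  · exact wd_of_bd h' hM

/-- An increasing factorization of a reduced word of `w`. -/
def IsRF (w : Equiv.Perm ℕ) (f : ℕ → Finset ℕ) : Prop :=
  ∃ M, Bd f M ∧ IsReducedWordFor w (wd f M)

theorem Bd.mono {f : ℕ → Finset ℕ} {M M' : ℕ} (h : Bd f M) (hM : M ≤ M') : Bd f M' :=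
  fun m hm => h m (hM.trans hm)

theorem IsRF.red {w : Equiv.Perm ℕ} {f : ℕ → Finset ℕ} (h : IsRF w f) {M : ℕ} (hM : Bd f M) :
    IsReducedWordFor w (wd f M) := by
  obtain ⟨M', h1, h2⟩ := h
  rwa [wd_eq_of_bd hM h1]

theorem IsRF.pos {w : Equiv.Perm ℕ} {f : ℕ → Finset ℕ} (h : IsRF w f) {m x : ℕ} (hx : x ∈ f m) :
    1 ≤ x := by
  obtain ⟨M, h1, h2⟩ := h
  refine h2.1.1 x (mem_wd.2 ⟨m, ?_, hx⟩)
  by_contra hm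
  rw [h1 m (by omega)] at hx
  exact absurd hx (Finset.notMem_empty x)

theorem IsReducedWordFor.of_le {w : Equiv.Perm ℕ} {l l' : List ℕ} (h : IsReducedWordFor w l)
    (hp : PosWord l') (hw : wordPerm l' = w) (hl : l'.length ≤ l.length) :
    IsReducedWordFor w l' :=
  ⟨⟨hp, fun σ hσ hσw => hl.trans (h.1.2 σ hσ (by rw [hσw, hw, h.2]))⟩, hw⟩

theorem IsReducedWordFor.le {w : Equiv.Perm ℕ} {l l' : List ℕ} (h : IsReducedWordFor w l)
    (hp : PosWord l') (hw : wordPerm l' = w) : l.length ≤ l'.length :=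
  h.1.2 l' hp (by rw [hw, h.2])

/-- Replacing two consecutive blocks by blocks with the same product and the same size. -/
theorem IsRF.replace {w : Equiv.Perm ℕ} {f g : ℕ → Finset ℕ} (h : IsRF w f) (i : ℕ)
    (hg : ∀ m, m ≠ i → m ≠ i + 1 → g m = f m)
    (hpos : ∀ x, x ∈ g i ∨ x ∈ g (i + 1) → 1 ≤ x)
    (hpm : pm (f (i + 1)) * pm (f i) = pm (g (i + 1)) * pm (g i))
    (hcard : (f (i + 1)).card + (f i).card = (g (i + 1)).card + (g i).card) : IsRF w g := by
  obtain ⟨M, h1, -⟩ := id h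
  have h1' : Bd f (M + (i + 2)) := h1.mono (by omega)
  have h2 := h.red h1'
  have hgb : Bd g (M + (i + 2)) := fun m hm => by
    rw [hg m (by omega) (by omega)]; exact h1' m hm
  refine ⟨_, hgb, ?_⟩
  obtain ⟨p, q, hpq⟩ := wd_split f (i := i) (M := M + (i + 2)) (by omega)
  have ef := hpq f fun _ _ _ => rfl
  have eg := hpq g hg
  apply h2.of_le
  · intro x hx
    obtain ⟨m, -, hm⟩ := mem_wd.1 hx
    by_cases e1 : m = i
    · exact hpos x (Or.inl (e1 ▸ hm))
    · by_cases e2 : m = i + 1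
      · exact hpos x (Or.inr (e2 ▸ hm))
      · rw [hg m e1 e2] at hm
        exact h.pos hm
  · rw [← h2.2, ef, eg]
    simp only [wordPerm_append]
    change _ * (pm (g (i + 1)) * pm (g i)) * _ = _ * (pm (f (i + 1)) * pm (f i)) * _
    rw [hpm]
  · rw [ef, eg]
    simp only [List.length_append, length_srt]
    omega

/-- The image of a set of natural numbers in the integers. -/
def zi (A : Finset ℕ) : Finset ℤ := A.map Nat.castEmbedding

theorem mem_zi {A : Finset ℕ} {n : ℕ} : (n : ℤ) ∈ zi A ↔ n ∈ A := by
  simp [zi]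

theorem exists_of_mem_zi {A : Finset ℕ} {x : ℤ} (h : x ∈ zi A) : ∃ n : ℕ, x = n ∧ n ∈ A := by
  obtain ⟨n, hn, e⟩ := Finset.mem_map.1 h
  exact ⟨n, e.symm, hn⟩

theorem zi_injective : Function.Injective zi := Finset.map_injective _

theorem zi_erase (A : Finset ℕ) (a : ℕ) : zi (A.erase a) = (zi A).erase a := by
  unfold zi
  rw [Finset.map_erase]
  rfl

theorem zi_insert (A : Finset ℕ) (a : ℕ) : zi (insert a A) = insert (a : ℤ) (zi A) := by
  unfold zi
  rw [Finset.map_insert]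
  rfl

theorem IsStep.pm_eq {A B : Finset ℕ} {a n : ℕ}
    (h : IsStep (zi A) (zi B) (a : ℤ) ((a + n : ℕ) : ℤ)) :
    pm A * pm B = pm (A.erase a) * pm (insert (a + n) B) := by
  apply pm_exchange
  · intro x h1 h2
    exact mem_zi.1 (h.memA x (by exact_mod_cast h1) (by exact_mod_cast h2))
  · intro x h1 h2
    exact mem_zi.1 (h.memB x (by exact_mod_cast h1) (by exact_mod_cast h2))
  · intro hx
    exact h.succ_not_memA (by exact_mod_cast mem_zi.2 hx)
  · intro hx
    exact h.not_memB (mem_zi.2 hx)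
  · intro x hx e
    apply h.pred_not_memB
    have := mem_zi.2 hx
    rwa [show (a : ℤ) - 1 = x by omega]

theorem IsStep.card_nat {A B : Finset ℕ} {a n : ℕ}
    (h : IsStep (zi A) (zi B) (a : ℤ) ((a + n : ℕ) : ℤ)) :
    A.card + B.card = (A.erase a).card + (insert (a + n) B).card := by
  have h1 : a ∈ A := mem_zi.1 h.mem_left
  have h2 : a + n ∉ B := fun hx => h.not_memB (mem_zi.2 hx)
  rw [Finset.card_insert_of_notMem h2, Finset.card_erase_of_mem h1]
  have := Finset.card_pos.2 ⟨a, h1⟩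
  omega

theorem red_zi_of_isRF {w : Equiv.Perm ℕ} {f : ℕ → Finset ℕ} (h : IsRF w f) (i : ℕ) :
    Red (zi (f (i + 1))) (zi (f i)) := by
  intro a r har hab hr ha
  obtain ⟨a, rfl, -⟩ := exists_of_mem_zi (hab a le_rfl har).1
  obtain ⟨n, rfl⟩ : ∃ n : ℕ, r = (a + n : ℕ) := ⟨(r - a).toNat, by push_cast; omega⟩
  obtain ⟨l, hl, hlen, hmem⟩ := pm_mul_pm_not_reduced (A := f (i + 1)) (B := f i) (a := a)
    (n := n)
    (fun x h1 h2 => mem_zi.1 (hab x (by exact_mod_cast h1) (by exact_mod_cast h2)).1)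
    (fun x h1 h2 => mem_zi.1 (hab x (by exact_mod_cast h1) (by exact_mod_cast h2)).2)
    (fun hx => hr (by exact_mod_cast mem_zi.2 hx))
    (fun x hx e => ha (by have := mem_zi.2 hx; rwa [show (a : ℤ) - 1 = x by omega]))
  obtain ⟨M, h1, -⟩ := id h
  have h1' : Bd f (M + (i + 2)) := h1.mono (by omega)
  have h2 := h.red h1'
  obtain ⟨p, q, hpq⟩ := wd_split f (i := i) (M := M + (i + 2)) (by omega)
  have ef := hpq f fun _ _ _ => rfl
  have := h2.le (l' := p ++ l ++ q) ?_ ?_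
  · rw [ef] at this
    simp only [List.length_append, length_srt] at this
    omega
  · intro x hx
    rw [List.mem_append, List.mem_append] at hx
    have h3 := h2.1.1
    rw [ef] at h3
    rcases hx with (hx | hx) | hx
    · exact h3 x (by simp [hx])
    · rcases hmem x hx with hx | hx
      · exact h.pos hx
      · exact h.pos hx
    · exact h3 x (by simp [hx])
  · rw [← h2.2, ef]
    simp only [wordPerm_append, hl]
    rfl

/-- Increasing factorizations of reduced words of `w`. -/
@[ext] structure RF (w : Equiv.Perm ℕ) : Type where
  val : ℕ → Finset ℕ
  isRF : IsRF w val

/-- The crystal model of increasing factorizations. -/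
def rfModel (w : Equiv.Perm ℕ) : Model (RF w) where
  blk f m := zi (f.1 m)
  blk_inj {x y} h := by
    apply RF.ext
    funext m
    exact zi_injective (congrFun h m)
  fin x := by
    obtain ⟨M, h, -⟩ := x.2
    exact ⟨M, fun m hm => by rw [h m hm]; rfl⟩
  red x i := red_zi_of_isRF x.2 i
  fwd := by
    intro x i a r h
    obtain ⟨a, rfl, ha⟩ := exists_of_mem_zi h.mem_left
    obtain ⟨n, rfl⟩ : ∃ n : ℕ, r = (a + n : ℕ) :=
      ⟨(r - a).toNat, by have := h.le; push_cast; omega⟩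
    let g : ℕ → Finset ℕ := Function.update (Function.update x.1 (i + 1) ((x.1 (i + 1)).erase a)) i
      (insert (a + n) (x.1 i))
    have g1 : g (i + 1) = (x.1 (i + 1)).erase a := by simp [g]
    have g0 : g i = insert (a + n) (x.1 i) := by simp [g]
    have gm : ∀ m, m ≠ i → m ≠ i + 1 → g m = x.1 m := fun m h1 h2 => by simp [g, h1, h2]
    have hg : IsRF w g := by
      apply x.2.replace i gm
      · intro y hy
        rw [g1, g0] at hy
        rcases hy with hy | hy
        · rcases Finset.mem_insert.1 hy with hy | hy
          · have := x.2.pos ha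
            omega
          · exact x.2.pos hy
        · exact x.2.pos (Finset.mem_of_mem_erase hy)
      · rw [g1, g0]; exact h.pm_eq
      · rw [g1, g0]; exact h.card_nat
    exact ⟨⟨g, hg⟩, (congrArg zi g1).trans (zi_erase _ _),
      (congrArg zi g0).trans (zi_insert _ _), fun m h1 h2 => congrArg zi (gm m h1 h2)⟩
  bwd := by
    intro y i A B a r h hA hB
    have har := h.le
    have hay : a ∈ zi (y.1 i) := by
      rw [hB]
      rcases har.lt_or_eq with h1 | h1
      · exact Finset.mem_insert_of_mem (h.memB a le_rfl h1)
      · rw [h1]; exact Finset.mem_insert_self _ _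
    obtain ⟨a, rfl, ha⟩ := exists_of_mem_zi hay
    obtain ⟨n, rfl⟩ : ∃ n : ℕ, r = (a + n : ℕ) :=
      ⟨(r - a).toNat, by push_cast; omega⟩
    have eA : A = zi (insert a (y.1 (i + 1))) := by
      rw [zi_insert, hA, Finset.insert_erase h.mem_left]
    have eB : B = zi ((y.1 i).erase (a + n)) := by
      rw [zi_erase, hB, Finset.erase_insert h.not_memB]
    have ha1 : a ∉ y.1 (i + 1) := by
      intro hx
      have := mem_zi.2 hx
      rw [hA] at this
      exact (Finset.mem_erase.1 this).1 rfl
    have hr1 : a + n ∈ y.1 i := by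
      apply mem_zi.1
      rw [hB]
      exact Finset.mem_insert_self _ _
    rw [eA, eB] at h
    let g : ℕ → Finset ℕ := Function.update (Function.update y.1 (i + 1)
      (insert a (y.1 (i + 1)))) i ((y.1 i).erase (a + n))
    have g1 : g (i + 1) = insert a (y.1 (i + 1)) := by simp [g]
    have g0 : g i = (y.1 i).erase (a + n) := by simp [g]
    have gm : ∀ m, m ≠ i → m ≠ i + 1 → g m = y.1 m := fun m h1 h2 => by simp [g, h1, h2]
    have hg : IsRF w g := by
      apply y.2.replace i gm
      · intro z hz
        rw [g1, g0] at hz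
        rcases hz with hz | hz
        · exact y.2.pos (Finset.mem_of_mem_erase hz)
        · rcases Finset.mem_insert.1 hz with hz | hz
          · rw [hz]; exact y.2.pos ha
          · exact y.2.pos hz
      · rw [g1, g0, h.pm_eq, Finset.erase_insert ha1, Finset.insert_erase hr1]
      · have := h.card_nat
        rw [Finset.erase_insert ha1, Finset.insert_erase hr1] at this
        rw [g1, g0, this]
    exact ⟨⟨g, hg⟩, (congrArg zi g1).trans eA.symm, (congrArg zi g0).trans eB.symm,
      fun m h1 h2 => congrArg zi (gm m h1 h2)⟩

/-- The crystal of increasing factorizations of reduced words of `w`. -/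
abbrev RC (w : Equiv.Perm ℕ) : Crys (RF w) := (rfModel w).crys

/-! ### Appending a fixed element of a crystal -/

/-- A relation `T` between two crystals which looks like tensoring with a fixed highest weight
element with `phi i = δ i`. -/
structure Emb {X X' : Type} (K : Crys X) (K' : Crys X') (δ : ℕ → ℕ) (T : X → X' → Prop) :
    Prop where
  step : ∀ {i x x' y'}, T x x' → K'.step i x' y' → ∃ y, K.step i x y ∧ T y y'
  eps : ∀ {x x'}, T x x' → ∀ i, K'.eps i x' = K.eps i x - δ i
  phi : ∀ {x x'}, T x x' → ∀ i, K'.phi i x' = K.phi i x + (δ i - K.eps i x)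
  left_unique : ∀ {x y x'}, T x x' → T y x' → x = y
  right_unique : ∀ {x x' y'}, T x x' → T x y' → x' = y'

namespace Emb
variable {X X' Y Y' : Type} {K : Crys X} {K' : Crys X'} {L : Crys Y} {L' : Crys Y'}
  {δ : ℕ → ℕ} {T : X → X' → Prop} {S : Y → Y' → Prop}

theorem reach (E : Emb K K' δ T) {x : X} {x' u' : X'} (h : K'.Reach x' u') (hT : T x x') :
    ∃ u, K.Reach x u ∧ T u u' := by
  induction h using Relation.ReflTransGen.head_induction_on generalizing x with
  | refl => exact ⟨x, .refl, hT⟩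
  | head hs _ ih =>
    obtain ⟨i, hs⟩ := hs
    obtain ⟨y, h1, h2⟩ := E.step hT hs
    obtain ⟨u, h3, h4⟩ := ih h2
    exact ⟨u, .of_step h1 h3, h4⟩

theorem rel (E : Emb K K' δ T) (E' : Emb L L' δ S) {u : X} {z : Y} (c : Comp K L u z) {u' : X'}
    {z' : Y'} (c' : Comp K' L' u' z') {gu : X} {zu : Y} (hT : T gu u') (hS : S zu z')
    (hg : c.Rel gu zu) {g : X} {f : X'} {y : Y} {y' : Y'} (hf : K'.Reach f u') (h1 : T g f)
    (h2 : S y y') (h3 : c.Rel g y) : c'.Rel f y' := by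
  induction hf using Relation.ReflTransGen.head_induction_on generalizing g y y' with
  | refl =>
    obtain rfl := E.left_unique h1 hT
    obtain rfl := h3.right_unique hg
    obtain rfl := E'.right_unique h2 hS
    exact c'.rel_base
  | @head f f1 hs hr ih =>
    obtain ⟨i, hs⟩ := hs
    obtain ⟨g1, k1, k2⟩ := E.step h1 hs
    obtain ⟨y1, k3, k4⟩ := h3.step k1
    have k5 : 0 < L'.eps i y' := by
      rw [E'.eps h2, ← h3.eps_eq, ← E.eps h1]
      exact Crys.eps_pos_of_step hs
    obtain ⟨y1', k6⟩ := L'.exists_step k5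
    obtain ⟨y2, k7, k8⟩ := E'.step h2 k6
    obtain rfl := L.det k3 k7
    have k9 := ih k2 k8 k4
    obtain ⟨b, hb⟩ := c'.exists_rel (Crys.Reach.of_step hs hr)
    obtain ⟨b1, k10, k11⟩ := hb.step hs
    obtain rfl := k11.right_unique k9
    rwa [L'.inj k6 k10]

end Emb

namespace WC

/-- The values of `phi` on the word `k-1, …, 1, 0`. -/
def dl (k i : ℕ) : ℕ := if i + 1 = k then 1 else 0

theorem eps_phi_dn (k i : ℕ) : WC.eps i (dn 0 k) = 0 ∧ WC.phi i (dn 0 k) = dl k i := by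
  induction k with
  | zero => exact ⟨eps_nil i, by rw [show dn 0 0 = [] from rfl, phi_nil]; rfl⟩
  | succ k ih =>
    rw [show dn 0 (k + 1) = (0 + k) :: dn 0 k from rfl, eps_cons, phi_cons, ih.1, ih.2]
    by_cases h1 : i + 1 = k
    · subst h1
      simp [dl]
    · rw [show dl k i = 0 by simp [dl, h1]]
      by_cases h2 : i = k
      · rw [show dl (k + 1) i = 1 by simp [dl, h2]]
        constructor <;> split_ifs <;> omega
      · rw [show dl (k + 1) i = 0 by simp [dl, h2]]
        constructor <;> split_ifs <;> omega

theorem eps_phi_append (k i : ℕ) (y : List ℕ) :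
    WC.eps i (y ++ dn 0 k) = WC.eps i y - dl k i ∧
      WC.phi i (y ++ dn 0 k) = WC.phi i y + (dl k i - WC.eps i y) := by
  induction y with
  | nil =>
    rw [List.nil_append, (eps_phi_dn k i).1, (eps_phi_dn k i).2, eps_nil, phi_nil]
    omega
  | cons q y ih =>
    rw [List.cons_append, eps_cons, phi_cons, eps_cons, phi_cons, ih.1, ih.2]
    constructor <;> split_ifs <;> omega

theorem dl_le (k i : ℕ) : dl k i ≤ 1 := by unfold dl; split_ifs <;> omega

theorem emb (k : ℕ) : Emb WC WC (dl k) fun y y' => y' = y ++ dn 0 k where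
  step := by
    rintro i y y' z rfl h
    induction y generalizing z with
    | nil =>
      have := Crys.eps_pos_of_step h
      rw [List.nil_append, (eps_phi_dn k i).1] at this
      omega
    | cons q y ih =>
      have hd := dl_le k i
      have hp := (eps_phi_append k i y).2
      rcases step_cons_inv h with ⟨rfl, h1, rfl⟩ | ⟨w, h1, rfl, h2⟩
      · change WC.phi i (y ++ dn 0 k) = 0 at h1
        exact ⟨i :: y, step_cons_of_phi (by omega), rfl⟩
      · obtain ⟨y1, h3, rfl⟩ := ih h1
        refine ⟨q :: y1, step_cons_of_step h3 fun hq => ?_, rfl⟩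
        have h4 : 0 < WC.phi i (y ++ dn 0 k) := h2 hq
        have h5 := Crys.eps_pos_of_step h3
        omega
  eps := by
    rintro y y' rfl i
    exact (eps_phi_append k i y).1
  phi := by
    rintro y y' rfl i
    exact (eps_phi_append k i y).2
  left_unique := by
    rintro x y z rfl h
    exact List.append_cancel_right h
  right_unique := by
    rintro x y z rfl rfl
    rfl

theorem region_append {z0 cs y : List ℕ} (h : Region [] cs y) : Region z0 cs (y ++ z0) := by
  induction cs generalizing y with
  | nil => obtain rfl := h; rfl
  | cons c cs ih =>
    obtain ⟨q, b, rfl, h1, h2⟩ := h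
    exact ⟨q, b ++ z0, rfl, h1, ih h2⟩

theorem exists_of_region {z0 cs b : List ℕ} (h : Region z0 cs b) :
    ∃ y, b = y ++ z0 ∧ Region [] cs y := by
  induction cs generalizing b with
  | nil => exact ⟨[], h, rfl⟩
  | cons c cs ih =>
    obtain ⟨q, b, rfl, h1, h2⟩ := h
    obtain ⟨y, rfl, h3⟩ := ih h2
    exact ⟨q :: y, rfl, q, y, rfl, h1, h3⟩

end WC

namespace Crys
variable {X X' : Type} {K : Crys X} {K' : Crys X'}

/-- A subset of the component of `u` is empty or cut out by a word. -/
def DT (K : Crys X) (P : X → Prop) (u : X) : Prop :=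
  (∃ b, K.Reach b u ∧ P b) → ∃ l, ∀ b, K.Reach b u → (P b ↔ K.ups l b = u)

/-- Transfer of cut sets along an embedding of tensor type. -/
theorem DT.emb {k : ℕ} {T : X → X' → Prop} (E : Emb K K' (WC.dl k) T) {P : X → Prop}
    {Q : X' → Prop} (hPQ : ∀ {g f}, T g f → P g → Q f)
    (hQ : ∀ f, Q f → ∃ g, T g f ∧ P g) (hP : ∀ g, P g → ∃ f, T g f)
    (hT : ∀ {g f}, T g f → P g)
    (hfin : ∀ x, ∃ N, ∀ m, N ≤ m → K.phi m x = 0)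
    (h : ∀ u, K.IsHW u → K.DT P u) {u' : X'} (hu' : K'.IsHW u') : K'.DT Q u' := by
  rintro ⟨f0, hf0, hQ0⟩
  obtain ⟨g0, hT0, hP0⟩ := hQ f0 hQ0
  obtain ⟨u, hu, hgu⟩ := K.exists_hw g0
  obtain ⟨l, hl⟩ := h u hu ⟨g0, hgu, hP0⟩
  obtain ⟨cs, z, hcs, hz, c, hc⟩ := K.exists_region hu (hfin u) l
  obtain ⟨gu, hg, hTu⟩ := E.reach hf0 hT0
  have hgur : K.Reach gu u := Crys.reach_of_reach hu hgu hg
  obtain ⟨zu, hzu⟩ := c.exists_rel hgur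
  have hEW := WC.emb k
  have hw : WC.IsHW (zu ++ dn 0 k) := fun i => by
    rw [hEW.eps rfl, ← hzu.eps_eq, ← E.eps hTu, hu' i]
  have c' : Comp K' WC u' (zu ++ dn 0 k) := ⟨hu', hw, fun i => by
    rw [E.phi hTu, hEW.phi rfl, hzu.phi_eq, hzu.eps_eq]⟩
  have hreg : WC.Region (dn 0 k) cs (zu ++ dn 0 k) :=
    WC.region_append ((hc _ _ hzu).2 ((hl gu hgur).1 (hT hTu)))
  obtain ⟨l', -, hl'⟩ := WC.exists_cuts hcs hw hreg
  refine ⟨l', fun f hf => ?_⟩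
  obtain ⟨b, hb⟩ := c'.exists_rel hf
  rw [hb.ups_eq_iff l', ← hl' b hb.reach']
  constructor
  · intro hQf
    obtain ⟨g, hTf, hPg⟩ := hQ f hQf
    obtain ⟨gu', h1, h2⟩ := E.reach hf hTf
    obtain rfl := E.left_unique h2 hTu
    have hgr : K.Reach g u := h1.trans hgur
    obtain ⟨y, hy⟩ := c.exists_rel hgr
    have := E.rel hEW c c' hTu rfl hzu hf hTf rfl hy
    obtain rfl := hb.right_unique this
    exact WC.region_append ((hc _ _ hy).2 ((hl g hgr).1 hPg))
  · intro hreg'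
    obtain ⟨y, rfl, hy⟩ := WC.exists_of_region hreg'
    obtain ⟨zu', h1, h2⟩ := hEW.reach hb.reach' rfl
    obtain rfl := hEW.left_unique h2 rfl
    obtain ⟨g, hg'⟩ := c.exists_rel' (h1.trans hzu.reach')
    have hPg := (hl g hg'.reach).2 ((hc _ _ hg').1 hy)
    obtain ⟨f', hf'⟩ := hP g hPg
    have := hEW.rel E c.symm c'.symm rfl hTu (c.rel_symm hzu) hb.reach' rfl hf'
      (c.rel_symm hg')
    obtain rfl := hb.left_unique (c'.symm.rel_symm this)
    exact hPQ hf' hPg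

end Crys

theorem Model.phi_fin {X : Type} (M : Model X) (x : X) : ∃ N, ∀ m, N ≤ m → M.crys.phi m x = 0 := by
  obtain ⟨N, h⟩ := M.fin x
  refine ⟨N, fun m hm => ?_⟩
  change hPhi (M.blk x (m + 1)) (M.blk x m) = 0
  rw [h m hm, h (m + 1) (by omega)]
  have h1 := hPhi_add ∅ ∅
  have h2 := WC.eps_nil 0
  rw [WC.eps_def, show blkW [] 0 = ∅ by simp [blkW], show blkW [] (0 + 1) = ∅ by simp [blkW]] at h2
  rw [h2] at h1
  simpa using h1

/-! ### Threshold sets -/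

theorem le_of_ht_pos {A B : Finset ℤ} {c x : ℤ} (hA : ∀ a ∈ A, c ≤ a) (h : 0 < ht A B x) :
    c ≤ x := by
  by_contra hx
  have h1 : (∑ a ∈ A, if a ≤ x then (1 : ℤ) else 0) = 0 :=
    Finset.sum_eq_zero fun a ha => if_neg (by have := hA a ha; omega)
  have h2 : 0 ≤ ∑ b ∈ B, if b < x then (1 : ℤ) else 0 :=
    Finset.sum_nonneg fun b _ => by split_ifs <;> omega
  unfold ht at h
  omega

theorem hEps_insert_lower {A B : Finset ℤ} {c : ℤ} (hA : ∀ a ∈ A, c < a) (hc : c ∉ B) :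
    hEps A (insert c B) = hEps A B - 1 := by
  have hi := ht_insert_lower (A := A) hc
  have hle := ht_le_hEps A B
  rcases Nat.eq_zero_or_pos (hEps A B) with h0 | h0
  · obtain ⟨lo, hlo⟩ := exists_ht_eq_zero A (insert c B)
    have := hEps_eq_of (A := A) (B := insert c B) (n := 0) (fun x => by
      have h1 := hi x
      have h2 := hle x
      split_ifs at h1 <;> omega) ⟨lo, hlo lo le_rfl⟩
    omega
  · have := hEps_eq_of (A := A) (B := insert c B) (n := hEps A B - 1) (fun x => by
      have h1 := hi x
      have h2 := hle x
      by_cases hx : c < x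
      · rw [if_pos hx] at h1; omega
      · rw [if_neg hx] at h1
        have h3 : ¬ 0 < ht A B x := fun h => hx (le_of_ht_pos (c := c + 1)
          (fun a ha => hA a ha) h)
        omega) (by
      obtain ⟨x, hx⟩ := exists_ht_eq_hEps A B
      have h3 : c + 1 ≤ x := le_of_ht_pos (A := A) (B := B) (fun a ha => hA a ha) (by omega)
      have h1 := hi x
      rw [if_pos (by omega)] at h1
      exact ⟨x, by omega⟩)
    omega

theorem IsStep.insert_lower {A B : Finset ℤ} {c a r : ℤ} (h : IsStep A B a r)
    (hA : ∀ a ∈ A, c < a) (hc : c ∉ B) (hpos : 0 < hEps A (insert c B)) :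
    IsStep A (insert c B) a r := by
  have hi := ht_insert_lower (A := A) hc
  have hca := hA a h.mem_left
  have e := h.ht_eq
  have e2 := hEps_insert_lower hA hc
  have ha := hi a
  rw [if_pos hca] at ha
  have key : ∀ x, 0 < ht A (insert c B) x → ht A (insert c B) x = ht A B x - 1 := by
    intro x hx
    have h1 := hi x
    by_cases hcx : c < x
    · rwa [if_pos hcx] at h1
    · rw [if_neg hcx] at h1
      exact absurd (le_of_ht_pos (c := c + 1) (fun a ha => hA a ha)
        (show 0 < ht A B x by omega)) (by omega)
  refine ⟨h.le, h.memA, fun x h1 h2 => Finset.mem_insert_of_mem (h.memB x h1 h2), ?_,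
    h.succ_not_memA, by omega, fun x hx => ?_, fun x => ?_⟩
  · have := h.le
    simp only [Finset.mem_insert, not_or]
    exact ⟨by omega, h.not_memB⟩
  · have := h.lt x hx
    by_cases hp : 0 < ht A (insert c B) x
    · have := key x hp; omega
    · omega
  · have := h.max x
    by_cases hp : 0 < ht A (insert c B) x
    · have := key x hp; omega
    · omega

theorem ht_insert_both {A B : Finset ℤ} {c : ℤ} (hA : c + 1 ∉ A) (hc : c ∉ B) (x : ℤ) :
    ht (insert (c + 1) A) (insert c B) x = ht A B x := by
  rw [ht_insert_upper hA, ht_insert_lower hc]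
  split_ifs <;> omega

theorem hEps_congr {A B A' B' : Finset ℤ} (h : ∀ x, ht A B x = ht A' B' x) :
    hEps A B = hEps A' B' := by
  have := hEps_eq_of (A := A) (B := B) (n := hEps A' B') (fun x => by
    rw [h]; exact ht_le_hEps _ _ _) (by
    obtain ⟨x, hx⟩ := exists_ht_eq_hEps A' B'
    exact ⟨x, by rw [h, hx]⟩)
  omega

theorem IsStep.insert_both {A B : Finset ℤ} {c a r : ℤ} (h : IsStep A B a r) (hA : c + 1 ∉ A)
    (hc : c ∉ B) (hca : c + 1 < a) : IsStep (insert (c + 1) A) (insert c B) a r := by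
  have e := ht_insert_both hA hc
  have := h.le
  refine ⟨h.le, fun x h1 h2 => Finset.mem_insert_of_mem (h.memA x h1 h2),
    fun x h1 h2 => Finset.mem_insert_of_mem (h.memB x h1 h2), ?_, ?_, ?_, fun x hx => ?_,
    fun x => ?_⟩
  · simp only [Finset.mem_insert, not_or]
    exact ⟨by omega, h.not_memB⟩
  · simp only [Finset.mem_insert, not_or]
    exact ⟨by omega, h.succ_not_memA⟩
  · rw [e]; exact h.pos
  · rw [e, e]; exact h.lt x hx
  · rw [e, e]; exact h.max x

namespace RF
variable {w : Equiv.Perm ℕ}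

theorem exists_of_step {i : ℕ} {x y : RF w} (h : (RC w).step i x y) : ∃ a n : ℕ,
    IsStep (zi (x.val (i + 1))) (zi (x.val i)) a (a + n : ℕ) ∧
    y.val (i + 1) = (x.val (i + 1)).erase a ∧ y.val i = insert (a + n) (x.val i) ∧
    ∀ m, m ≠ i → m ≠ i + 1 → y.val m = x.val m := by
  obtain ⟨a, r, h1, h2, h3, h4⟩ := h
  obtain ⟨a, rfl, ha⟩ := exists_of_mem_zi h1.mem_left
  obtain ⟨n, rfl⟩ : ∃ n : ℕ, r = (a + n : ℕ) :=
    ⟨(r - a).toNat, by have := h1.le; push_cast; omega⟩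
  exact ⟨a, n, h1, zi_injective (h2.trans (zi_erase _ _).symm),
    zi_injective (h3.trans (zi_insert _ _).symm), fun m h5 h6 => zi_injective (h4 m h5 h6)⟩

theorem step_letters {i : ℕ} {x y : RF w} (h : (RC w).step i x y) (c : ℕ) :
    (∃ m, c ∈ x.val m) ↔ ∃ m, c ∈ y.val m := by
  obtain ⟨a, n, h1, h2, h3, h4⟩ := exists_of_step h
  constructor
  · rintro ⟨m, hm⟩
    by_cases e1 : m = i
    · subst e1
      exact ⟨m, by rw [h3]; exact Finset.mem_insert_of_mem hm⟩
    by_cases e2 : m = i + 1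
    · subst e2
      by_cases e3 : c = a
      · subst e3
        refine ⟨i, ?_⟩
        rw [h3]
        rcases Nat.eq_zero_or_pos n with rfl | hn
        · exact Finset.mem_insert_self _ _
        · exact Finset.mem_insert_of_mem (mem_zi.1 (h1.memB c le_rfl (by push_cast; omega)))
      · exact ⟨i + 1, by rw [h2]; exact Finset.mem_erase.2 ⟨e3, hm⟩⟩
    · exact ⟨m, by rwa [h4 m e1 e2]⟩
  · rintro ⟨m, hm⟩
    by_cases e1 : m = i
    · subst e1
      rw [h3] at hm
      rcases Finset.mem_insert.1 hm with rfl | hm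
      · exact ⟨m + 1, mem_zi.1 (h1.memA _ (by push_cast; omega) le_rfl)⟩
      · exact ⟨m, hm⟩
    by_cases e2 : m = i + 1
    · subst e2
      rw [h2] at hm
      exact ⟨i + 1, Finset.mem_of_mem_erase hm⟩
    · exact ⟨m, by rwa [← h4 m e1 e2]⟩

theorem reach_letters {x y : RF w} (h : (RC w).Reach x y) (c : ℕ) :
    (∃ m, c ∈ x.val m) ↔ ∃ m, c ∈ y.val m := by
  induction h with
  | refl => rfl
  | tail _ hs ih =>
    obtain ⟨i, hs⟩ := hs
    exact ih.trans (step_letters hs c)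

/-- The letters of block `m` are at least `t m`. -/
def Thr (t : ℕ → ℕ) (f : RF w) : Prop := ∀ m, ∀ x ∈ f.val m, t m ≤ x

theorem thr_step {t : ℕ → ℕ} (ht : Monotone t) {i : ℕ} {x y : RF w} (h : (RC w).step i x y)
    (hx : Thr t x) : Thr t y := by
  obtain ⟨a, n, h1, h2, h3, h4⟩ := exists_of_step h
  intro m c hc
  by_cases e1 : m = i
  · subst e1
    rw [h3] at hc
    rcases Finset.mem_insert.1 hc with rfl | hc
    · have := hx (m + 1) a (mem_zi.1 h1.mem_left)
      have := ht (show m ≤ m + 1 by omega)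
      omega
    · exact hx m c hc
  by_cases e2 : m = i + 1
  · subst e2
    rw [h2] at hc
    exact hx _ c (Finset.mem_of_mem_erase hc)
  · rw [h4 m e1 e2] at hc
    exact hx m c hc

theorem thr_of_step {t : ℕ → ℕ} {i : ℕ} (hi : t i = t (i + 1)) {x y : RF w}
    (h : (RC w).step i x y) (hy : Thr t y) : Thr t x := by
  obtain ⟨a, n, h1, h2, h3, h4⟩ := exists_of_step h
  have hB : ∀ c ∈ x.val i, t i ≤ c := fun c hc =>
    hy i c (by rw [h3]; exact Finset.mem_insert_of_mem hc)
  intro m c hc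
  by_cases e1 : m = i
  · subst e1
    exact hB c hc
  by_cases e2 : m = i + 1
  · subst e2
    by_cases e3 : c = a
    · subst e3
      rw [← hi]
      rcases Nat.eq_zero_or_pos n with rfl | hn
      · exact hy i _ (by rw [h3]; exact Finset.mem_insert_self _ _)
      · exact hB c (mem_zi.1 (h1.memB c le_rfl (by push_cast; omega)))
    · exact hy _ c (by rw [h2]; exact Finset.mem_erase.2 ⟨e3, hc⟩)
  · exact hy m c (by rwa [h4 m e1 e2])

theorem thr_raise {t : ℕ → ℕ} (ht : Monotone t) {i : ℕ} (hi : t i = t (i + 1)) (b : RF w) :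
    Thr t b ↔ Thr (Function.update t (i + 1) (t i + 1)) ((RC w).up i b) := by
  induction b using Crys.up_induction (K := RC w) (i := i) with
  | h0 y hy =>
    rw [Crys.up_of_eps hy]
    constructor
    · intro h m c hc
      by_cases e2 : m = i + 1
      · subst e2
        rw [Function.update_self]
        have h1 := h _ c hc
        by_contra hlt
        obtain rfl : c = t i := by omega
        have h2 := ht_le_hEps (zi (y.val (i + 1))) (zi (y.val i)) (t i)
        rw [show hEps (zi (y.val (i + 1))) (zi (y.val i)) = 0 from hy] at h2
        have h3 : (1 : ℤ) ≤ ∑ a ∈ zi (y.val (i + 1)), if a ≤ (t i : ℤ) then (1 : ℤ) else 0 := by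
          have := Finset.single_le_sum (f := fun a : ℤ => if a ≤ (t i : ℤ) then (1 : ℤ) else 0)
            (fun a _ => by split_ifs <;> omega) (mem_zi.2 hc)
          simpa using this
        have h4 : (∑ a ∈ zi (y.val i), if a < (t i : ℤ) then (1 : ℤ) else 0) = 0 :=
          Finset.sum_eq_zero fun a ha => by
            obtain ⟨n, rfl, hn⟩ := exists_of_mem_zi ha
            have := h i n hn
            rw [if_neg (by omega)]
        unfold _root_.ht at h2
        omega
      · rw [Function.update_of_ne e2]
        exact h m c hc
    · intro h m c hc
      have := h m c hc
      by_cases e2 : m = i + 1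
      · subst e2
        rw [Function.update_self] at this
        omega
      · rwa [Function.update_of_ne e2] at this
  | h1 x y hs ih =>
    rw [Crys.up_of_step hs, ← ih]
    exact ⟨thr_step ht hs, thr_of_step hi hs⟩

/-- If the raised threshold set is cut out by a word, so is the original one. -/
theorem dt_of_raise {t t' : ℕ → ℕ} (ht : Monotone t) {i : ℕ} (hi : t i = t (i + 1))
    (ht' : t' = Function.update t (i + 1) (t i + 1)) {u : RF w} (hu : (RC w).IsHW u)
    (h : (RC w).DT (Thr t') u) : (RC w).DT (Thr t) u := by
  subst ht'
  rintro ⟨b, hb, hP⟩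
  have hr : ∀ b, (RC w).Reach b u → (RC w).Reach ((RC w).up i b) u := fun b hb =>
    Crys.reach_of_reach hu hb (Crys.reach_up i b)
  obtain ⟨l, hl⟩ := h ⟨_, hr b hb, (thr_raise ht hi b).1 hP⟩
  exact ⟨i :: l, fun b hb => (thr_raise ht hi b).trans (hl _ (hr b hb))⟩

end RF

/-! ### Removing the first diagonal -/

theorem wordPerm_fix {l : List ℕ} {c : ℕ} (h : ∀ x ∈ l, x ≠ c ∧ x + 1 ≠ c) : wordPerm l c = c := by
  induction l with
  | nil => rfl
  | cons a l ih =>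
    rw [wordPerm_cons, Equiv.Perm.mul_apply, ih fun x hx => h x (List.mem_cons_of_mem _ hx)]
    have := h a (by simp)
    exact Equiv.swap_apply_of_ne_of_ne (Ne.symm this.1) (Ne.symm this.2)

theorem srt_insert_lt {A : Finset ℕ} {c : ℕ} (h : ∀ a ∈ A, c < a) :
    srt (insert c A) = c :: srt A := by
  apply srt_eq
  · rw [List.pairwise_cons]
    exact ⟨fun a ha => h a (mem_srt.1 ha), pairwise_srt A⟩
  · intro x
    rw [List.mem_cons, Finset.mem_insert, mem_srt]

theorem length_dn (p n : ℕ) : (dn p n).length = n := by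
  induction n with
  | zero => rfl
  | succ n ih => rw [dn, List.length_cons, ih]

namespace Diag

/-- Adjoin the diagonal letters `d + m` to the first `k` blocks. -/
def ins (d k : ℕ) (g : ℕ → Finset ℕ) (m : ℕ) : Finset ℕ :=
  if m < k then insert (d + m) (g m) else g m

/-- Remove the diagonal letters `d + m` from the first `k` blocks. -/
def del (d k : ℕ) (f : ℕ → Finset ℕ) (m : ℕ) : Finset ℕ :=
  if m < k then (f m).erase (d + m) else f m

/-- The thresholds of factorizations to which a diagonal of length `k` can be adjoined. -/
def thr (d k m : ℕ) : ℕ := if m ≤ k then d + m + 1 else d + m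

theorem thr_mono (d k : ℕ) : Monotone (thr d k) :=
  monotone_nat_of_le_succ fun m => by unfold thr; split_ifs <;> omega

theorem lt_of_thr {d k m x : ℕ} (hm : m < k) (h : thr d k m ≤ x) : d + m < x := by
  unfold thr at h
  rw [if_pos hm.le] at h
  omega

variable {d k : ℕ} {f g : ℕ → Finset ℕ}

theorem del_ins (hg : ∀ m, ∀ x ∈ g m, thr d k m ≤ x) : del d k (ins d k g) = g := by
  funext m
  unfold del ins
  split_ifs with h
  · exact Finset.erase_insert fun hx => absurd (lt_of_thr h (hg m _ hx)) (lt_irrefl _)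
  · rfl

theorem ins_del (hf : ∀ m < k, d + m ∈ f m) : ins d k (del d k f) = f := by
  funext m
  unfold ins
  simp only [del]
  split_ifs with h
  · exact Finset.insert_erase (hf m h)
  · rfl

theorem bd_ins {M : ℕ} (h : Bd g M) (hM : k ≤ M) : Bd (ins d k g) M := fun m hm => by
  rw [ins, if_neg (by omega)]; exact h m hm

theorem bd_del {M : ℕ} (h : Bd f M) : Bd (del d k f) M := fun m hm => by
  unfold del
  split_ifs
  · rw [h m hm]; rfl
  · exact h m hm

theorem wordPerm_add (hg : ∀ m, ∀ x ∈ g m, thr d k m ≤ x) (M : ℕ) :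
    wordPerm (wd (ins d k g) M) = wordPerm (dn d (min M k)) * wordPerm (wd g M) ∧
      (wd (ins d k g) M).length = min M k + (wd g M).length := by
  induction M with
  | zero => simp [wd, dn, wordPerm]
  | succ M ih =>
    have far : Commute (wordPerm (srt (g M))) (wordPerm (dn d (min M k))) := by
      apply wordPerm_far
      intro x hx y hy
      have h1 := hg M x (mem_srt.1 hx)
      have h2 := mem_dn.1 hy
      unfold thr at h1
      split_ifs at h1 <;> omega
    simp only [wd, wordPerm_append, List.length_append, ih.1, ih.2]
    by_cases hM : M < k
    · have e1 : ins d k g M = insert (d + M) (g M) := if_pos hM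
      rw [e1, srt_insert_lt fun a ha => lt_of_thr hM (hg M a ha),
        show min (M + 1) k = M + 1 by omega, show min M k = M by omega, dn, wordPerm_cons,
        wordPerm_cons]
      rw [show min M k = M by omega] at far
      constructor
      · rw [mul_assoc, ← mul_assoc (wordPerm (srt (g M))), far.eq]
        simp only [mul_assoc]
      · simp only [List.length_cons]; omega
    · have e1 : ins d k g M = g M := if_neg hM
      rw [e1, show min (M + 1) k = k by omega, show min M k = k by omega]
      rw [show min M k = k by omega] at far
      constructor
      · rw [← mul_assoc, far.eq, mul_assoc]
      · omega

/-- The initial diagonal can be read off from the permutation. -/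
theorem wordPerm_apply (hf : ∀ m, ∀ x ∈ f m, d + m ≤ x) (h1 : ∀ m < k, d + m ∈ f m)
    (h2 : d + k ∉ f k) (M : ℕ) : wordPerm (wd f M) d = d + min M k := by
  induction M with
  | zero => simp [wd, wordPerm]
  | succ M ih =>
    rw [wd, wordPerm_append, Equiv.Perm.mul_apply, ih]
    by_cases hM : M < k
    · have e : f M = insert (d + M) ((f M).erase (d + M)) := (Finset.insert_erase (h1 M hM)).symm
      have hlt : ∀ a ∈ (f M).erase (d + M), d + M < a := fun a ha => by
        have := hf M a (Finset.mem_of_mem_erase ha)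
        have := (Finset.mem_erase.1 ha).1
        omega
      rw [e, srt_insert_lt hlt, wordPerm_cons, Equiv.Perm.mul_apply, show min M k = M by omega,
        wordPerm_fix fun x hx => by have := hlt x (mem_srt.1 hx); omega,
        show min (M + 1) k = M + 1 by omega]
      exact Equiv.swap_apply_left _ _
    · rw [show min (M + 1) k = k by omega, show min M k = k by omega]
      apply wordPerm_fix
      intro x hx
      have h3 := hf M x (mem_srt.1 hx)
      have : x ≠ d + k := by
        rintro rfl
        obtain rfl : M = k := by omega
        exact h2 (mem_srt.1 hx)
      omega

theorem exists_diag (d : ℕ) {w : Equiv.Perm ℕ} (f : RF w) :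
    ∃ k, (∀ m < k, d + m ∈ f.val m) ∧ d + k ∉ f.val k := by
  have h : ∃ k, d + k ∉ f.val k := by
    obtain ⟨M, hM, -⟩ := f.isRF
    exact ⟨M, by rw [hM M le_rfl]; exact Finset.notMem_empty _⟩
  exact ⟨Nat.find h, fun m hm => by simpa using Nat.find_min h hm, Nat.find_spec h⟩

theorem diag_eq {w : Equiv.Perm ℕ} {f : RF w} (hf : RF.Thr (d + ·) f)
    (h1 : ∀ m < k, d + m ∈ f.val m) (h2 : d + k ∉ f.val k) : w d = d + k := by
  obtain ⟨M, hM, -⟩ := id f.isRF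
  have h3 := f.isRF.red (hM.mono (show M ≤ M + k by omega))
  have := wordPerm_apply hf h1 h2 (M + k)
  rw [h3.2] at this
  rw [this]; omega

theorem thr_del {w : Equiv.Perm ℕ} {f : RF w} (hf : RF.Thr (d + ·) f) (h2 : d + k ∉ f.val k)
    (m : ℕ) : ∀ x ∈ del d k f.val m, thr d k m ≤ x := by
  intro x hx
  unfold del at hx
  unfold thr
  split_ifs at hx with h
  · have h3 : d + m ≤ x := hf m x (Finset.mem_of_mem_erase hx)
    have := (Finset.mem_erase.1 hx).1
    rw [if_pos h.le]
    omega
  · have h3 : d + m ≤ x := hf m x hx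
    split_ifs with h4
    · obtain rfl : m = k := by omega
      have : x ≠ d + m := fun e => h2 (e ▸ hx)
      omega
    · exact h3

theorem posWord_dn (hd : 1 ≤ d) : PosWord (dn d k) := fun x hx => by
  have := mem_dn.1 hx; omega

variable {w v : Equiv.Perm ℕ}

theorem isRF_del (hd : 1 ≤ d) (hw : w = wordPerm (dn d k) * v) {f : RF w}
    (hf : RF.Thr (d + ·) f)
    (h1 : ∀ m < k, d + m ∈ f.val m) (h2 : d + k ∉ f.val k) : IsRF v (del d k f.val) := by
  obtain ⟨M, hM, -⟩ := id f.isRF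
  have hM' := hM.mono (show M ≤ M + k by omega)
  have h3 := f.isRF.red hM'
  have h4 := wordPerm_add (thr_del hf h2) (M + k)
  rw [ins_del h1, h3.2, show min (M + k) k = k by omega] at h4
  have h5 := mul_left_cancel (hw.symm.trans h4.1)
  refine ⟨M + k, bd_del hM', ⟨?_, fun σ hσ hσw => ?_⟩, h5.symm⟩
  · intro x hx
    obtain ⟨m, -, hx⟩ := mem_wd.1 hx
    refine f.isRF.pos (m := m) ?_
    unfold del at hx
    split_ifs at hx
    · exact Finset.mem_of_mem_erase hx
    · exact hx
  · have h6 := h3.le (l' := dn d k ++ σ) (fun x hx => by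
      rcases List.mem_append.1 hx with hx | hx
      · exact posWord_dn hd x hx
      · exact hσ x hx) (by rw [wordPerm_append, hσw, ← h5, ← hw])
    rw [List.length_append, length_dn, h4.2] at h6
    omega

theorem isRF_ins (hd : 1 ≤ d) (hw : w = wordPerm (dn d k) * v) {f0 : RF w}
    (hf : RF.Thr (d + ·) f0) (h1 : ∀ m < k, d + m ∈ f0.val m) (h2 : d + k ∉ f0.val k)
    {g : RF v} (hg : RF.Thr (thr d k) g) : IsRF w (ins d k g.val) := by
  have hg0 := isRF_del hd hw hf h1 h2
  obtain ⟨M0, hM0, -⟩ := id f0.isRF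
  obtain ⟨M1, hM1, -⟩ := id g.isRF
  have hM0' := hM0.mono (show M0 ≤ M0 + M1 + k by omega)
  have hM1' := hM1.mono (show M1 ≤ M0 + M1 + k by omega)
  set M := M0 + M1 + k
  have h3 := f0.isRF.red hM0'
  have h4 := wordPerm_add (thr_del hf h2) M
  rw [ins_del h1, show min M k = k by omega] at h4
  have h5 := wordPerm_add hg M
  have h6 := g.isRF.red hM1'
  have h7 := hg0.red (bd_del hM0')
  rw [show min M k = k by omega, h6.2] at h5
  refine ⟨M, bd_ins hM1' (by omega), h3.of_le ?_ ?_ ?_⟩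
  · intro x hx
    obtain ⟨m, -, hx⟩ := mem_wd.1 hx
    unfold ins at hx
    split_ifs at hx
    · rcases Finset.mem_insert.1 hx with hx | hx
      · omega
      · exact g.isRF.pos hx
    · exact g.isRF.pos hx
  · rw [h5.1, ← hw]
  · have := h6.le h7.1.1 h7.2
    omega

/-- Adjoining a diagonal as a relation between two crystals. -/
def T (d k : ℕ) (g : RF v) (f : RF w) : Prop := RF.Thr (thr d k) g ∧ f.val = ins d k g.val

theorem T.blocks {g : RF v} {f : RF w} (h : T d k g f) (i : ℕ) :
    (RC w).eps i f = (RC v).eps i g - WC.dl k i ∧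
      (f.val (i + 1)).card + (g.val i).card + WC.dl k i =
        (g.val (i + 1)).card + (f.val i).card ∧
      ∀ a n : ℕ, IsStep (zi (g.val (i + 1))) (zi (g.val i)) a (a + n : ℕ) →
        0 < (RC w).eps i f → IsStep (zi (f.val (i + 1))) (zi (f.val i)) a (a + n : ℕ) := by
  obtain ⟨hg, hf⟩ := h
  change hEps (zi (f.val (i + 1))) (zi (f.val i)) =
    hEps (zi (g.val (i + 1))) (zi (g.val i)) - WC.dl k i ∧ _ ∧ ∀ a n : ℕ, _ →
    0 < hEps (zi (f.val (i + 1))) (zi (f.val i)) → _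
  rw [hf]
  by_cases h1 : i + 1 < k
  · have e1 : ins d k g.val i = insert (d + i) (g.val i) := if_pos (by omega)
    have e2 : ins d k g.val (i + 1) = insert (d + i + 1) (g.val (i + 1)) := if_pos h1
    have n1 : d + i ∉ g.val i := fun hx => lt_irrefl _ (lt_of_thr (by omega) (hg i _ hx))
    have n2 : d + i + 1 ∉ g.val (i + 1) := fun hx => lt_irrefl _ (lt_of_thr h1 (hg _ _ hx))
    have e3 : WC.dl k i = 0 := if_neg (by omega)
    have m1 : ((d + i : ℕ) : ℤ) ∉ zi (g.val i) := fun hx => n1 (mem_zi.1 hx)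
    have m2 : ((d + i : ℕ) : ℤ) + 1 ∉ zi (g.val (i + 1)) := fun hx => n2 (mem_zi.1 (by
      push_cast at hx ⊢; exact hx))
    rw [e1, e2, e3, Finset.card_insert_of_notMem n1, Finset.card_insert_of_notMem n2, zi_insert,
      zi_insert, Nat.cast_succ]
    refine ⟨hEps_congr (ht_insert_both m2 m1), by omega, fun a n hs _ =>
      hs.insert_both m2 m1 ?_⟩
    have := lt_of_thr h1 (hg _ _ (mem_zi.1 hs.mem_left))
    push_cast
    omega
  · have e2 : ins d k g.val (i + 1) = g.val (i + 1) := if_neg h1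
    rw [e2]
    by_cases h2 : i + 1 = k
    · have e1 : ins d k g.val i = insert (d + i) (g.val i) := if_pos (by omega)
      have n1 : d + i ∉ g.val i := fun hx => lt_irrefl _ (lt_of_thr (by omega) (hg i _ hx))
      have e3 : WC.dl k i = 1 := if_pos h2
      have m1 : ((d + i : ℕ) : ℤ) ∉ zi (g.val i) := fun hx => n1 (mem_zi.1 hx)
      have hA : ∀ a ∈ zi (g.val (i + 1)), ((d + i : ℕ) : ℤ) < a := fun a ha => by
        obtain ⟨n, rfl, hn⟩ := exists_of_mem_zi ha
        have := hg _ n hn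
        unfold thr at this
        rw [if_pos (by omega)] at this
        omega
      rw [e1, e3, Finset.card_insert_of_notMem n1, zi_insert]
      exact ⟨hEps_insert_lower hA m1, by omega, fun a n hs hp => hs.insert_lower hA m1 hp⟩
    · have e1 : ins d k g.val i = g.val i := if_neg (by omega)
      have e3 : WC.dl k i = 0 := if_neg h2
      rw [e1, e3]
      exact ⟨rfl, by omega, fun a n hs _ => hs⟩

theorem T.step {g : RF v} {f f' : RF w} {i : ℕ} (h : T d k g f) (hs : (RC w).step i f f') :
    ∃ g', (RC v).step i g g' ∧ T d k g' f' := by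
  have hb := h.blocks i
  have hp := Crys.eps_pos_of_step hs
  obtain ⟨g', hg'⟩ := (RC v).exists_step (i := i) (x := g) (by have := hb.1; omega)
  refine ⟨g', hg', RF.thr_step (thr_mono d k) hg' h.1, ?_⟩
  obtain ⟨a, n, s1, s2, s3, s4⟩ := RF.exists_of_step hg'
  obtain ⟨a', n', t1, t2, t3, t4⟩ := RF.exists_of_step hs
  have hu := (hb.2.2 a n s1 hp).unique t1
  obtain rfl : a = a' := by exact_mod_cast hu.1
  obtain rfl : n = n' := by have := hu.2; push_cast at this; omega
  have ha := mem_zi.1 s1.mem_left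
  funext m
  have hfm : ∀ m, f.val m = ins d k g.val m := fun m => congrFun h.2 m
  by_cases e1 : m = i
  · subst e1
    rw [t3, hfm, ins, ins, s3]
    split_ifs
    · exact Finset.insert_comm _ _ _
    · rfl
  by_cases e2 : m = i + 1
  · subst e2
    rw [t2, hfm, ins, ins, s2]
    split_ifs with hk
    · have := lt_of_thr hk (h.1 _ _ ha)
      exact Finset.erase_insert_of_ne (by omega)
    · rfl
  · rw [t4 m e1 e2, hfm, ins, ins, s4 m e1 e2]

theorem emb : Emb (RC v) (RC w) (WC.dl k) (T d k) where
  step h hs := h.step hs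
  eps h i := (h.blocks i).1
  phi := by
    intro g f h i
    have h1 := h.blocks i
    have h2 : (RC w).phi i f + (zi (f.val (i + 1))).card = (RC w).eps i f + (zi (f.val i)).card :=
      hPhi_add _ _
    have h3 : (RC v).phi i g + (zi (g.val (i + 1))).card = (RC v).eps i g + (zi (g.val i)).card :=
      hPhi_add _ _
    simp only [zi, Finset.card_map] at h2 h3
    omega
  left_unique := by
    rintro x y f ⟨h1, h2⟩ ⟨h3, h4⟩
    apply RF.ext
    rw [← del_ins h1, ← del_ins h3, ← h2, ← h4]
  right_unique := by
    rintro g x y ⟨-, h2⟩ ⟨-, h4⟩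
    exact RF.ext (h2.trans h4.symm)

end Diag

namespace RF

/-- Raising thresholds along a diagonal. -/
theorem dt_diag {v : Equiv.Perm ℕ} {d k : ℕ} {u : RF v} (hu : (RC v).IsHW u)
    (h : (RC v).DT (Thr (d + 1 + ·)) u) : (RC v).DT (Thr (Diag.thr d k)) u := by
  obtain ⟨P, hP⟩ : ∃ P, ∀ m, ∀ c ∈ u.val m, c < P := by
    obtain ⟨M, hM, -⟩ := u.isRF
    refine ⟨(wd u.val M).sum + 1, fun m c hc => ?_⟩
    have hm : m < M := by
      by_contra hm
      rw [hM m (by omega)] at hc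
      exact absurd hc (Finset.notMem_empty c)
    exact Nat.lt_succ_of_le (List.le_sum_of_mem (mem_wd.2 ⟨m, hm, hc⟩))
  have key : ∀ q, (RC v).DT (Thr (Diag.thr d (k + q))) u → (RC v).DT (Thr (Diag.thr d k)) u := by
    intro q
    induction q with
    | zero => exact id
    | succ q ih =>
      refine fun hq => ih (dt_of_raise (i := k + q) (Diag.thr_mono d _) ?_ ?_ hu hq)
      · unfold Diag.thr; split_ifs <;> omega
      · funext m
        unfold Diag.thr
        by_cases hm : m = k + q + 1
        · subst hm
          rw [Function.update_self]
          split_ifs <;> omega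
        · rw [Function.update_of_ne hm]
          split_ifs <;> omega
  apply key P
  have e : ∀ b, (RC v).Reach b u → (Thr (Diag.thr d (k + P)) b ↔ Thr (d + 1 + ·) b) := by
    intro b hb
    have hl : ∀ m, ∀ c ∈ b.val m, c < P := fun m c hc => by
      obtain ⟨m', hm'⟩ := (reach_letters hb c).1 ⟨m, hc⟩
      exact hP m' c hm'
    refine forall_congr' fun m => forall_congr' fun c => forall_congr' fun hc => ?_
    have := hl m c hc
    unfold Diag.thr
    dsimp only
    split_ifs <;> omega
  rintro ⟨b, hb, hb'⟩
  obtain ⟨l, hl⟩ := h ⟨b, hb, (e b hb).1 hb'⟩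
  exact ⟨l, fun b hb => (e b hb).trans (hl b hb)⟩

/-- The sets cut out by the standard thresholds are cut out by words. -/
theorem dt_standard {N : ℕ} (j : ℕ) : ∀ {d : ℕ} {w : Equiv.Perm ℕ}, 1 ≤ d → N ≤ d + j →
    (∀ x < d, w x = x) → (∀ x, N ≤ x → w x = x) → ∀ {u : RF w}, (RC w).IsHW u →
    (RC w).DT (Thr (d + ·)) u := by
  induction j with
  | zero =>
    intro d w hd hN h1 h2 u hu _
    have hw : w = 1 := by
      ext x
      rcases lt_or_ge x d with h | h
      · exact h1 x h
      · exact h2 x (by omega)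
    have hf : ∀ f : RF w, f.val = fun _ => ∅ := by
      intro f
      obtain ⟨M, hM, hr⟩ := id f.isRF
      have h3 := hr.le (l' := []) (by intro x hx; simp at hx) (by rw [hw]; rfl)
      have h4 : wd f.val M = [] := List.length_eq_zero_iff.1 (by simpa using h3)
      funext m
      by_contra hne
      obtain ⟨c, hc⟩ := Finset.nonempty_iff_ne_empty.2 hne
      have : c ∈ wd f.val M := mem_wd.2 ⟨m, by
        by_contra hm
        rw [hM m (by omega)] at hc
        exact absurd hc (Finset.notMem_empty c), hc⟩
      rw [h4] at this
      simp at this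
    refine ⟨[], fun b _ => ⟨fun _ => RF.ext ((hf b).trans (hf u).symm), fun _ m x hx => ?_⟩⟩
    rw [hf b] at hx
    simp at hx
  | succ j ih =>
    intro d w hd hN h1 h2 u hu hex
    obtain ⟨f0, -, hf0⟩ := id hex
    obtain ⟨k, hk1, hk2⟩ := Diag.exists_diag d f0
    have hwd := Diag.diag_eq hf0 hk1 hk2
    obtain ⟨v, hv⟩ : ∃ v, w = wordPerm (dn d k) * v :=
      ⟨(wordPerm (dn d k))⁻¹ * w, by rw [mul_inv_cancel_left]⟩
    have hg0 := Diag.isRF_del hd hv hf0 hk1 hk2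
    have hv1 : ∀ x < d + 1, v x = x := by
      intro x hx
      obtain ⟨M, hM, hr⟩ := hg0
      rw [← hr.2]
      apply wordPerm_fix
      intro c hc
      obtain ⟨m, -, hc⟩ := mem_wd.1 hc
      have := Diag.thr_del hf0 hk2 m c hc
      unfold Diag.thr at this
      split_ifs at this <;> omega
    have hv2 : ∀ x, N ≤ x → v x = x := by
      intro x hx
      have h3 : wordPerm (dn d k) x = x := by
        apply wordPerm_fix
        intro c hc
        have h4 := mem_dn.1 hc
        have h5 : d + k < N := by
          by_contra h5
          have := h2 (d + k) (by omega)
          rw [← hwd] at this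
          have := w.injective this
          omega
        omega
      have h4 := h2 x hx
      rw [hv, Equiv.Perm.mul_apply] at h4
      exact (wordPerm (dn d k)).injective (h4.trans h3.symm)
    refine Crys.DT.emb (K := RC v) (P := Thr (Diag.thr d k)) (T := Diag.T d k) Diag.emb ?_ ?_ ?_
      (fun h => h.1) (rfModel v).phi_fin ?_ hu hex
    · rintro g f ⟨-, hf⟩ hg m x hx
      rw [hf] at hx
      unfold Diag.ins at hx
      have h3 : ∀ y ∈ g.val m, d + m ≤ y := fun y hy => by
        have := hg m y hy
        unfold Diag.thr at this
        split_ifs at this <;> omega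
      split_ifs at hx
      · rcases Finset.mem_insert.1 hx with hx | hx
        · exact hx.ge
        · exact h3 x hx
      · exact h3 x hx
    · intro f hf
      obtain ⟨k', h3, h4⟩ := Diag.exists_diag d f
      have h5 := Diag.diag_eq hf h3 h4
      obtain rfl : k' = k := by omega
      have h6 := Diag.thr_del hf h4
      exact ⟨⟨_, Diag.isRF_del hd hv hf h3 h4⟩, ⟨h6, (Diag.ins_del h3).symm⟩, h6⟩
    · intro g hg
      exact ⟨⟨_, Diag.isRF_ins hd hv hf0 hk1 hk2 hg⟩, hg, rfl⟩
    · intro u hu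
      exact dt_diag hu (ih (by omega) (by omega) hv1 hv2 hu)

/-- Threshold sets between the constant and the standard thresholds are cut out by words. -/
theorem dt_thr {w : Equiv.Perm ℕ} (hw : FinitaryPerm w) {n : ℕ} {u : RF w} (hu : (RC w).IsHW u)
    {t : ℕ → ℕ} (ht : Monotone t) (h0 : 1 ≤ t 0) (hle : ∀ m, t m ≤ m + 1)
    (hn : ∀ m, n ≤ m → t m = m + 1) : (RC w).DT (Thr t) u := by
  obtain ⟨s, hs⟩ : ∃ s, s = ∑ m ∈ Finset.range n, (m + 1 - t m) := ⟨_, rfl⟩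
  induction s using Nat.strong_induction_on generalizing t with
  | _ s ih =>
    by_cases hid : ∀ m, t m = m + 1
    · have e : t = (1 + ·) := funext fun m => by rw [hid m, add_comm]
      obtain ⟨N, hN⟩ : ∃ N, ∀ x, N ≤ x → w x = x := by
        obtain ⟨N, hN⟩ := hw.2.bddAbove
        refine ⟨N + 1, fun x hx => ?_⟩
        by_contra hne
        have := hN hne
        omega
      rw [e]
      refine dt_standard (N := N) N le_rfl (by omega) (fun x hx => ?_) hN hu
      obtain rfl : x = 0 := by omega
      exact hw.1
    · push Not at hid
      obtain ⟨m0, hm0⟩ := hid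
      obtain ⟨j, hj1, hj2⟩ : ∃ j, t j = t (j + 1) ∧ ∀ m, j < m → t m ≠ t (m + 1) := by
        have hex : ∃ j, t j = t (j + 1) ∧ j ≤ n := by
          by_contra! hne
          have h1 : ∀ m, m + 1 ≤ t m := by
            intro m
            induction m with
            | zero => exact h0
            | succ m ihm =>
              rcases Nat.lt_or_ge n m with h | h
              · rw [hn (m + 1) (by omega)]
              · have h2 := ht (show m ≤ m + 1 by omega)
                have h3 : t m ≠ t (m + 1) := fun e => absurd (hne m e) (by omega)
                omega
          have := h1 m0
          have := hle m0
          omega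
        obtain ⟨j0, hj0, hj0n⟩ := hex
        refine ⟨Nat.findGreatest (fun j => t j = t (j + 1)) n,
          Nat.findGreatest_spec (P := fun j => t j = t (j + 1)) hj0n hj0, fun m hm => ?_⟩
        rcases Nat.lt_or_ge n m with h | h
        · rw [hn m (by omega), hn (m + 1) (by omega)]
          omega
        · exact Nat.findGreatest_is_greatest (P := fun j => t j = t (j + 1)) hm h
      have hjn : j + 1 < n := by
        by_contra h
        have h1 := hn (j + 1) (by omega)
        have h2 := hle j
        omega
      refine dt_of_raise ht hj1 rfl hu (ih _ ?_ ?_ ?_ ?_ ?_ rfl)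
      · rw [hs]
        apply Finset.sum_lt_sum
        · intro m _
          by_cases e : m = j + 1
          · subst e
            rw [Function.update_self]
            omega
          · rw [Function.update_of_ne e]
        · refine ⟨j + 1, Finset.mem_range.2 hjn, ?_⟩
          rw [Function.update_self]
          have := hle j
          omega
      · apply monotone_nat_of_le_succ
        intro m
        have h1 := ht (show m ≤ m + 1 by omega)
        by_cases e : m = j + 1
        · subst e
          have h2 := hj2 (j + 1) (by omega)
          rw [Function.update_self, Function.update_of_ne (by omega)]
          omega
        · rw [Function.update_of_ne e]
          by_cases e' : m + 1 = j + 1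
          · rw [e', Function.update_self]
            rw [show m = j by omega]
            omega
          · rwa [Function.update_of_ne e']
      · rwa [Function.update_of_ne (by omega)]
      · intro m
        by_cases e : m = j + 1
        · subst e
          rw [Function.update_self]
          have := hle j
          omega
        · rw [Function.update_of_ne e]
          exact hle m
      · intro m hm
        rw [Function.update_of_ne (by omega)]
        exact hn m hm

end RF

/-! ### Normal forms are reduced words -/

/-- The set of inversions of a permutation. -/
def invSet (w : Equiv.Perm ℕ) : Set (ℕ × ℕ) := {p | p.1 < p.2 ∧ w p.2 < w p.1}

theorem sPerm_lt {a x y : ℕ} (h : x < y) (hne : ¬ (x = a ∧ y = a + 1)) :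
    sPerm a x < sPerm a y := by
  simp only [sPerm, Equiv.swap_apply_def]
  split_ifs <;> omega

theorem sPerm_sPerm (a x : ℕ) : sPerm a (sPerm a x) = x := Equiv.swap_apply_self _ _ _

theorem encard_invSet_mul_le (w : Equiv.Perm ℕ) (a : ℕ) :
    (invSet (w * sPerm a)).encard ≤ (invSet w).encard + 1 := by
  have hsub : invSet (w * sPerm a) ⊆
      insert (a, a + 1) (Prod.map (sPerm a) (sPerm a) '' invSet w) := by
    rintro ⟨x, y⟩ ⟨hlt, hinv⟩
    by_cases hne : x = a ∧ y = a + 1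
    · left; rw [hne.1, hne.2]
    · right
      refine ⟨(sPerm a x, sPerm a y), ⟨sPerm_lt hlt hne, hinv⟩, ?_⟩
      simp [sPerm_sPerm]
  exact (Set.encard_le_encard hsub).trans
    ((Set.encard_insert_le _ _).trans (add_le_add (Set.encard_image_le _ _) le_rfl))

theorem le_encard_invSet_mul {w : Equiv.Perm ℕ} {a : ℕ} (h : w a < w (a + 1)) :
    (invSet w).encard + 1 ≤ (invSet (w * sPerm a)).encard := by
  have hinj : Function.Injective (Prod.map (sPerm a) (sPerm a)) :=
    (sPerm a).injective.prodMap (sPerm a).injective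
  have hsa : sPerm a a = a + 1 := Equiv.swap_apply_left _ _
  have hsa' : sPerm a (a + 1) = a := Equiv.swap_apply_right _ _
  have hnot : (a, a + 1) ∉ Prod.map (sPerm a) (sPerm a) '' invSet w := by
    rintro ⟨⟨x, y⟩, ⟨hlt, -⟩, he⟩
    rw [Prod.map_apply, Prod.mk.injEq] at he
    have hx := sPerm_sPerm a x
    have hy := sPerm_sPerm a y
    rw [he.1, hsa] at hx
    rw [he.2, hsa'] at hy
    dsimp only at hlt
    omega
  have hsub : insert (a, a + 1) (Prod.map (sPerm a) (sPerm a) '' invSet w) ⊆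
      invSet (w * sPerm a) := by
    rintro p (rfl | ⟨⟨x, y⟩, ⟨hlt, hinv⟩, rfl⟩)
    · refine ⟨Nat.lt_succ_self a, ?_⟩
      simpa [hsa, hsa'] using h
    · dsimp only at hlt hinv
      refine ⟨sPerm_lt hlt ?_, ?_⟩
      · rintro ⟨rfl, rfl⟩
        exact absurd hinv h.not_gt
      · simpa [sPerm_sPerm] using hinv
  rw [← hinj.encard_image (invSet w), ← Set.encard_insert_of_notMem hnot]
  exact Set.encard_le_encard hsub

theorem encard_invSet_wordPerm_le (l : List ℕ) : (invSet (wordPerm l)).encard ≤ l.length := by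
  induction l using List.reverseRecOn with
  | nil =>
    have : invSet (wordPerm []) = ∅ := by
      ext ⟨x, y⟩
      simp only [invSet, wordPerm_nil, Set.mem_ofPred_eq, Equiv.Perm.coe_one, id,
        Set.mem_empty_iff_false, iff_false]
      omega
    simp [this]
  | append_singleton l a ih =>
    rw [wordPerm_append, wordPerm_singleton, List.length_append]
    push_cast
    exact (encard_invSet_mul_le _ a).trans (add_le_add ih (by simp))

/-- Words whose length is at most the number of inversions of their permutation. -/
def Tight (l : List ℕ) : Prop := (l.length : ℕ∞) ≤ (invSet (wordPerm l)).encard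

theorem Tight.isReducedWord {l : List ℕ} (h : Tight l) (hp : PosWord l) : IsReducedWord l :=
  ⟨hp, fun σ _ he => by
    have := h.trans (he ▸ encard_invSet_wordPerm_le σ)
    exact_mod_cast this⟩

theorem Tight.append_dn {l : List ℕ} {j : ℕ} (h : Tight l) (hl : ∀ x ∈ l, x ≤ j) (m : ℕ) :
    ∀ a, a + m = j + 2 → Tight (l ++ dn a m) ∧ wordPerm (l ++ dn a m) a = j + 2 ∧
      ∀ x < a, wordPerm (l ++ dn a m) x < j + 2 := by
  induction m with
  | zero =>
    intro a ha
    obtain rfl : a = j + 2 := ha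
    have hfix : ∀ y, j + 2 ≤ y → wordPerm l y = y := fun y hy =>
      wordPerm_fix fun x hx => by have := hl x hx; omega
    rw [dn, List.append_nil]
    refine ⟨h, hfix _ le_rfl, fun x hx => ?_⟩
    by_contra! hc
    have := (wordPerm l).injective (hfix _ hc)
    omega
  | succ m ih =>
    intro a ha
    obtain ⟨h1, h2, h3⟩ := ih (a + 1) (by omega)
    rw [dn_succ', ← List.append_assoc, wordPerm_append, wordPerm_singleton]
    refine ⟨?_, ?_, fun x hx => ?_⟩
    · have := le_encard_invSet_mul (w := wordPerm (l ++ dn (a + 1) m)) (a := a)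
        (by rw [h2]; exact h3 a (Nat.lt_succ_self a))
      unfold Tight
      rw [wordPerm_append _ [a], wordPerm_singleton, List.length_append]
      refine le_trans ?_ this
      push_cast
      exact add_le_add h1 (by simp)
    · rw [Equiv.Perm.mul_apply, sPerm, Equiv.swap_apply_left, h2]
    · rw [Equiv.Perm.mul_apply, sPerm, Equiv.swap_apply_of_ne_of_ne (by omega) (by omega)]
      exact h3 x (by omega)

theorem map_succ_dn (p n : ℕ) : (dn p n).map (· + 1) = dn (p + 1) n := by
  induction n with
  | zero => rfl
  | succ n ih => rw [dn, List.map_cons, ih, dn]; congr 1; omega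

theorem NF.tight {j : ℕ} {l : List ℕ} (h : NF j l) : Tight (l.map (· + 1)) := by
  induction h with
  | nil => simp [Tight]
  | @snoc j a l h ha ih =>
    rw [List.map_append, map_succ_dn]
    refine (ih.append_dn (j := j) (fun x hx => ?_) _ _ (by omega)).1
    obtain ⟨y, hy, rfl⟩ := List.mem_map.1 hx
    exact h.lt y hy

theorem NF.isReducedWord {j : ℕ} {l : List ℕ} (h : NF j l) : IsReducedWord (l.map (· + 1)) :=
  h.tight.isReducedWord fun x hx => by
    obtain ⟨y, -, rfl⟩ := List.mem_map.1 hx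
    omega

/-! ### Factorizations into lists -/

/-- The factorization into lists given by a sequence of finite sets. -/
def toF (f : ℕ → Finset ℕ) : ℕ → List ℕ
  | 0 => []
  | m + 1 => srt (f m)

theorem srt_injective : Function.Injective srt := fun A B h => by
  ext x
  rw [← mem_srt, h, mem_srt]

theorem srt_eq_nil {A : Finset ℕ} : srt A = [] ↔ A = ∅ := by
  rw [← srt_empty, srt_injective.eq_iff]

theorem toF_injective : Function.Injective toF := fun f g h => by
  funext m
  exact srt_injective (congrFun h (m + 1))

theorem toF_eq_of {F : ℕ → List ℕ} (h0 : F 0 = []) (hinc : IncreasingFact F) :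
    toF (fun m => (F (m + 1)).toFinset) = F := by
  funext m
  cases m with
  | zero => exact h0.symm
  | succ m => exact srt_eq (List.isChain_iff_pairwise.1 (hinc (m + 1))) fun x => by simp

theorem increasingFact_toF (f : ℕ → Finset ℕ) : IncreasingFact (toF f) := fun m => by
  cases m with
  | zero => exact List.isChain_nil
  | succ m => exact List.isChain_iff_pairwise.2 (pairwise_srt _)

/-- The concatenation of the blocks with index less than `K`. -/
def catF (F : ℕ → List ℕ) (K : ℕ) : List ℕ := ((List.range K).reverse.map F).foldr (· ++ ·) []

theorem catF_succ (F : ℕ → List ℕ) (K : ℕ) : catF F (K + 1) = F K ++ catF F K := by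
  simp [catF, List.range_succ]

theorem catF_eq {F : ℕ → List ℕ} {K K' : ℕ} (hK : K ≤ K') (h : ∀ j, K ≤ j → F j = []) :
    catF F K' = catF F K := by
  induction hK with
  | refl => rfl
  | step hm ih => rw [catF_succ, h _ hm, List.nil_append, ih]

theorem factWord_eq {F : ℕ → List ℕ} {M : ℕ} (h : ∀ j, M < j → F j = []) :
    factWord F = catF F (M + 1) := by
  have hb : ∀ i ∈ {i | F i ≠ []}, i ≤ M := fun i hi => by
    by_contra! hc
    exact hi (h i hc)
  have h1 : factWord F = catF F (topIdx F + 1) := by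
    simp [factWord, factWordGe, catF]
  have h2 : topIdx F ≤ M := by
    rcases Set.eq_empty_or_nonempty {i | F i ≠ []} with he | he
    · simp [topIdx, he]
    · exact csSup_le he hb
  rw [h1]
  refine (catF_eq (by omega) fun j hj => ?_).symm
  by_contra hc
  have : j ≤ topIdx F := le_csSup ⟨M, hb⟩ hc
  omega

theorem factWord_toF {f : ℕ → Finset ℕ} {M : ℕ} (h : Bd f M) : factWord (toF f) = wd f M := by
  rw [factWord_eq (M := M)]
  · clear h
    induction M with
    | zero => rfl
    | succ M ih => rw [catF_succ, ih]; rfl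
  · rintro (_ | j) hj
    · rfl
    · rw [toF, h j (by omega), srt_empty]

theorem RF.exists_toF {w : Equiv.Perm ℕ} {F : ℕ → List ℕ} {M : ℕ} (h0 : F 0 = [])
    (hM : ∀ j, M < j → F j = []) (hinc : IncreasingFact F)
    (hw : IsReducedWordFor w (factWord F)) : ∃ b : RF w, toF b.val = F := by
  have he := toF_eq_of h0 hinc
  have hB : Bd (fun m => (F (m + 1)).toFinset) M := fun m hm => by
    dsimp only
    rw [hM (m + 1) (by omega)]
    rfl
  refine ⟨⟨_, M, hB, ?_⟩, he⟩
  rw [← factWord_toF hB, he]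
  exact hw

theorem RF.isReducedWordFor {w : Equiv.Perm ℕ} (b : RF w) :
    IsReducedWordFor w (factWord (toF b.val)) := by
  obtain ⟨M, hB, h⟩ := b.isRF
  rwa [factWord_toF hB]

theorem RF.toF_mem_RFn {w : Equiv.Perm ℕ} {b : RF w} {n : ℕ} :
    toF b.val ∈ RFn n w ↔ ∀ m, n ≤ m → b.val m = ∅ := by
  constructor
  · rintro ⟨-, h, -⟩ m hm
    exact srt_eq_nil.1 (h (m + 1) (by omega))
  · refine fun h => ⟨rfl, ?_, increasingFact_toF _, b.isReducedWordFor⟩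
    rintro (_ | j) hj
    · rfl
    · exact srt_eq_nil.2 (h j (by omega))

/-! ### The pairing rule -/

theorem srt_erase (A : Finset ℕ) (a : ℕ) : srt (A.erase a) = (srt A).erase a := by
  have hp := pairwise_srt A
  apply srt_eq (hp.sublist List.erase_sublist)
  intro x
  rw [List.Nodup.mem_erase_iff (hp.imp fun h => h.ne), Finset.mem_erase, mem_srt]

theorem mem_insAsc {x y : ℕ} {l : List ℕ} : y ∈ insAsc x l ↔ y = x ∨ y ∈ l := by
  induction l with
  | nil => simp [insAsc]
  | cons z l ih =>
    rw [insAsc]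
    split_ifs
    · simp
    · rw [List.mem_cons, ih, List.mem_cons]; tauto

theorem insAsc_pairwise {x : ℕ} {l : List ℕ} (hx : x ∉ l) (h : l.Pairwise (· < ·)) :
    (insAsc x l).Pairwise (· < ·) := by
  induction l with
  | nil => simp [insAsc]
  | cons z l ih =>
    rw [List.pairwise_cons] at h
    rw [List.mem_cons, not_or] at hx
    rw [insAsc]
    split_ifs with hz
    · rw [List.pairwise_cons, List.pairwise_cons]
      refine ⟨fun a ha => ?_, h⟩
      rcases List.mem_cons.1 ha with rfl | ha
      · exact lt_of_le_of_ne hz hx.1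
      · exact hz.trans_lt (h.1 a ha)
    · rw [List.pairwise_cons]
      refine ⟨fun a ha => ?_, ih hx.2 h.2⟩
      rcases mem_insAsc.1 ha with rfl | ha
      · omega
      · exact h.1 a ha

theorem srt_insert {A : Finset ℕ} {c : ℕ} (hc : c ∉ A) : srt (insert c A) = insAsc c (srt A) := by
  apply srt_eq (insAsc_pairwise (by rwa [mem_srt]) (pairwise_srt A))
  intro x
  rw [mem_insAsc, mem_srt, Finset.mem_insert]

theorem foldr_max_eq {l : List ℕ} {m : ℕ} (hm : m ∈ l) (h : ∀ x ∈ l, x ≤ m) :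
    l.foldr max 0 = m := by
  have le1 : ∀ l : List ℕ, (∀ x ∈ l, x ≤ m) → l.foldr max 0 ≤ m := fun l => by
    induction l with
    | nil => intro _; exact Nat.zero_le _
    | cons a l ih =>
      intro h
      exact max_le (h a (by simp)) (ih fun x hx => h x (by simp [hx]))
  have le2 : ∀ l : List ℕ, ∀ x ∈ l, x ≤ l.foldr max 0 := fun l => by
    induction l with
    | nil => simp
    | cons a l ih =>
      intro x hx
      rcases List.mem_cons.1 hx with rfl | hx
      · exact le_max_left _ _
      · exact (ih x hx).trans (le_max_right _ _)
  exact le_antisymm (le1 l h) (le2 l m hm)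

theorem ht_const {A B : Finset ℕ} {b : ℕ} {y : ℤ} (hB : ∀ x ∈ B, x < b) (hy : (b : ℤ) ≤ y)
    (hA : ∀ a ∈ A, b < a → y < a) : ht (zi A) (zi B) y = ht (zi A) (zi B) b := by
  unfold ht
  congr 1
  · refine Finset.sum_congr rfl fun x hx => ?_
    obtain ⟨a, rfl, ha⟩ := exists_of_mem_zi hx
    have := hA a ha
    congr 1
    simp only [eq_iff_iff]
    constructor
    · intro h; by_contra hc; have := this (by omega); omega
    · omega
  · refine Finset.sum_congr rfl fun x hx => ?_
    obtain ⟨a, rfl, ha⟩ := exists_of_mem_zi hx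
    have := hB a ha
    congr 1
    simp only [eq_iff_iff]
    omega

theorem exists_unpairedUpper (bs : List ℕ) : ∀ A : Finset ℕ, bs.Pairwise (· > ·) →
    ∃ L : Finset ℕ, unpairedUpper bs (srt A) = srt L ∧
      ∀ x : ℤ, ht (zi A) (zi bs.toFinset) x ≤ ht (zi L) ∅ x ∧
        (ht (zi L) ∅ x = 0 ∨ ∃ y ≤ x, ht (zi A) (zi bs.toFinset) y = ht (zi L) ∅ x) := by
  induction bs with
  | nil => exact fun A _ => ⟨A, rfl, fun x => ⟨le_rfl, Or.inr ⟨x, le_rfl, rfl⟩⟩⟩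
  | cons b bs ih =>
    intro A hp
    rw [List.pairwise_cons] at hp
    have hB : ∀ x ∈ bs.toFinset, x < b := fun x hx => hp.1 x (List.mem_toFinset.1 hx)
    have hb : (b : ℤ) ∉ zi bs.toFinset := fun h => (hB b (mem_zi.1 h)).false
    rw [List.toFinset_cons, zi_insert]
    -- it suffices to compare with a smaller pairing problem
    suffices ∃ A' : Finset ℕ, unpairedUpper (b :: bs) (srt A) = unpairedUpper bs (srt A') ∧
        ∀ y : ℤ, ht (zi A) (insert (b : ℤ) (zi bs.toFinset)) y ≤ ht (zi A') (zi bs.toFinset) y ∧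
          (ht (zi A) (insert (b : ℤ) (zi bs.toFinset)) y ≠ ht (zi A') (zi bs.toFinset) y →
            b < y ∧ ∀ a ∈ A', b < a → y < a) by
      obtain ⟨A', h1, h2⟩ := this
      obtain ⟨L, h3, h4⟩ := ih A' hp.2
      refine ⟨L, h1.trans h3, fun x => ⟨(h2 x).1.trans (h4 x).1, (h4 x).2.imp_right ?_⟩⟩
      rintro ⟨y, hy, he⟩
      by_cases hne : ht (zi A) (insert (b : ℤ) (zi bs.toFinset)) y = ht (zi A') (zi bs.toFinset) y
      · exact ⟨y, hy, hne.trans he⟩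
      · obtain ⟨h5, h6⟩ := (h2 y).2 hne
        refine ⟨b, by omega, ?_⟩
        by_cases hne' : ht (zi A) (insert (b : ℤ) (zi bs.toFinset)) b =
            ht (zi A') (zi bs.toFinset) b
        · rw [hne', ← he]
          exact (ht_const hB h5.le h6).symm
        · exact absurd ((h2 b).2 hne').1 (lt_irrefl _)
    rw [unpairedUpper]
    cases hf : (srt A).find? (fun a => decide (b < a)) with
    | none =>
      refine ⟨A, rfl, fun y => ?_⟩
      rw [ht_insert_lower hb]
      rw [List.find?_eq_none] at hf
      have hA : ∀ a ∈ A, ¬ b < a := fun a ha => by simpa using hf a (mem_srt.2 ha)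
      split_ifs with h
      · exact ⟨by omega, fun _ => ⟨h, fun a ha hba => absurd hba (hA a ha)⟩⟩
      · exact ⟨by omega, fun hc => absurd (sub_zero _) hc⟩
    | some a =>
      rw [List.find?_eq_some_iff_append] at hf
      obtain ⟨hba, l1, l2, hl, hl1⟩ := hf
      have hba : b < a := by simpa using hba
      have haA : a ∈ A := by rw [← mem_srt, hl]; simp
      have hmin : ∀ x ∈ A, b < x → x ≠ a → a < x := fun x hx hbx hxa => by
        have hps := pairwise_srt A
        rw [← mem_srt, hl] at hx
        rw [hl] at hps
        rcases List.mem_append.1 hx with hx | hx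
        · have := hl1 x hx
          simp at this
          omega
        · rcases List.mem_cons.1 hx with hx | hx
          · exact absurd hx hxa
          · exact (List.pairwise_cons.1 (List.pairwise_append.1 hps).2.1).1 x hx
      refine ⟨A.erase a, by rw [srt_erase], fun y => ?_⟩
      rw [ht_insert_lower hb, zi_erase, ht_erase_upper (mem_zi.2 haA)]
      constructor
      · split_ifs <;> omega
      · intro hne
        have : (b : ℤ) < y ∧ y < a := by
          split_ifs at hne <;> omega
        refine ⟨this.1, fun x hx hbx => ?_⟩
        have := hmin x (Finset.mem_of_mem_erase hx) hbx (Finset.ne_of_mem_erase hx)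
        omega

theorem ht_empty_eq (L : Finset ℤ) (x : ℤ) : ht L ∅ x = (L.filter (· ≤ x)).card := by
  simp [ht]

theorem unpairedUpper_of_hEps {A B : Finset ℕ} (h : hEps (zi A) (zi B) = 0) :
    unpairedUpper (srt B).reverse (srt A) = [] := by
  obtain ⟨L, h1, h2⟩ := exists_unpairedUpper (srt B).reverse A
    (List.pairwise_reverse.2 (pairwise_srt B))
  have hB : (srt B).reverse.toFinset = B := by ext; simp [mem_srt]
  rw [hB] at h2
  rw [h1, srt_eq_nil, Finset.eq_empty_iff_forall_notMem]
  intro a ha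
  have hpos : 0 < ht (zi L) ∅ a := by
    rw [ht_empty_eq]
    exact_mod_cast Finset.card_pos.2 ⟨(a : ℤ), by simp [mem_zi, ha]⟩
  rcases (h2 a).2 with h3 | ⟨y, -, h3⟩
  · omega
  · have := ht_le_hEps (zi A) (zi B) y
    omega

theorem unpairedUpper_of_isStep {A B : Finset ℕ} {a : ℕ} {r : ℤ}
    (h : IsStep (zi A) (zi B) a r) :
    unpairedUpper (srt B).reverse (srt A) ≠ [] ∧
      (unpairedUpper (srt B).reverse (srt A)).foldr max 0 = a := by
  obtain ⟨L, h1, h2⟩ := exists_unpairedUpper (srt B).reverse A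
    (List.pairwise_reverse.2 (pairwise_srt B))
  have hB : (srt B).reverse.toFinset = B := by ext; simp [mem_srt]
  rw [hB] at h2
  have hpos := h.pos
  have hle : ∀ x, ht (zi L) ∅ x ≤ ht (zi A) (zi B) a := fun x => by
    rcases (h2 x).2 with h3 | ⟨y, -, h3⟩
    · omega
    · rw [← h3]; exact h.max y
  have hfull : ∀ x ∈ L, x ≤ a := fun x hx => by
    by_contra! hc
    have e1 := (h2 a).1
    have e2 := hle x
    have e3 : ht (zi L) ∅ a < ht (zi L) ∅ x := by
      rw [ht_empty_eq, ht_empty_eq]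
      norm_cast
      apply Finset.card_lt_card
      rw [Finset.ssubset_iff_of_subset]
      · refine ⟨x, by simp [mem_zi, hx], by simp; omega⟩
      · intro z hz
        rw [Finset.mem_filter] at hz ⊢
        exact ⟨hz.1, by omega⟩
    omega
  have hmem : a ∈ L := by
    by_contra hc
    have he : ht (zi L) ∅ a = ht (zi L) ∅ (a - 1) := by
      rw [ht_empty_eq, ht_empty_eq]
      congr 2
      ext z
      rw [Finset.mem_filter, Finset.mem_filter]
      refine and_congr_right fun hz => ?_
      have : z ≠ a := by rintro rfl; exact hc (mem_zi.1 hz)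
      omega
    have e1 := (h2 a).1
    rcases (h2 (a - 1)).2 with h3 | ⟨y, hy, h3⟩
    · omega
    · have := h.lt y (by omega)
      omega
  rw [h1]
  refine ⟨fun hc => ?_, foldr_max_eq (mem_srt.2 hmem) fun x hx => hfull x (mem_srt.1 hx)⟩
  rw [srt_eq_nil] at hc
  simp [hc] at hmem

/-! ### The raising operators -/

theorem RF.msE_of_eps {w : Equiv.Perm ℕ} {i : ℕ} {x : RF w} (h : (RC w).eps i x = 0) :
    msE (i + 1) (toF x.val) = none := by
  have := unpairedUpper_of_hEps (A := x.val (i + 1)) (B := x.val i) h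
  simp only [msE, toF, this, if_true]

theorem RF.msE_of_step {w : Equiv.Perm ℕ} {i : ℕ} {x y : RF w} (h : (RC w).step i x y) :
    msE (i + 1) (toF x.val) = some (toF y.val) := by
  obtain ⟨a, n, hs, h1, h0, hm⟩ := RF.exists_of_step h
  obtain ⟨e1, e2⟩ := unpairedUpper_of_isStep hs
  have e3 : sInf {j : ℕ | (a + j + 1) ∉ srt (x.val (i + 1))} = n := by
    apply le_antisymm
    · apply Nat.sInf_le
      rw [Set.mem_ofPred_eq, mem_srt]
      intro hc
      exact hs.succ_not_memA (by exact_mod_cast mem_zi.2 hc)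
    · refine le_csInf ⟨n, ?_⟩ fun j hj => ?_
      · rw [Set.mem_ofPred_eq, mem_srt]
        intro hc
        exact hs.succ_not_memA (by exact_mod_cast mem_zi.2 hc)
      · by_contra! hc
        apply hj
        rw [mem_srt, ← mem_zi]
        exact hs.memA _ (by push_cast; omega) (by push_cast; omega)
  have hnB : a + n ∉ x.val i := fun hc => hs.not_memB (mem_zi.2 hc)
  simp only [msE, toF, e1, if_false, e2, e3, Option.some.injEq]
  funext m
  by_cases hm0 : m = i + 1
  · subst hm0
    rw [Function.update_self, toF, h0, srt_insert hnB]
  · rw [Function.update_of_ne hm0]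
    by_cases hm1 : m = i + 2
    · subst hm1
      rw [Function.update_self, toF, h1, srt_erase]
    · rw [Function.update_of_ne hm1]
      cases m with
      | zero => rfl
      | succ m => rw [toF, toF, hm m (by omega) (by omega)]

/-! ### Demazure subcrystals -/

theorem WC.Region.of_step {cs y x : List ℕ} {i : ℕ} (h : WC.Region [] cs y)
    (hs : WC.step i y x) : WC.Region [] cs x := by
  induction cs generalizing y x with
  | nil =>
    obtain rfl : y = [] := h
    have := WC.step_eps hs
    have h0 := WC.eps_nil i
    omega
  | cons c cs ih =>
    obtain ⟨q, b, rfl, h1, h2⟩ := h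
    rcases WC.step_cons_inv hs with ⟨rfl, -, rfl⟩ | ⟨b', h3, rfl, -⟩
    · exact ⟨i, b, rfl, by omega, h2⟩
    · exact ⟨q, b', rfl, h1, ih h2 h3⟩

theorem Crys.ups_eq_of_step {X : Type} {K : Crys X} {u : X} (hu : K.IsHW u)
    (hfin : ∃ N, ∀ m, N ≤ m → K.phi m u = 0) {l : List ℕ} {b b' : X} {i : ℕ}
    (h : K.ups l b = u) (hs : K.step i b b') : K.ups l b' = u := by
  obtain ⟨cs, z, -, -, c, hc⟩ := Crys.exists_region hu hfin l
  have hb : K.Reach b u := h ▸ reach_ups l b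
  obtain ⟨y, hy⟩ := c.exists_rel hb
  obtain ⟨y', hy', hrel⟩ := hy.step hs
  exact (hc _ _ hrel).1 (((hc _ _ hy).2 h).of_step hy')

namespace RF

variable {w : Equiv.Perm ℕ} {n : ℕ}

/-- All blocks of index at least `n` are empty. -/
def Short (n : ℕ) (b : RF w) : Prop := Bd b.val n

theorem Short.of_step {b b' : RF w} {i : ℕ} (h : b.Short n) (hi : i + 1 < n)
    (hs : (RC w).step i b b') : b'.Short n := fun m hm => by
  obtain ⟨a, k, -, -, -, h1⟩ := exists_of_step hs
  rw [h1 m (by omega) (by omega), h m hm]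

theorem Short.up {b : RF w} {i : ℕ} (h : b.Short n) (hi : i + 1 < n) :
    ((RC w).up i b).Short n := by
  induction b using Crys.up_induction (K := RC w) (i := i) with
  | h0 x hx => rwa [Crys.up_of_eps hx]
  | h1 x y hs ih => rw [Crys.up_of_step hs]; exact ih (h.of_step hi hs)

theorem Short.eps {b : RF w} {i : ℕ} (h : b.Short n) (hi : n ≤ i + 1) : (RC w).eps i b = 0 := by
  by_contra hc
  obtain ⟨y, hy⟩ := (RC w).exists_step (Nat.pos_of_ne_zero hc)
  obtain ⟨a, k, h1, -⟩ := exists_of_step hy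
  have := mem_zi.1 h1.mem_left
  rw [h (i + 1) hi] at this
  simp at this

theorem Short.ups_filter {b : RF w} (h : b.Short n) (l : List ℕ) :
    (RC w).ups (l.filter (· + 1 < n)) b = (RC w).ups l b := by
  induction l generalizing b with
  | nil => rfl
  | cons i l ih =>
    by_cases hi : i + 1 < n
    · rw [List.filter_cons_of_pos (by simpa using hi)]
      exact ih (h.up hi)
    · rw [List.filter_cons_of_neg (by simpa using hi), ih h, Crys.ups,
        Crys.up_of_eps (h.eps (by omega))]

theorem exists_of_msEIter {i k : ℕ} {b : RF w} {c : ℕ → List ℕ}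
    (h : msEIter (i + 1) k (toF b.val) = some c) :
    ∃ b' : RF w, toF b'.val = c ∧ Relation.ReflTransGen ((RC w).step i) b b' := by
  induction k generalizing b with
  | zero => exact ⟨b, Option.some.inj h, .refl⟩
  | succ k ih =>
    rw [msEIter] at h
    rcases Nat.eq_zero_or_pos ((RC w).eps i b) with h0 | h0
    · rw [msE_of_eps h0] at h
      simp at h
    · obtain ⟨y, hy⟩ := (RC w).exists_step h0
      rw [msE_of_step hy, Option.bind_some] at h
      obtain ⟨b', h1, h2⟩ := ih h
      exact ⟨b', h1, .head hy h2⟩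

theorem exists_msEIter_up (i : ℕ) (b : RF w) :
    ∃ k, msEIter (i + 1) k (toF b.val) = some (toF ((RC w).up i b).val) := by
  induction b using Crys.up_induction (K := RC w) (i := i) with
  | h0 x hx => exact ⟨0, by rw [Crys.up_of_eps hx]; rfl⟩
  | h1 x y hs ih =>
    obtain ⟨k, hk⟩ := ih
    exact ⟨k + 1, by rw [msEIter, msE_of_step hs, Crys.up_of_step hs]; exact hk⟩

theorem toF_val_injective : Function.Injective fun b : RF w => toF b.val :=
  fun _ _ h => RF.ext (toF_injective h)

theorem mem_demWord {u : RF w} (hu : (RC w).IsHW u) (hE : u.Short n) {l : List ℕ}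
    (hl : ∀ i ∈ l, i + 1 < n) {b : RF w} :
    toF b.val ∈ demWord n w (l.map (· + 1)) {toF u.val} ↔ b.Short n ∧ (RC w).ups l b = u := by
  have hfin := (rfModel w).phi_fin u
  induction l generalizing b with
  | nil =>
    rw [List.map_nil, demWord, Set.mem_singleton_iff, toF_val_injective.eq_iff, Crys.ups]
    exact ⟨fun h => ⟨h ▸ hE, h⟩, fun h => h.2⟩
  | cons i l ih =>
    have ih := @ih fun k hk => hl k (by simp [hk])
    rw [List.map_cons, demWord, demOp, Set.mem_ofPred_eq, toF_mem_RFn]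
    refine and_congr_right fun hb => ⟨?_, fun h => ?_⟩
    · rintro ⟨k, c, hk, hc⟩
      obtain ⟨b', rfl, hb'⟩ := exists_of_msEIter hk
      have h1 := (ih.1 hc).2
      clear hk hc hb
      induction hb' using Relation.ReflTransGen.head_induction_on with
      | refl =>
        rw [Crys.ups]
        induction b' using Crys.up_induction (K := RC w) (i := i) with
        | h0 x hx => rwa [Crys.up_of_eps hx]
        | h1 x y hs ih' =>
          rw [Crys.up_of_step hs]
          exact ih' (Crys.ups_eq_of_step hu hfin h1 hs)
      | head hs _ ih' => rwa [Crys.ups, Crys.up_of_step hs]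
    · obtain ⟨k, hk⟩ := exists_msEIter_up i b
      exact ⟨k, _, hk, ih.2 ⟨Short.up hb (hl i (by simp)), h⟩⟩

theorem exists_of_mem_demWord {u : RF w} {l : List ℕ} {F : ℕ → List ℕ}
    (h : F ∈ demWord n w l {toF u.val}) : ∃ b : RF w, toF b.val = F := by
  cases l with
  | nil => exact ⟨u, (Set.mem_singleton_iff.1 h).symm⟩
  | cons i l =>
    obtain ⟨⟨h0, hM, hinc, hred⟩, -⟩ := h
    exact exists_toF h0 hM hinc hred

/-! ### Flags and thresholds -/

/-- The smallest letters allowed in the blocks of a flagged factorization with `n` blocks. -/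
def flagThr (φ : ℕ → ℕ) (n m : ℕ) : ℕ :=
  if m < n then sInf {a | 1 ≤ a ∧ m + 1 ≤ φ a} else m + 1

variable {φ : ℕ → ℕ}

theorem flagThr_mem (hφ : IsFlag φ) {m : ℕ} (h : m < n) :
    flagThr φ n m ∈ {a | 1 ≤ a ∧ m + 1 ≤ φ a} := by
  rw [flagThr, if_pos h]
  exact Nat.sInf_mem ⟨m + 1, by omega, hφ.2 _ (by omega)⟩

theorem flagThr_le (hφ : IsFlag φ) (m : ℕ) : flagThr φ n m ≤ m + 1 := by
  unfold flagThr
  split_ifs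
  · exact Nat.sInf_le ⟨by omega, hφ.2 _ (by omega)⟩
  · exact le_rfl

theorem flagThr_monotone (hφ : IsFlag φ) : Monotone (flagThr φ n) := by
  intro m m' h
  by_cases h' : m' < n
  · have := flagThr_mem hφ h'
    rw [flagThr, if_pos (by omega)]
    exact Nat.sInf_le ⟨this.1, by have := this.2; omega⟩
  · refine (flagThr_le hφ m).trans ?_
    rw [flagThr, if_neg h']
    omega

theorem flaggedFact_iff (hφ : IsFlag φ) {b : RF w} :
    FlaggedFact φ (toF b.val) ↔ ∀ m, ∀ x ∈ b.val m, m + 1 ≤ φ x := by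
  constructor
  · intro h m x hx
    have hp := pairwise_srt (b.val m)
    have h1 := h (m + 1)
    rw [← mem_srt] at hx
    rw [toF] at h1
    cases hl : srt (b.val m) with
    | nil => simp [hl] at hx
    | cons c l =>
      rw [hl] at h1 hp hx
      have h2 := h1 (by simp)
      rw [List.headI] at h2
      have hc : c ∈ b.val m := by rw [← mem_srt, hl]; simp
      refine h2.trans (hφ.1 _ _ (b.isRF.pos hc) ?_)
      rcases List.mem_cons.1 hx with rfl | hx
      · exact le_rfl
      · exact ((List.pairwise_cons.1 hp).1 x hx).le
  · rintro h (_ | m) hne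
    · exact absurd rfl hne
    · rw [toF] at hne ⊢
      cases hl : srt (b.val m) with
      | nil => exact absurd hl hne
      | cons c l => exact h m c (by rw [← mem_srt, hl]; simp)

theorem toF_mem_RFCset (hφ : IsFlag φ) {b : RF w} :
    toF b.val ∈ RFCset w φ ↔ ∀ m, ∀ x ∈ b.val m, m + 1 ≤ φ x := by
  rw [← flaggedFact_iff hφ]
  refine ⟨fun h => h.2.2.2.1, fun h => ⟨rfl, ?_, increasingFact_toF _, h, b.isReducedWordFor⟩⟩
  obtain ⟨M, hB, -⟩ := b.isRF
  refine (Set.finite_Iic M).subset ?_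
  rintro (_ | m) hm
  · exact Nat.zero_le _
  · by_contra hc
    have hm' : M ≤ m := by
      rw [Set.mem_Iic] at hc
      omega
    exact hm (srt_eq_nil.2 (hB m hm'))

theorem exists_of_mem_RFCset {F : ℕ → List ℕ} (h : F ∈ RFCset w φ) :
    ∃ b : RF w, toF b.val = F := by
  obtain ⟨h0, hfin, hinc, -, hred⟩ := h
  obtain ⟨M, hM⟩ := hfin.bddAbove
  refine exists_toF h0 (M := M) (fun j hj => ?_) hinc hred
  by_contra hc
  exact absurd (hM hc) (by omega)

theorem thr_flagThr (hφ : IsFlag φ) (hbig : ∀ f ∈ RFCset w φ, ∀ j, n < j → f j = []) {b : RF w} :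
    Thr (flagThr φ n) b ↔ toF b.val ∈ RFCset w φ := by
  constructor
  · rw [toF_mem_RFCset hφ]
    intro h m x hx
    have h1 := h m x hx
    by_cases hm : m < n
    · have h2 := flagThr_mem hφ hm
      exact h2.2.trans (hφ.1 _ _ h2.1 h1)
    · rw [flagThr, if_neg hm] at h1
      exact h1.trans (hφ.2 x (b.isRF.pos hx))
  · intro h m x hx
    by_cases hm : m < n
    · rw [flagThr, if_pos hm]
      exact Nat.sInf_le ⟨b.isRF.pos hx, (toF_mem_RFCset hφ).1 h m x hx⟩
    · have := srt_eq_nil.1 (hbig _ h (m + 1) (by omega))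
      simp [this] at hx

theorem exists_demWord_eq (hw : FinitaryPerm w) (hφ : IsFlag φ) (hn : 1 ≤ n)
    (hbig : ∀ f ∈ RFCset w φ, ∀ j, n < j → f j = []) {u : RF w} (hu : (RC w).IsHW u)
    (hne : ∃ b, (RC w).Reach b u ∧ toF b.val ∈ RFCset w φ) :
    u.Short n ∧ ∃ l, NF (n - 1) l ∧
      (fun b : RF w => toF b.val) '' {b | (RC w).Reach b u ∧ toF b.val ∈ RFCset w φ} =
        demWord n w (l.map (· + 1)) {toF u.val} := by
  have hthr := fun b : RF w => thr_flagThr (b := b) hφ hbig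
  have hshort : ∀ b : RF w, toF b.val ∈ RFCset w φ → b.Short n := fun b h m hm =>
    srt_eq_nil.1 (hbig _ h (m + 1) (by omega))
  obtain ⟨l, hl⟩ := dt_thr hw (n := n) hu (flagThr_monotone hφ)
    (flagThr_mem (n := n) hφ (Nat.lt_of_lt_of_le Nat.zero_lt_one hn)).1 (flagThr_le hφ)
    (fun m hm => if_neg hm.not_gt) (by simpa only [hthr] using hne)
  simp only [hthr] at hl
  have hE : u.Short n := hshort u ((hl u .refl).2 (hu.ups_eq l))
  obtain ⟨l', h1, h2⟩ := Crys.exists_nf hu ((rfModel w).phi_fin u) (n := n - 1)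
    (l.filter (· + 1 < n)) (fun i hi => by
      have := (List.mem_filter.1 hi).2
      simp only [decide_eq_true_eq] at this
      omega)
  refine ⟨hE, l', h1, ?_⟩
  have key : ∀ b : RF w, toF b.val ∈ demWord n w (l'.map (· + 1)) {toF u.val} ↔
      b.Short n ∧ (RC w).ups l' b = u := fun b =>
    mem_demWord hu hE fun i hi => by have := h1.lt i hi; omega
  ext F
  constructor
  · rintro ⟨b, ⟨hb, hF⟩, rfl⟩
    refine (key b).2 ⟨hshort b hF, ?_⟩
    rw [← h2 b hb, (hshort b hF).ups_filter]
    exact (hl b hb).1 hF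
  · intro hF
    obtain ⟨b, rfl⟩ := exists_of_mem_demWord hF
    obtain ⟨hs, h3⟩ := (key b).1 hF
    have hb : (RC w).Reach b u := h3 ▸ Crys.reach_ups l' b
    rw [← h2 b hb, hs.ups_filter] at h3
    exact ⟨b, ⟨hb, (hl b hb).2 h3⟩, rfl⟩

end RF

/-- Corollary 1.3.
For every `w ∈ S∞` and flag `φ`, the set `RFC(w, φ)`, with the Morse–Schilling crystal
operators of `RF_n(w)` restricted to it (for `n` sufficiently large that
`RFC(w, φ) ⊆ RF_n(w)`), is a disjoint union of Demazure crystals: it can be partitioned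
into subsets each of which is a Demazure subcrystal `𝔇_σ{u^•} = 𝔇_{i_1} ⋯ 𝔇_{i_k} {u^•}`
of `RF_n(w)` for some highest weight element `u^•` and reduced word `i_1 ⋯ i_k` of a
permutation `σ ∈ S_n`. -/
theorem RFC_disjoint_union_of_demazure (w : Equiv.Perm ℕ) (hw : FinitaryPerm w)
    (φ : ℕ → ℕ) (hφ : IsFlag φ) (n : ℕ) (hn : 1 ≤ n)
    (hbig : ∀ f ∈ RFCset w φ, ∀ j, n < j → f j = []) :
    ∃ Parts : Set (Set (ℕ → List ℕ)),
      ⋃₀ Parts = RFCset w φ ∧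
      (∀ A ∈ Parts, ∀ B ∈ Parts, A ≠ B → A ∩ B = ∅) ∧
      ∀ A ∈ Parts, ∃ (u : ℕ → List ℕ) (l : List ℕ),
        u ∈ RFn n w ∧ (∀ i, 1 ≤ i → i < n → msE i u = none) ∧
        IsReducedWord l ∧ (∀ x ∈ l, 1 ≤ x ∧ x < n) ∧
        A = demWord n w l {u} := by
  refine ⟨{S | ∃ u : RF w, (RC w).IsHW u ∧
    (∃ b, (RC w).Reach b u ∧ toF b.val ∈ RFCset w φ) ∧
    S = (fun b : RF w => toF b.val) '' {b | (RC w).Reach b u ∧ toF b.val ∈ RFCset w φ}},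
    ?_, ?_, ?_⟩
  · ext F
    constructor
    · rintro ⟨S, ⟨u, -, -, rfl⟩, b, ⟨-, hb⟩, rfl⟩
      exact hb
    · intro hF
      obtain ⟨b, rfl⟩ := RF.exists_of_mem_RFCset hF
      obtain ⟨u, hu, hb⟩ := Crys.exists_hw (RC w) b
      exact ⟨_, ⟨u, hu, ⟨b, hb, hF⟩, rfl⟩, b, ⟨hb, hF⟩, rfl⟩
  · rintro _ ⟨u, hu, -, rfl⟩ _ ⟨v, hv, -, rfl⟩ hne
    rw [Set.eq_empty_iff_forall_notMem]
    rintro _ ⟨⟨b, ⟨hb, -⟩, rfl⟩, b', ⟨hb', -⟩, he⟩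
    obtain rfl := RF.toF_val_injective he
    obtain rfl := Crys.hw_unique hu hv hb hb'
    exact hne rfl
  · rintro _ ⟨u, hu, hne, rfl⟩
    obtain ⟨hE, l, hl, heq⟩ := RF.exists_demWord_eq hw hφ hn hbig hu hne
    refine ⟨toF u.val, l.map (· + 1), RF.toF_mem_RFn.2 hE, ?_, hl.isReducedWord, ?_, heq⟩
    · rintro (_ | i) hi -
      · omega
      · exact RF.msE_of_eps (hu i)
    · intro x hx
      obtain ⟨i, hi, rfl⟩ := List.mem_map.1 hx
      have := hl.lt i hi
      omega

end
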